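/- arXiv:2004.14680 — 3 statements merged into one kernel-verified Lean document; each statement's English description precedes it below -/
import Mathlib

section
/- Let u_n be as in the general blow-up setting (solutions of −Δu_n + 2K̂_n = 2K_n e^{u_n} in 𝔻, ∂u_n/∂ν + 2ĥ_n = 2h_n e^{u_n/2} on ∂𝔻, with coefficients converging in C² and bounded mass ∫_𝔻 e^{u_n} + ∫_{∂𝔻} e^{u_n/2} ≤ C). (a) If p ∈ 𝔻 and r > 0 with B_r(p) ⊂ 𝔻, and ∫_{B_r(p)} K_n⁺ e^{u_n} ≤ ε < 2π, then u_n⁺ is uniformly bounded in L^∞(B_{r/2}(p)). (b) If p ∈ ∂𝔻 and ∫_{B_r(p) ∩ closure 𝔻} K_n⁺ e^{u_n} ≤ ε < π/2 and ∫_{B_r(p) ∩ ∂𝔻} h_n⁺ e^{u_n/2} ≤ ε < π/2, then u_n⁺ is uniformly bounded in L^∞(B_{r/2}(p) ∩ closure 𝔻). -/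
open MeasureTheory Filter

noncomputable section

/-- The open unit disk in ℝ² ≅ ℂ. -/
def unitDisk : Set ℂ := Metric.ball 0 1

/-- The closed unit disk. -/
def unitClosedDisk : Set ℂ := Metric.closedBall 0 1

/-- The unit circle ∂𝔻. -/
def unitCircle : Set ℂ := Metric.sphere 0 1

/-- Arc-length measure: the 1-dimensional Hausdorff measure on ℂ. -/
def arcMeasure : Measure ℂ := μH[1]

/-- Directional derivative of `u` at `z` in direction `v`. -/
def dirDeriv (v : ℂ) (u : ℂ → ℝ) (z : ℂ) : ℝ := fderiv ℝ u z v

/-- Euclidean gradient of `u` at `z`, realized as a complex number. -/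
def grad (u : ℂ → ℝ) (z : ℂ) : ℂ := ⟨dirDeriv 1 u z, dirDeriv Complex.I u z⟩

/-- Euclidean Laplacian. -/
def lap (u : ℂ → ℝ) (z : ℂ) : ℝ :=
  dirDeriv 1 (dirDeriv 1 u) z + dirDeriv Complex.I (dirDeriv Complex.I u) z

/-- Outward normal derivative on the unit circle: ν(z) = z. -/
def normalDeriv (u : ℂ → ℝ) (z : ℂ) : ℝ := fderiv ℝ u z z

/-- Tangential derivative on the unit circle: τ(z) = iz. -/
def tangentialDeriv (u : ℂ → ℝ) (z : ℂ) : ℝ := fderiv ℝ u z (Complex.I * z)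

/-- Euclidean dot product on ℂ ≅ ℝ². -/
def dot (z w : ℂ) : ℝ := z.re * w.re + z.im * w.im

/-- `u` solves `-Δu = 2K e^u` in 𝔻, `∂u/∂ν + 2 = 2h e^{u/2}` on ∂𝔻. -/
def SolvesLiouville (K h u : ℂ → ℝ) : Prop :=
  (∀ z ∈ unitDisk, -lap u z = 2 * K z * Real.exp (u z)) ∧
  (∀ z ∈ unitCircle, normalDeriv u z + 2 = 2 * h z * Real.exp (u z / 2))

/-- Convergence in C² on a set: uniform convergence of the derivatives up to order 2. -/
def TendstoC2On (F : ℕ → ℂ → ℝ) (G : ℂ → ℝ) (s : Set ℂ) : Prop :=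
  ∀ i : ℕ, i ≤ 2 →
    TendstoUniformlyOn (fun n => iteratedFDeriv ℝ i (F n)) (iteratedFDeriv ℝ i G)
      Filter.atTop s

/-- `sup u_n → +∞` on the closed disk. -/
def BlowsUp (u : ℕ → ℂ → ℝ) : Prop :=
  ∀ M : ℝ, ∀ᶠ n in Filter.atTop, ∃ z ∈ unitClosedDisk, M < u n z

/-- `u_n → -∞` locally uniformly on `s`. -/
def TendstoLocallyUniformlyBotOn (u : ℕ → ℂ → ℝ) (s : Set ℂ) : Prop :=
  ∀ (M : ℝ) (S : Set ℂ), IsCompact S → S ⊆ s →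
    ∀ᶠ n in Filter.atTop, ∀ z ∈ S, u n z < M

/-- Bounded total mass: area plus boundary length. -/
def MassBound (u : ℕ → ℂ → ℝ) (C : ℝ) : Prop :=
  ∀ n, (∫ z in unitDisk, Real.exp (u n z)) +
       (∫ z in unitCircle, Real.exp (u n z / 2) ∂arcMeasure) ≤ C

/-- `u` solves the general problem `-Δu + 2K̂ = 2K e^u` in 𝔻,
`∂u/∂ν + 2ĥ = 2h e^{u/2}` on ∂𝔻. -/
def SolvesLiouvilleGen (K Khat h hhat u : ℂ → ℝ) : Prop :=
  (∀ z ∈ unitDisk, -lap u z + 2 * Khat z = 2 * K z * Real.exp (u z)) ∧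
  (∀ z ∈ unitCircle, normalDeriv u z + 2 * hhat z = 2 * h z * Real.exp (u z / 2))

open Topology
open scoped ENNReal

lemma hasDerivAt_comp_max_zero {g g' : ℝ → ℝ} {x : ℝ}
    (hg : HasDerivAt g (g' (max x 0)) (max x 0)) (h0 : g 0 = 0) (h0' : g' 0 = 0) :
    HasDerivAt (fun x => g (max x 0)) (g' (max x 0)) x := by
  rcases lt_trichotomy x 0 with hx | hx | hx
  · rw [max_eq_right hx.le, h0']
    refine (hasDerivAt_const x (0 : ℝ)).congr_of_eventuallyEq ?_
    filter_upwards [Iio_mem_nhds hx] with y hy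
    rw [max_eq_right (le_of_lt hy), h0]
  · subst hx
    rw [max_self, h0'] at hg ⊢
    rw [hasDerivAt_iff_isLittleO] at hg ⊢
    simp only [max_self, h0, sub_zero, smul_zero] at hg ⊢
    have ht : Tendsto (fun x : ℝ => max x 0) (𝓝 0) (𝓝 0) := by
      have : Continuous fun x : ℝ => max x 0 := by fun_prop
      simpa using this.tendsto 0
    refine (hg.comp_tendsto ht).trans_isBigO ?_
    refine Asymptotics.IsBigO.of_bound 1 (Eventually.of_forall fun y => ?_)
    simp only [Function.comp_apply, Real.norm_eq_abs, one_mul]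
    rcases le_total y 0 with h | h
    · simp [h]
    · simp [h]
  · rw [max_eq_left hx.le] at hg ⊢
    refine hg.congr_of_eventuallyEq ?_
    filter_upwards [Ioi_mem_nhds hx] with y hy
    rw [max_eq_left (le_of_lt hy)]

/-- Iterated partial derivatives of a function on the plane, as plain functions. -/
structure HasPartials (ψ ψs ψss ψt ψtt : ℂ → ℝ) : Prop where
  s1 : ∀ s t : ℝ, HasDerivAt (fun s => ψ ⟨s, t⟩) (ψs ⟨s, t⟩) s
  s2 : ∀ s t : ℝ, HasDerivAt (fun s => ψs ⟨s, t⟩) (ψss ⟨s, t⟩) s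
  t1 : ∀ s t : ℝ, HasDerivAt (fun t => ψ ⟨s, t⟩) (ψt ⟨s, t⟩) t
  t2 : ∀ s t : ℝ, HasDerivAt (fun t => ψt ⟨s, t⟩) (ψtt ⟨s, t⟩) t
  cont : Continuous ψ
  cont_ss : Continuous ψss
  cont_tt : Continuous ψtt

lemma continuous_mk : Continuous fun p : ℝ × ℝ => (⟨p.1, p.2⟩ : ℂ) :=
  Complex.equivRealProdCLM.symm.continuous

lemma continuous_mk_left (t : ℝ) : Continuous fun s : ℝ => (⟨s, t⟩ : ℂ) :=
  continuous_mk.comp (by fun_prop : Continuous fun s : ℝ => (s, t))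

lemma continuous_mk_right (s : ℝ) : Continuous fun t : ℝ => (⟨s, t⟩ : ℂ) :=
  continuous_mk.comp (by fun_prop : Continuous fun t : ℝ => (s, t))

lemma hasDerivAt_mk_left (s t : ℝ) : HasDerivAt (fun s : ℝ => (⟨s, t⟩ : ℂ)) 1 s := by
  have h : HasDerivAt (fun s : ℝ => (s : ℂ) + t * Complex.I) 1 s :=
    (Complex.ofRealCLM.hasDerivAt (x := s)).add_const _ |>.congr_deriv (by simp)
  convert h using 2 with s
  exact Complex.mk_eq_add_mul_I _ _

lemma hasDerivAt_mk_right (s t : ℝ) : HasDerivAt (fun t : ℝ => (⟨s, t⟩ : ℂ)) Complex.I t := by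
  have h : HasDerivAt (fun t : ℝ => (s : ℂ) + t * Complex.I) Complex.I t :=
    (((Complex.ofRealCLM.hasDerivAt (x := t)).mul_const Complex.I).const_add (s : ℂ)).congr_deriv
      (by simp)
  convert h using 2 with s
  exact Complex.mk_eq_add_mul_I _ _

lemma contDiff_dirDeriv {w : ℂ → ℝ} {n : ℕ} (hw : ContDiff ℝ (n + 1 : ℕ) w) (v : ℂ) :
    ContDiff ℝ n (dirDeriv v w) := by
  unfold dirDeriv
  exact (hw.fderiv_right (m := n) (by norm_cast)).clm_apply contDiff_const

lemma HasPartials.of_contDiff {w : ℂ → ℝ} (hw : ContDiff ℝ 2 w) :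
    HasPartials w (dirDeriv 1 w) (dirDeriv 1 (dirDeriv 1 w)) (dirDeriv Complex.I w)
      (dirDeriv Complex.I (dirDeriv Complex.I w)) := by
  have h1 : ∀ v, ContDiff ℝ (1 : ℕ) (dirDeriv v w) := fun v => contDiff_dirDeriv hw v
  have h2 : ∀ v v', ContDiff ℝ (0 : ℕ) (dirDeriv v' (dirDeriv v w)) := fun v v' =>
    contDiff_dirDeriv (h1 v) v'
  have hd : Differentiable ℝ w := hw.differentiable (by norm_num)
  have hd1 : ∀ v, Differentiable ℝ (dirDeriv v w) := fun v => (h1 v).differentiable (by norm_num)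
  refine ⟨fun s t => ?_, fun s t => ?_, fun s t => ?_, fun s t => ?_, hw.continuous,
    (h2 _ _).continuous, (h2 _ _).continuous⟩
  · exact (hd ⟨s, t⟩).hasFDerivAt.comp_hasDerivAt s (hasDerivAt_mk_left s t)
  · exact (hd1 _ ⟨s, t⟩).hasFDerivAt.comp_hasDerivAt s (hasDerivAt_mk_left s t)
  · exact (hd ⟨s, t⟩).hasFDerivAt.comp_hasDerivAt t (hasDerivAt_mk_right s t)
  · exact (hd1 _ ⟨s, t⟩).hasFDerivAt.comp_hasDerivAt t (hasDerivAt_mk_right s t)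

lemma integral_mul_second_deriv {a b : ℝ} {F F1 F2 G G1 G2 : ℝ → ℝ}
    (hF : ∀ x, HasDerivAt F (F1 x) x) (hF1 : ∀ x, HasDerivAt F1 (F2 x) x)
    (hG : ∀ x, HasDerivAt G (G1 x) x) (hG1 : ∀ x, HasDerivAt G1 (G2 x) x)
    (hF2 : Continuous F2) (hG2 : Continuous G2) :
    ∫ x in a..b, F x * G2 x =
      F b * G1 b - F a * G1 a - (F1 b * G b - F1 a * G a) + ∫ x in a..b, F2 x * G x := by
  have cF1 : Continuous F1 := continuous_iff_continuousAt.2 fun x => (hF1 x).continuousAt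
  have cG1 : Continuous G1 := continuous_iff_continuousAt.2 fun x => (hG1 x).continuousAt
  rw [intervalIntegral.integral_mul_deriv_eq_deriv_mul (fun x _ => hF x) (fun x _ => hG1 x)
      (cF1.intervalIntegrable _ _) (hG2.intervalIntegrable _ _),
    intervalIntegral.integral_mul_deriv_eq_deriv_mul (fun x _ => hF1 x) (fun x _ => hG x)
      (hF2.intervalIntegrable _ _) (cG1.intervalIntegrable _ _)]
  ring

lemma eq_zero_of_hasDerivAt {G G1 : ℝ → ℝ} {T : ℝ} (hG : ∀ x, HasDerivAt G (G1 x) x)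
    (h0 : ∀ x, T < |x| → G x = 0) {x : ℝ} (hx : T < |x|) : G1 x = 0 := by
  have h : HasDerivAt G 0 x := by
    refine (hasDerivAt_const x (0 : ℝ)).congr_of_eventuallyEq ?_
    filter_upwards [(continuous_abs.tendsto x).eventually (lt_mem_nhds hx)] with y hy
    exact h0 y hy
  exact (hG x).unique h

lemma integral_eq_intervalIntegral_of_abs {f : ℝ → ℝ} {T : ℝ} (h0 : ∀ x, T < |x| → f x = 0) :
    ∫ x, f x = ∫ x in (-(T + 1))..(T + 1), f x := by
  refine (intervalIntegral.integral_eq_integral_of_support_subset fun x hx => ?_).symm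
  have : |x| ≤ T := not_lt.1 fun h => hx (h0 x h)
  obtain ⟨h1, h2⟩ := abs_le.1 this
  constructor <;> linarith

/-- Integration by parts twice on the line against a compactly supported function. -/
lemma integral_mul_second_deriv_line {F F1 F2 G G1 G2 : ℝ → ℝ} {T : ℝ}
    (hF : ∀ x, HasDerivAt F (F1 x) x) (hF1 : ∀ x, HasDerivAt F1 (F2 x) x)
    (hG : ∀ x, HasDerivAt G (G1 x) x) (hG1 : ∀ x, HasDerivAt G1 (G2 x) x)
    (hF2 : Continuous F2) (hG2 : Continuous G2) (h0 : ∀ x, T < |x| → G x = 0) :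
    ∫ x, F x * G2 x = ∫ x, F2 x * G x := by
  have h1 : ∀ x, T < |x| → G1 x = 0 := fun x hx => eq_zero_of_hasDerivAt hG h0 hx
  have h2 : ∀ x, T < |x| → G2 x = 0 := fun x hx => eq_zero_of_hasDerivAt hG1 h1 hx
  rw [integral_eq_intervalIntegral_of_abs (T := T) (fun x hx => by rw [h2 x hx, mul_zero]),
    integral_eq_intervalIntegral_of_abs (T := T) (fun x hx => by rw [h0 x hx, mul_zero]),
    integral_mul_second_deriv hF hF1 hG hG1 hF2 hG2]
  have e1 : T < |T + 1| := lt_of_lt_of_le (by linarith) (le_abs_self _)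
  have e2 : T < |-(T + 1)| := by rwa [abs_neg]
  rw [h0 _ e1, h0 _ e2, h1 _ e1, h1 _ e2]
  ring

/-- Integration by parts twice on the line for an even reflection, against a compactly supported
function: the kink at the origin produces a boundary term. -/
lemma integral_mul_second_deriv_reflect {F F1 F2 G G1 G2 : ℝ → ℝ} {T : ℝ} (hT : 0 ≤ T)
    (hF : ∀ x, HasDerivAt F (F1 x) x) (hF1 : ∀ x, HasDerivAt F1 (F2 x) x)
    (hG : ∀ x, HasDerivAt G (G1 x) x) (hG1 : ∀ x, HasDerivAt G1 (G2 x) x)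
    (hF2 : Continuous F2) (hG2 : Continuous G2) (h0 : ∀ x, T < |x| → G x = 0) :
    ∫ x, F (-|x|) * G2 x = (∫ x, F2 (-|x|) * G x) - 2 * F1 0 * G 0 := by
  have h1 : ∀ x, T < |x| → G1 x = 0 := fun x hx => eq_zero_of_hasDerivAt hG h0 hx
  have h2 : ∀ x, T < |x| → G2 x = 0 := fun x hx => eq_zero_of_hasDerivAt hG1 h1 hx
  have cF : Continuous F := continuous_iff_continuousAt.2 fun x => (hF x).continuousAt
  have cG : Continuous G := continuous_iff_continuousAt.2 fun x => (hG x).continuousAt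
  have e1 : T < |T + 1| := lt_of_lt_of_le (by linarith) (le_abs_self _)
  have e2 : T < |-(T + 1)| := by rwa [abs_neg]
  have cl : Continuous fun x => F (-|x|) * G2 x := by fun_prop
  have cr : Continuous fun x => F2 (-|x|) * G x := by fun_prop
  rw [integral_eq_intervalIntegral_of_abs (T := T) (fun x hx => by rw [h2 x hx, mul_zero]),
    integral_eq_intervalIntegral_of_abs (T := T) (fun x hx => by rw [h0 x hx, mul_zero]),
    ← intervalIntegral.integral_add_adjacent_intervals (b := 0) (cl.intervalIntegrable _ _)
      (cl.intervalIntegrable _ _),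
    ← intervalIntegral.integral_add_adjacent_intervals (b := 0) (cr.intervalIntegrable _ _)
      (cr.intervalIntegrable _ _)]
  have i1 : ∀ {H H' : ℝ → ℝ}, ∫ x in (-(T + 1))..0, H (-|x|) * H' x =
      ∫ x in (-(T + 1))..0, H x * H' x := fun {H H'} => by
    refine intervalIntegral.integral_congr fun x hx => ?_
    rw [Set.uIcc_of_le (by linarith)] at hx
    simp only [abs_of_nonpos hx.2, neg_neg]
  have i2 : ∀ {H H' : ℝ → ℝ}, ∫ x in (0 : ℝ)..(T + 1), H (-|x|) * H' x =
      ∫ x in (0 : ℝ)..(T + 1), H (-x) * H' x := fun {H H'} => by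
    refine intervalIntegral.integral_congr fun x hx => ?_
    rw [Set.uIcc_of_le (by linarith)] at hx
    simp only [abs_of_nonneg hx.1]
  have n1 : ∀ x, HasDerivAt (fun x => F (-x)) (-F1 (-x)) x := fun x =>
    ((hF (-x)).comp x (hasDerivAt_neg x)).congr_deriv (by ring)
  have n2 : ∀ x, HasDerivAt (fun x => -F1 (-x)) (F2 (-x)) x := fun x =>
    ((hF1 (-x)).comp x (hasDerivAt_neg x)).neg.congr_deriv (by ring)
  rw [i1, i1, i2, i2, integral_mul_second_deriv hF hF1 hG hG1 hF2 hG2,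
    integral_mul_second_deriv n1 n2 hG hG1 (by fun_prop) hG2, h0 _ e1, h0 _ e2, h1 _ e1, h1 _ e2]
  simp only [neg_zero]
  ring

lemma integral_complex_eq_integral_re {f : ℂ → ℝ} (hf : Continuous f) (hc : HasCompactSupport f) :
    ∫ z, f z = ∫ t : ℝ, ∫ s : ℝ, f ⟨s, t⟩ := by
  have hi : Integrable (fun p : ℝ × ℝ => f ⟨p.1, p.2⟩) (volume.prod volume) := by
    have := (Complex.volume_preserving_equiv_real_prod.symm).integrable_comp_emb
      Complex.measurableEquivRealProd.symm.measurableEmbedding (g := f) |>.2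
      (hf.integrable_of_hasCompactSupport hc)
    exact this
  rw [← integral_prod_symm _ hi]
  exact ((Complex.volume_preserving_equiv_real_prod.symm).integral_comp
      Complex.measurableEquivRealProd.symm.measurableEmbedding f).symm

lemma integral_complex_eq_integral_im {f : ℂ → ℝ} (hf : Continuous f) (hc : HasCompactSupport f) :
    ∫ z, f z = ∫ s : ℝ, ∫ t : ℝ, f ⟨s, t⟩ := by
  have hi : Integrable (fun p : ℝ × ℝ => f ⟨p.1, p.2⟩) (volume.prod volume) := by
    have := (Complex.volume_preserving_equiv_real_prod.symm).integrable_comp_emb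
      Complex.measurableEquivRealProd.symm.measurableEmbedding (g := f) |>.2
      (hf.integrable_of_hasCompactSupport hc)
    exact this
  rw [← integral_prod _ hi]
  exact ((Complex.volume_preserving_equiv_real_prod.symm).integral_comp
      Complex.measurableEquivRealProd.symm.measurableEmbedding f).symm

lemma HasPartials.vanish {ψ ψs ψss ψt ψtt : ℂ → ℝ} (h : HasPartials ψ ψs ψss ψt ψtt) {T : ℝ}
    (h0 : ∀ z, T < ‖z‖ → ψ z = 0) {z : ℂ} (hz : T < ‖z‖) : ψss z = 0 ∧ ψtt z = 0 := by
  have key : ∀ {l : ℝ → ℂ} {f f' : ℂ → ℝ}, Continuous l →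
      (∀ x, HasDerivAt (fun x => f (l x)) (f' (l x)) x) → (∀ z, T < ‖z‖ → f z = 0) →
      ∀ x, T < ‖l x‖ → f' (l x) = 0 := by
    intro l f f' hl hf hf0 x hx
    have h : HasDerivAt (fun x => f (l x)) 0 x := by
      refine (hasDerivAt_const x (0 : ℝ)).congr_of_eventuallyEq ?_
      filter_upwards [(hl.norm.tendsto x).eventually (lt_mem_nhds hx)] with y hy
      exact hf0 _ hy
    exact (hf x).unique h
  have hs : ∀ z, T < ‖z‖ → ψs z = 0 := fun z hz =>
    key (continuous_mk_left z.im) (fun s => h.s1 s z.im) h0 z.re hz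
  have ht : ∀ z, T < ‖z‖ → ψt z = 0 := fun z hz =>
    key (continuous_mk_right z.re) (fun s => h.t1 z.re s) h0 z.im hz
  exact ⟨key (continuous_mk_left z.im) (fun s => h.s2 s z.im) hs z.re hz,
    key (continuous_mk_right z.re) (fun s => h.t2 z.re s) ht z.im hz⟩

lemma hasCompactSupport_of_norm {f : ℂ → ℝ} {T : ℝ} (h0 : ∀ z, T < ‖z‖ → f z = 0) :
    HasCompactSupport f :=
  HasCompactSupport.intro (isCompact_closedBall (0 : ℂ) T) fun z hz =>
    h0 z (by simpa using hz)

/-- Green's second identity in the plane, for a compactly supported test function. -/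
lemma integral_mul_laplacian {w ws wss wt wtt ψ ψs ψss ψt ψtt : ℂ → ℝ}
    (hw : HasPartials w ws wss wt wtt) (hψ : HasPartials ψ ψs ψss ψt ψtt) {T : ℝ}
    (h0 : ∀ z, T < ‖z‖ → ψ z = 0) :
    ∫ z, w z * (ψss z + ψtt z) = ∫ z, (wss z + wtt z) * ψ z := by
  have hv := fun z hz => hψ.vanish h0 (z := z) hz
  have c1 := hw.cont
  have c2 := hw.cont_ss
  have c3 := hw.cont_tt
  have d1 := hψ.cont
  have d2 := hψ.cont_ss
  have d3 := hψ.cont_tt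
  have k1 : HasCompactSupport fun z => w z * ψss z :=
    hasCompactSupport_of_norm (T := T) fun z hz => by simp [(hv z hz).1]
  have k2 : HasCompactSupport fun z => w z * ψtt z :=
    hasCompactSupport_of_norm (T := T) fun z hz => by simp [(hv z hz).2]
  have k3 : HasCompactSupport fun z => wss z * ψ z :=
    hasCompactSupport_of_norm (T := T) fun z hz => by simp [h0 z hz]
  have k4 : HasCompactSupport fun z => wtt z * ψ z :=
    hasCompactSupport_of_norm (T := T) fun z hz => by simp [h0 z hz]
  have m1 : Continuous fun z => w z * ψss z := by fun_prop
  have m2 : Continuous fun z => w z * ψtt z := by fun_prop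
  have m3 : Continuous fun z => wss z * ψ z := by fun_prop
  have m4 : Continuous fun z => wtt z * ψ z := by fun_prop
  simp only [mul_add, add_mul]
  rw [integral_add (m1.integrable_of_hasCompactSupport k1) (m2.integrable_of_hasCompactSupport k2),
    integral_add (m3.integrable_of_hasCompactSupport k3) (m4.integrable_of_hasCompactSupport k4),
    integral_complex_eq_integral_re m1 k1, integral_complex_eq_integral_re m3 k3,
    integral_complex_eq_integral_im m2 k2, integral_complex_eq_integral_im m4 k4]
  congr 1
  · refine integral_congr_ae (Eventually.of_forall fun t => ?_)
    exact integral_mul_second_deriv_line (T := T) (fun s => hw.s1 s t) (fun s => hw.s2 s t)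
      (fun s => hψ.s1 s t) (fun s => hψ.s2 s t) (c2.comp (continuous_mk_left t))
      (d2.comp (continuous_mk_left t))
      fun s hs => h0 _ (hs.trans_le (Complex.abs_re_le_norm ⟨s, t⟩))
  · refine integral_congr_ae (Eventually.of_forall fun s => ?_)
    exact integral_mul_second_deriv_line (T := T) (fun t => hw.t1 s t) (fun t => hw.t2 s t)
      (fun t => hψ.t1 s t) (fun t => hψ.t2 s t) (c3.comp (continuous_mk_right s))
      (d3.comp (continuous_mk_right s))
      fun t ht => h0 _ (ht.trans_le (Complex.abs_im_le_norm ⟨s, t⟩))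

/-- Fold the plane onto the closed left half plane. -/
def fold (z : ℂ) : ℂ := ⟨-|z.re|, z.im⟩

lemma continuous_fold : Continuous fold :=
  continuous_mk.comp (by fun_prop : Continuous fun z : ℂ => (-|z.re|, z.im))

/-- Green's second identity for a function reflected evenly across the imaginary axis. -/
lemma integral_fold_mul_laplacian {w ws wss wt wtt ψ ψs ψss ψt ψtt : ℂ → ℝ}
    (hw : HasPartials w ws wss wt wtt) (hψ : HasPartials ψ ψs ψss ψt ψtt) {T : ℝ} (hT : 0 ≤ T)
    (hws : Continuous ws) (h0 : ∀ z, T < ‖z‖ → ψ z = 0) :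
    ∫ z, w (fold z) * (ψss z + ψtt z) =
      (∫ z, (wss (fold z) + wtt (fold z)) * ψ z) - ∫ t : ℝ, 2 * ws ⟨0, t⟩ * ψ ⟨0, t⟩ := by
  have hv := fun z hz => hψ.vanish h0 (z := z) hz
  have c1 := hw.cont.comp continuous_fold
  have c2 := hw.cont_ss.comp continuous_fold
  have c3 := hw.cont_tt.comp continuous_fold
  have d1 := hψ.cont
  have d2 := hψ.cont_ss
  have d3 := hψ.cont_tt
  have k1 : HasCompactSupport fun z => w (fold z) * ψss z :=
    hasCompactSupport_of_norm (T := T) fun z hz => by simp [(hv z hz).1]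
  have k2 : HasCompactSupport fun z => w (fold z) * ψtt z :=
    hasCompactSupport_of_norm (T := T) fun z hz => by simp [(hv z hz).2]
  have k3 : HasCompactSupport fun z => wss (fold z) * ψ z :=
    hasCompactSupport_of_norm (T := T) fun z hz => by simp [h0 z hz]
  have k4 : HasCompactSupport fun z => wtt (fold z) * ψ z :=
    hasCompactSupport_of_norm (T := T) fun z hz => by simp [h0 z hz]
  have m1 : Continuous fun z => w (fold z) * ψss z := c1.mul d2
  have m2 : Continuous fun z => w (fold z) * ψtt z := c1.mul d3
  have m3 : Continuous fun z => wss (fold z) * ψ z := c2.mul d1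
  have m4 : Continuous fun z => wtt (fold z) * ψ z := c3.mul d1
  have m5 : Continuous fun t : ℝ => 2 * ws ⟨0, t⟩ * ψ ⟨0, t⟩ :=
    ((hws.comp (continuous_mk_right 0)).const_mul 2).mul (d1.comp (continuous_mk_right 0))
  have k5 : HasCompactSupport fun t : ℝ => 2 * ws ⟨0, t⟩ * ψ ⟨0, t⟩ :=
    HasCompactSupport.intro (isCompact_Icc (a := -T) (b := T)) fun t ht => by
      rw [h0, mul_zero]
      refine lt_of_lt_of_le (not_le.1 fun h => ht (abs_le.1 h)) (Complex.abs_im_le_norm ⟨0, t⟩)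
  have i3 : Integrable fun t : ℝ => ∫ s : ℝ, wss (fold ⟨s, t⟩) * ψ ⟨s, t⟩ := by
    have hi : Integrable (fun p : ℝ × ℝ => wss (fold ⟨p.1, p.2⟩) * ψ ⟨p.1, p.2⟩)
        (volume.prod volume) :=
      (Complex.volume_preserving_equiv_real_prod.symm).integrable_comp_emb
        Complex.measurableEquivRealProd.symm.measurableEmbedding
        (g := fun z => wss (fold z) * ψ z) |>.2 (m3.integrable_of_hasCompactSupport k3)
    exact hi.integral_prod_right
  simp only [mul_add, add_mul]
  rw [integral_add (m1.integrable_of_hasCompactSupport k1) (m2.integrable_of_hasCompactSupport k2),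
    integral_add (m3.integrable_of_hasCompactSupport k3) (m4.integrable_of_hasCompactSupport k4),
    integral_complex_eq_integral_re m1 k1, integral_complex_eq_integral_re m3 k3,
    integral_complex_eq_integral_im m2 k2, integral_complex_eq_integral_im m4 k4,
    add_sub_right_comm, ← integral_sub i3 (m5.integrable_of_hasCompactSupport k5)]
  congr 1
  · refine integral_congr_ae (Eventually.of_forall fun t => ?_)
    exact integral_mul_second_deriv_reflect hT (fun s => hw.s1 s t) (fun s => hw.s2 s t)
      (fun s => hψ.s1 s t) (fun s => hψ.s2 s t) (hw.cont_ss.comp (continuous_mk_left t))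
      (d2.comp (continuous_mk_left t))
      fun s hs => h0 _ (hs.trans_le (Complex.abs_re_le_norm ⟨s, t⟩))
  · refine integral_congr_ae (Eventually.of_forall fun s => ?_)
    exact integral_mul_second_deriv_line (T := T) (fun t => hw.t1 (-|s|) t)
      (fun t => hw.t2 (-|s|) t) (fun t => hψ.t1 s t) (fun t => hψ.t2 s t)
      (c3.comp (continuous_mk_right s)) (d3.comp (continuous_mk_right s))
      fun t ht => h0 _ (ht.trans_le (Complex.abs_im_le_norm ⟨s, t⟩))

/-- Squared Euclidean distance. -/
def sqDist (x y : ℂ) : ℝ := (y.re - x.re) ^ 2 + (y.im - x.im) ^ 2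

lemma sqDist_eq (x y : ℂ) : sqDist x y = ‖y - x‖ ^ 2 := by
  rw [← Complex.normSq_eq_norm_sq, Complex.normSq_apply, sqDist]
  simp only [Complex.sub_re, Complex.sub_im]
  ring

lemma sqDist_nonneg (x y : ℂ) : 0 ≤ sqDist x y := by unfold sqDist; positivity

lemma continuous_sqDist (x : ℂ) : Continuous (sqDist x) := by unfold sqDist; fun_prop

/-- The cutoff variable of the regularized logarithmic kernel of squared radius `b` and
squared regularization scale `a`. -/
def cutVar (a b : ℝ) (x y : ℂ) : ℝ := max ((b - sqDist x y) / (b + a)) 0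

/-- A nonnegative, compactly supported, `C²` regularization of `log (b / |y - x|²)`. -/
def logKer (a b : ℝ) (x y : ℂ) : ℝ :=
  -Real.log (1 - cutVar a b x y) - cutVar a b x y - cutVar a b x y ^ 2 / 2

/-- The concentrating part of minus the Laplacian of `logKer`. -/
def peakKer (a b : ℝ) (x y : ℂ) : ℝ := 4 * a * cutVar a b x y ^ 2 / (sqDist x y + a) ^ 2

/-- The bounded part of the Laplacian of `logKer`. -/
def tailKer (a b : ℝ) (x y : ℂ) : ℝ :=
  8 * sqDist x y * cutVar a b x y / ((b + a) * (sqDist x y + a))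

section Kernel

variable {a b : ℝ}

lemma cutVar_nonneg (x y : ℂ) : 0 ≤ cutVar a b x y := le_max_right _ _

lemma cutVar_lt_one (ha : 0 < a) (hb : 0 < b) (x y : ℂ) : cutVar a b x y < 1 := by
  refine max_lt ?_ one_pos
  rw [div_lt_one (by positivity)]
  linarith [sqDist_nonneg x y]

lemma cutVar_eq_zero (ha : 0 < a) (hb : 0 < b) {x y : ℂ} (h : b ≤ sqDist x y) :
    cutVar a b x y = 0 :=
  max_eq_right (div_nonpos_of_nonpos_of_nonneg (by linarith) (by positivity))

lemma cutVar_eq (ha : 0 < a) (hb : 0 < b) {x y : ℂ} (h : sqDist x y ≤ b) :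
    cutVar a b x y = (b - sqDist x y) / (b + a) :=
  max_eq_left (div_nonneg (by linarith) (by positivity))

lemma continuous_cutVar (x : ℂ) : Continuous (cutVar a b x) := by
  have := continuous_sqDist x
  unfold cutVar
  fun_prop

lemma logKer_eq_zero (ha : 0 < a) (hb : 0 < b) {x y : ℂ} (h : b ≤ sqDist x y) :
    logKer a b x y = 0 := by
  simp [logKer, cutVar_eq_zero ha hb h]

lemma tailKer_nonneg (ha : 0 < a) (hb : 0 < b) (x y : ℂ) : 0 ≤ tailKer a b x y := by
  have := sqDist_nonneg x y
  have := cutVar_nonneg (a := a) (b := b) x y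
  unfold tailKer
  positivity

lemma tailKer_le (ha : 0 < a) (hb : 0 < b) (x y : ℂ) : tailKer a b x y ≤ 8 / b := by
  have h1 := sqDist_nonneg x y
  have h2 := cutVar_nonneg (a := a) (b := b) x y
  have h3 := (cutVar_lt_one ha hb x y).le
  unfold tailKer
  rw [div_le_div_iff₀ (by positivity) hb]
  have : sqDist x y * cutVar a b x y ≤ sqDist x y := mul_le_of_le_one_right h1 h3
  nlinarith [mul_nonneg h1 hb.le, mul_nonneg h1 ha.le, mul_pos ha hb, mul_pos ha ha]

lemma continuous_tailKer (ha : 0 < a) (hb : 0 < b) (x : ℂ) : Continuous (tailKer a b x) := by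
  have h1 := continuous_sqDist x
  have h2 := continuous_cutVar (a := a) (b := b) x
  unfold tailKer
  refine Continuous.div (by fun_prop) (by fun_prop) fun y => ?_
  have := sqDist_nonneg x y
  positivity

lemma continuous_peakKer (ha : 0 < a) (x : ℂ) : Continuous (peakKer a b x) := by
  have h1 := continuous_sqDist x
  have h2 := continuous_cutVar (a := a) (b := b) x
  unfold peakKer
  refine Continuous.div (by fun_prop) (by fun_prop) fun y => ?_
  have := sqDist_nonneg x y
  positivity

lemma continuous_logKer (ha : 0 < a) (hb : 0 < b) (x : ℂ) : Continuous (logKer a b x) := by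
  have h2 := continuous_cutVar (a := a) (b := b) x
  unfold logKer
  have : Continuous fun y => Real.log (1 - cutVar a b x y) :=
    Continuous.log (by fun_prop) fun y => by linarith [cutVar_lt_one ha hb x y]
  fun_prop

lemma one_sub_cutVar (ha : 0 < a) (hb : 0 < b) {x y : ℂ} (h : sqDist x y ≤ b) :
    1 - cutVar a b x y = (sqDist x y + a) / (b + a) := by
  rw [cutVar_eq ha hb h]
  field_simp
  ring

lemma logKer_nonneg (ha : 0 < a) (hb : 0 < b) (x y : ℂ) : 0 ≤ logKer a b x y := by
  have h1 := cutVar_nonneg (a := a) (b := b) x y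
  have h2 := cutVar_lt_one ha hb x y
  have h3 := Real.hasSum_pow_div_log_of_abs_lt_one (x := cutVar a b x y) (by rwa [abs_of_nonneg h1])
  have h4 := sum_le_hasSum (Finset.range 2) (fun i _ => by positivity) h3
  simp only [Finset.sum_range_succ, Finset.sum_range_zero] at h4
  norm_num at h4
  unfold logKer
  linarith

lemma exp_logKer_le (ha : 0 < a) (hb : 0 < b) {x y : ℂ} (h0 : 0 < sqDist x y)
    (h : sqDist x y ≤ b) : Real.exp (logKer a b x y) ≤ b / sqDist x y := by
  have h1 := cutVar_nonneg (a := a) (b := b) x y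
  have h2 : 0 < 1 - cutVar a b x y := by linarith [cutVar_lt_one ha hb x y]
  have : logKer a b x y ≤ -Real.log (1 - cutVar a b x y) := by
    unfold logKer
    nlinarith
  refine (Real.exp_le_exp.2 this).trans ?_
  rw [Real.exp_neg, Real.exp_log h2, one_sub_cutVar ha hb h, inv_div,
    div_le_div_iff₀ (by linarith) h0]
  nlinarith

lemma logKer_hasPartials (ha : 0 < a) (hb : 0 < b) (x : ℂ) : ∃ ψs ψss ψt ψtt : ℂ → ℝ,
    HasPartials (logKer a b x) ψs ψss ψt ψtt ∧
      ∀ y, ψss y + ψtt y = tailKer a b x y - peakKer a b x y := by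
  set Φ : ℝ → ℝ := fun τ => -Real.log (1 - τ) - τ - τ ^ 2 / 2
  set Φ1 : ℝ → ℝ := fun τ => τ ^ 2 / (1 - τ) with hΦ1
  set Φ2 : ℝ → ℝ := fun τ => (2 * τ - τ ^ 2) / (1 - τ) ^ 2 with hΦ2
  have dΦ : ∀ τ < 1, HasDerivAt Φ (Φ1 τ) τ := fun τ hτ => by
    have h1 : 1 - τ ≠ 0 := by linarith
    have := (((((hasDerivAt_id τ).const_sub 1).log h1).neg).sub (hasDerivAt_id τ)).sub
      (((hasDerivAt_id τ).pow 2).div_const 2)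
    refine this.congr_deriv ?_
    simp only [hΦ1, id]
    field_simp
    ring
  have dΦ1 : ∀ τ < 1, HasDerivAt Φ1 (Φ2 τ) τ := fun τ hτ => by
    have h1 : 1 - τ ≠ 0 := by linarith
    have := ((hasDerivAt_id τ).pow 2).div ((hasDerivAt_id τ).const_sub 1) h1
    refine this.congr_deriv ?_
    simp only [hΦ2, id]
    field_simp
    simp
    ring
  set κ := 1 / (b + a) with hκ
  have hba : b + a ≠ 0 := by positivity
  have lt1 := cutVar_lt_one ha hb x
  have line : ∀ (l : ℝ → ℂ) (c k : ℝ) (r : ℝ), (∀ r, sqDist x (l r) = (r - c) ^ 2 + k) →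
      HasDerivAt (fun r => Φ (cutVar a b x (l r))) (-(2 * κ * (r - c)) * Φ1 (cutVar a b x (l r))) r ∧
      HasDerivAt (fun r => Φ1 (cutVar a b x (l r)))
        (-(2 * κ * (r - c)) * Φ2 (cutVar a b x (l r))) r := by
    intro l c k r hl
    have hd : HasDerivAt (fun r => (b - sqDist x (l r)) / (b + a)) (-(2 * κ * (r - c))) r := by
      simp only [hl]
      have := ((((((hasDerivAt_id r).sub_const c).pow 2).add_const k).const_sub b).div_const (b + a))
      refine this.congr_deriv ?_
      simp only [hκ, id]
      field_simp
      simp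
      ring
    have m1 := hasDerivAt_comp_max_zero (dΦ _ (lt1 (l r))) (by simp [Φ]) (by simp [Φ1])
    have m2 := hasDerivAt_comp_max_zero (dΦ1 _ (lt1 (l r))) (by simp [Φ1]) (by simp [Φ2])
    exact ⟨(HasDerivAt.comp (h₂ := fun τ => Φ (max τ 0)) r m1 hd).congr_deriv (mul_comm _ _),
      (HasDerivAt.comp (h₂ := fun τ => Φ1 (max τ 0)) r m2 hd).congr_deriv (mul_comm _ _)⟩
  have ls := fun s t : ℝ => line (fun s => ⟨s, t⟩) x.re ((t - x.im) ^ 2) s fun r => rfl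
  have lt := fun s t : ℝ => line (fun t => ⟨s, t⟩) x.im ((s - x.re) ^ 2) t fun r => by
    simp only [sqDist]; ring
  have c1 : Continuous fun y => Φ1 (cutVar a b x y) := by
    have h2 := continuous_cutVar (a := a) (b := b) x
    refine Continuous.div (by fun_prop) (by fun_prop) fun y => ?_
    linarith [lt1 y]
  have c2 : Continuous fun y => Φ2 (cutVar a b x y) := by
    have h2 := continuous_cutVar (a := a) (b := b) x
    refine Continuous.div (by fun_prop) (by fun_prop) fun y => ?_
    have : 0 < 1 - cutVar a b x y := by linarith [lt1 y]
    positivity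
  refine ⟨fun y => -(2 * κ * (y.re - x.re)) * Φ1 (cutVar a b x y),
    fun y => (2 * κ * (y.re - x.re)) ^ 2 * Φ2 (cutVar a b x y) - 2 * κ * Φ1 (cutVar a b x y),
    fun y => -(2 * κ * (y.im - x.im)) * Φ1 (cutVar a b x y),
    fun y => (2 * κ * (y.im - x.im)) ^ 2 * Φ2 (cutVar a b x y) - 2 * κ * Φ1 (cutVar a b x y),
    ⟨fun s t => (ls s t).1, fun s t => ?_, fun s t => (lt s t).1, fun s t => ?_,
      continuous_logKer ha hb x, ?_, ?_⟩, fun y => ?_⟩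
  · refine (((((hasDerivAt_id s).sub_const x.re).const_mul (2 * κ)).neg).mul
      (ls s t).2).congr_deriv ?_
    simp
    ring
  · refine (((((hasDerivAt_id t).sub_const x.im).const_mul (2 * κ)).neg).mul
      (lt s t).2).congr_deriv ?_
    simp
    ring
  · exact (((by fun_prop : Continuous fun y : ℂ => (2 * κ * (y.re - x.re)) ^ 2).mul c2)).sub
      (c1.const_mul _)
  · exact (((by fun_prop : Continuous fun y : ℂ => (2 * κ * (y.im - x.im)) ^ 2).mul c2)).sub
      (c1.const_mul _)
  · rcases le_total (sqDist x y) b with h | h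
    · have e1 := one_sub_cutVar ha hb h
      have e2 : sqDist x y + a ≠ 0 := by linarith [sqDist_nonneg x y]
      have e3 : (2 * κ * (y.re - x.re)) ^ 2 + (2 * κ * (y.im - x.im)) ^ 2
          = 4 * κ ^ 2 * sqDist x y := by simp only [sqDist]; ring
      calc _ = ((2 * κ * (y.re - x.re)) ^ 2 + (2 * κ * (y.im - x.im)) ^ 2) * Φ2 (cutVar a b x y)
            - 4 * κ * Φ1 (cutVar a b x y) := by ring
        _ = _ := by
          rw [e3]
          simp only [hΦ1, hΦ2, e1, tailKer, peakKer, hκ]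
          rw [cutVar_eq ha hb h]
          field_simp
          ring
    · simp [hΦ1, hΦ2, tailKer, peakKer, cutVar_eq_zero ha hb h]

end Kernel

lemma integral_stereographic_density :
    ∫ z : ℂ, (Real.pi * (1 + ‖z‖ ^ 2) ^ 2)⁻¹ = 1 := by
  rw [integral_fun_norm_addHaar (volume : Measure ℂ) (fun r => (Real.pi * (1 + r ^ 2) ^ 2)⁻¹)]
  have h1 : ∫ y in Set.Ioi (0 : ℝ), y * (Real.pi * (1 + y ^ 2) ^ 2)⁻¹ = 0 - -(2 * Real.pi)⁻¹ := by
    have hd : ∀ y : ℝ, HasDerivAt (fun y : ℝ => -(2 * Real.pi)⁻¹ * (1 + y ^ 2)⁻¹)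
        (y * (Real.pi * (1 + y ^ 2) ^ 2)⁻¹) y := fun y => by
      have h0 : (1 : ℝ) + y ^ 2 ≠ 0 := by positivity
      have := ((((hasDerivAt_id y).pow 2).const_add 1).inv h0).const_mul (-(2 * Real.pi)⁻¹)
      refine this.congr_deriv ?_
      simp
      field_simp
    have ht : Tendsto (fun y : ℝ => -(2 * Real.pi)⁻¹ * (1 + y ^ 2)⁻¹) atTop (𝓝 0) := by
      have : Tendsto (fun y : ℝ => (1 + y ^ 2)⁻¹) atTop (𝓝 0) :=
        tendsto_inv_atTop_zero.comp
          (tendsto_atTop_add_const_left _ _ (tendsto_pow_atTop two_ne_zero))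
      simpa using this.const_mul (-(2 * Real.pi)⁻¹)
    have := integral_Ioi_of_hasDerivAt_of_nonneg' (a := 0) (fun y _ => hd y)
      (fun y hy => by have : (0 : ℝ) < y := hy; positivity) ht
    rw [this]
    simp
  have hf : Module.finrank ℝ ℂ = 2 := Complex.finrank_real_complex
  have hv : (volume : Measure ℂ).real (Metric.ball 0 1) = Real.pi := by
    simp [Measure.real, Complex.volume_ball]
  simp only [hf, hv, smul_eq_mul, nsmul_eq_mul, Nat.add_one_sub_one, pow_one] at h1 ⊢
  rw [h1]
  have := Real.pi_pos
  field_simp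
  norm_num

/-- The peak kernels converge to `4π` times the Dirac mass. -/
lemma tendsto_integral_peakKer {W : ℂ → ℝ} (hW : Continuous W) {b : ℝ} (hb : 0 < b) (x : ℂ) :
    Tendsto (fun c : ℝ => ∫ y, W y * peakKer (c⁻¹ ^ 2) b x y) atTop
      (𝓝 (4 * Real.pi * W x)) := by
  have hf : Module.finrank ℝ ℂ = 2 := Complex.finrank_real_complex
  set g : ℂ → ℝ := fun y => W y * (max (b - sqDist x y) 0) ^ 2 with hg
  have cg : Continuous g := by
    have := continuous_sqDist x
    fun_prop
  have sg : HasCompactSupport g := by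
    refine HasCompactSupport.intro (isCompact_closedBall x (Real.sqrt b)) fun y hy => ?_
    rw [Metric.mem_closedBall, not_le, dist_eq_norm] at hy
    have : b ≤ sqDist x y := by
      rw [sqDist_eq]
      exact (Real.sqrt_le_left (norm_nonneg _)).1 hy.le
    simp [hg, max_eq_right (sub_nonpos.2 this)]
  have key := tendsto_integral_comp_smul_smul_of_integrable' (μ := (volume : Measure ℂ))
    (φ := fun z : ℂ => (Real.pi * (1 + ‖z‖ ^ 2) ^ 2)⁻¹) (g := g) (x₀ := x)
    (fun z => by positivity) integral_stereographic_density ?_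
    (cg.integrable_of_hasCompactSupport sg) cg.continuousAt
  · have h2 : Tendsto (fun c : ℝ => 4 * Real.pi * ((b + c⁻¹ ^ 2) ^ 2)⁻¹) atTop
        (𝓝 (4 * Real.pi * (b ^ 2)⁻¹)) := by
      have h3 : Tendsto (fun c : ℝ => (b + c⁻¹ ^ 2) ^ 2) atTop (𝓝 ((b + 0 ^ 2) ^ 2)) :=
        (((tendsto_inv_atTop_zero).pow 2).const_add b).pow 2
      have h4 := (h3.inv₀ (by positivity)).const_mul (4 * Real.pi)
      simpa using h4
    have h5 := h2.mul key
    have e1 : 4 * Real.pi * (b ^ 2)⁻¹ * g x = 4 * Real.pi * W x := by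
      have : sqDist x x = 0 := by simp [sqDist]
      simp only [hg, this, sub_zero, max_eq_left hb.le]
      field_simp
    rw [e1] at h5
    refine h5.congr' ?_
    filter_upwards [eventually_gt_atTop 0] with c hc
    rw [← integral_const_mul]
    refine integral_congr_ae (Eventually.of_forall fun y => ?_)
    have e2 : ‖c • (x - y)‖ ^ 2 = c ^ 2 * sqDist x y := by
      rw [norm_smul, mul_pow, sqDist_eq, norm_sub_rev, Real.norm_eq_abs, sq_abs]
    have e3 : cutVar (c⁻¹ ^ 2) b x y = (max (b - sqDist x y) 0) / (b + c⁻¹ ^ 2) := by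
      rw [cutVar, ← max_div_div_right (by positivity), zero_div]
    have h0 := sqDist_nonneg x y
    have := Real.pi_pos
    simp only [e2, hf, hg, peakKer, e3, smul_eq_mul]
    have e4 : sqDist x y + c⁻¹ ^ 2 = (1 + c ^ 2 * sqDist x y) * c⁻¹ ^ 2 := by
      field_simp
      ring
    rw [e4]
    have : 1 + c ^ 2 * sqDist x y ≠ 0 := by positivity
    field_simp
  · rw [hf]
    have h6 : Tendsto (fun r : ℝ => Real.pi⁻¹ * (r ^ 2)⁻¹) atTop (𝓝 0) := by
      simpa using (tendsto_inv_atTop_zero.comp (tendsto_pow_atTop (α := ℝ) two_ne_zero)).const_mul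
        Real.pi⁻¹
    refine squeeze_zero' (Eventually.of_forall fun z => by positivity) ?_
      (h6.comp tendsto_norm_cobounded_atTop)
    filter_upwards [tendsto_norm_cobounded_atTop.eventually (eventually_gt_atTop 0)] with z hz
    have := Real.pi_pos
    simp only [Function.comp_apply]
    rw [← mul_inv, ← div_eq_mul_inv, inv_eq_one_div, div_le_div_iff₀ (by positivity) (by positivity)]
    have : ‖z‖ ^ 2 * ‖z‖ ^ 2 ≤ (1 + ‖z‖ ^ 2) ^ 2 := by nlinarith [sq_nonneg ‖z‖]
    nlinarith

/-- Uniform local integrability of the kernels `‖y - x‖ ^ (-s)`, `0 < s < 2 * α`, against `ν`. -/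
structure RieszBounded (ν : Measure ℂ) (α : ℝ) : Prop where
  ball_ne_top : ∀ (c : ℂ) (R : ℝ), ν (Metric.ball c R) ≠ ∞
  exists_bound : ∀ s : ℝ, 0 < s → s < 2 * α → ∀ (c : ℂ) (R : ℝ), ∃ C : ℝ≥0∞, C ≠ ∞ ∧
    ∀ y, ∫⁻ x in Metric.ball c R, ‖y - x‖ₑ ^ (-s) ∂ν ≤ C

lemma exists_lintegral_rpow_enorm_le {E : Type*} [NormedAddCommGroup E] [NormedSpace ℝ E]
    [FiniteDimensional ℝ E] [MeasurableSpace E] [BorelSpace E] (μ : Measure E)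
    [μ.IsAddHaarMeasure] (hd : 1 ≤ Module.finrank ℝ E) {s : ℝ} (hs0 : 0 < s)
    (hs : s < Module.finrank ℝ E) (c : E) (R : ℝ) :
    ∃ C : ℝ≥0∞, C ≠ ∞ ∧ ∀ y, ∫⁻ x in Metric.ball c R, ‖y - x‖ₑ ^ (-s) ∂μ ≤ C := by
  have : Nontrivial E := Module.nontrivial_of_finrank_pos (R := ℝ) hd
  have hint : IntegrableOn (fun z : E => ‖z‖ ^ (-s)) (Metric.ball 0 1) μ := by
    refine integrableOn_ball_of_norm_le_rpow hd (C := 1) hs (Eventually.of_forall fun x => ?_) ?_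
    · rw [Real.norm_of_nonneg (by positivity), one_mul]
    · exact (measurable_norm.pow_const _).aestronglyMeasurable
  have hfin : ∫⁻ z in Metric.ball (0 : E) 1, ‖z‖ₑ ^ (-s) ∂μ ≠ ∞ := by
    refine ne_of_lt (lt_of_le_of_lt (le_of_eq ?_) hint.2)
    refine setLIntegral_congr_fun_ae measurableSet_ball ?_
    have h0 : ∀ᵐ z ∂μ, z ≠ 0 := by
      rw [ae_iff]
      simp
    filter_upwards [h0] with z hz _
    rw [← ofReal_norm, ENNReal.ofReal_rpow_of_pos (norm_pos_iff.2 hz),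
      Real.enorm_of_nonneg (by positivity)]
  have hm : Measurable fun z : E => ‖z‖ₑ ^ (-s) := measurable_enorm.pow_const _
  refine ⟨μ (Metric.ball c R) + ∫⁻ z in Metric.ball (0 : E) 1, ‖z‖ₑ ^ (-s) ∂μ,
    ENNReal.add_ne_top.2 ⟨measure_ball_lt_top.ne, hfin⟩, fun y => ?_⟩
  calc ∫⁻ x in Metric.ball c R, ‖y - x‖ₑ ^ (-s) ∂μ
      ≤ ∫⁻ x in Metric.ball c R,
          1 + (Metric.ball (0 : E) 1).indicator (fun z => ‖z‖ₑ ^ (-s)) (y - x) ∂μ := by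
        refine lintegral_mono fun x => ?_
        by_cases h : y - x ∈ Metric.ball (0 : E) 1
        · rw [Set.indicator_of_mem h]
          exact le_add_self
        · rw [Set.indicator_of_notMem h, add_zero]
          rw [mem_ball_zero_iff, not_lt] at h
          have h1 : 1 ≤ ‖y - x‖ₑ := by
            rw [← ofReal_norm]
            exact ENNReal.one_le_ofReal.2 h
          exact ENNReal.rpow_le_one_of_one_le_of_neg h1 (by linarith)
    _ = μ (Metric.ball c R) + ∫⁻ x in Metric.ball c R,
          (Metric.ball (0 : E) 1).indicator (fun z => ‖z‖ₑ ^ (-s)) (y - x) ∂μ := by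
        rw [lintegral_add_left measurable_const, setLIntegral_one]
    _ ≤ μ (Metric.ball c R) + ∫⁻ x,
          (Metric.ball (0 : E) 1).indicator (fun z => ‖z‖ₑ ^ (-s)) (y - x) ∂μ := by
        gcongr
        exact Measure.restrict_le_self
    _ = _ := by
        rw [lintegral_sub_left_eq_self (fun z => (Metric.ball (0 : E) 1).indicator
          (fun z => ‖z‖ₑ ^ (-s)) z) y, lintegral_indicator measurableSet_ball]

lemma rieszBounded_volume : RieszBounded volume 1 := by
  have hf : Module.finrank ℝ ℂ = 2 := Complex.finrank_real_complex
  refine ⟨fun c R => measure_ball_lt_top.ne, fun s h0 hs c R => ?_⟩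
  exact exists_lintegral_rpow_enorm_le volume (by rw [hf]; norm_num) h0
    (by rw [hf]; norm_num; linarith) c R

/-- Lebesgue measure on the imaginary axis. -/
def axisMeasure : Measure ℂ := Measure.map (fun t : ℝ => (⟨0, t⟩ : ℂ)) volume

instance : SFinite axisMeasure := by unfold axisMeasure; infer_instance

lemma axis_preimage_ball_subset (c : ℂ) (R : ℝ) :
    (fun t : ℝ => (⟨0, t⟩ : ℂ)) ⁻¹' Metric.ball c R ⊆ Metric.ball c.im R := fun t ht => by
  rw [Set.mem_preimage, mem_ball_iff_norm] at ht
  rw [mem_ball_iff_norm, Real.norm_eq_abs]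
  exact (Complex.abs_im_le_norm (⟨0, t⟩ - c)).trans_lt ht

lemma rieszBounded_axisMeasure : RieszBounded axisMeasure (1 / 2) := by
  have hm := (continuous_mk_right 0).measurable
  refine ⟨fun c R => ?_, fun s h0 hs c R => ?_⟩
  · rw [axisMeasure, Measure.map_apply hm measurableSet_ball]
    exact ((measure_mono (axis_preimage_ball_subset c R)).trans_lt measure_ball_lt_top).ne
  · obtain ⟨C, hC, hb⟩ := exists_lintegral_rpow_enorm_le (volume : Measure ℝ) (by simp) h0
      (by simp; linarith) c.im R
    refine ⟨C, hC, fun y => (le_trans ?_ (hb y.im))⟩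
    rw [axisMeasure, setLIntegral_map measurableSet_ball (by fun_prop) hm]
    refine (lintegral_mono_set (axis_preimage_ball_subset c R)).trans (lintegral_mono fun t => ?_)
    rw [ENNReal.rpow_neg, ENNReal.rpow_neg]
    gcongr
    rw [← ofReal_norm, ← ofReal_norm]
    exact ENNReal.ofReal_le_ofReal (Complex.abs_im_le_norm (y - ⟨0, t⟩))

lemma exp_integral_le {μ : Measure ℂ} [IsFiniteMeasure μ] {m : ℝ} (hm : 0 < m)
    (hμ : μ.real Set.univ ≤ m) {f : ℂ → ℝ} (hf : Integrable f μ)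
    (hf' : Integrable (fun y => Real.exp (m * f y)) μ) :
    Real.exp (∫ y, f y ∂μ) ≤ 1 + m⁻¹ * ∫ y, Real.exp (m * f y) ∂μ := by
  set v := ∫ y, f y ∂μ
  have h1 : ∫ y, Real.exp v * (1 - v + m * f y) ∂μ ≤ ∫ y, Real.exp (m * f y) ∂μ := by
    refine integral_mono ((((integrable_const _).add (hf.const_mul m))).const_mul _) hf' fun y => ?_
    have := Real.add_one_le_exp (m * f y - v)
    calc Real.exp v * (1 - v + m * f y) ≤ Real.exp v * Real.exp (m * f y - v) := by
          gcongr
          linarith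
      _ = Real.exp (m * f y) := by rw [← Real.exp_add]; ring_nf
  rw [integral_const_mul, integral_add (integrable_const _) (hf.const_mul m), integral_const,
    integral_const_mul, smul_eq_mul] at h1
  have h2 : m⁻¹ * (Real.exp v * (μ.real Set.univ * (1 - v) + m * v)) ≤
      m⁻¹ * ∫ y, Real.exp (m * f y) ∂μ := by gcongr
  set θ := m⁻¹ * μ.real Set.univ with hθ
  have e : m⁻¹ * (Real.exp v * (μ.real Set.univ * (1 - v) + m * v)) =
      Real.exp v * (θ * (1 - v) + v) := by
    rw [hθ]
    field_simp
  rw [e] at h2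
  have t0 : 0 ≤ θ := by positivity
  have t1 : θ ≤ 1 := by
    rw [hθ, inv_mul_le_iff₀ hm]
    linarith
  have h3 : Real.exp v * (1 - v) ≤ 1 := by
    have := Real.add_one_le_exp (-v)
    calc Real.exp v * (1 - v) ≤ Real.exp v * Real.exp (-v) := by gcongr; linarith
      _ = 1 := by rw [← Real.exp_add]; simp
  nlinarith

lemma ofReal_exp_mul_logKer_le {a b e : ℝ} (ha : 0 < a) (hb : 0 < b) (he : 0 < e) (x y : ℂ) :
    ENNReal.ofReal (Real.exp (e * logKer a b x y)) ≤
      1 + ENNReal.ofReal (b ^ e) * ‖y - x‖ₑ ^ (-(2 * e)) := by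
  rcases le_or_gt b (sqDist x y) with h | h
  · simp [logKer_eq_zero ha hb h]
  · refine le_trans ?_ le_add_self
    rcases eq_or_ne y x with rfl | hne
    · have : ENNReal.ofReal (b ^ e) * ‖y - y‖ₑ ^ (-(2 * e)) = ∞ := by
        rw [sub_self, enorm_zero, ENNReal.zero_rpow_of_neg (by linarith), ENNReal.mul_top]
        simpa using Real.rpow_pos_of_pos hb e
      rw [this]
      exact le_top
    · have hn : 0 < ‖y - x‖ := norm_pos_iff.2 (sub_ne_zero.2 hne)
      have h0 : 0 < sqDist x y := by rw [sqDist_eq]; positivity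
      rw [← ofReal_norm, ENNReal.ofReal_rpow_of_pos hn, ← ENNReal.ofReal_mul (by positivity)]
      refine ENNReal.ofReal_le_ofReal ?_
      calc Real.exp (e * logKer a b x y) = Real.exp (logKer a b x y) ^ e := by
            rw [← Real.exp_mul, mul_comm]
        _ ≤ (b / sqDist x y) ^ e := by
            gcongr
            exact exp_logKer_le ha hb h0 h.le
        _ = b ^ e * ‖y - x‖ ^ (-(2 * e)) := by
            rw [Real.div_rpow hb.le h0.le, sqDist_eq, ← Real.rpow_natCast, ← Real.rpow_mul hn.le,
              Real.rpow_neg hn.le, div_eq_mul_inv]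
            norm_num

lemma hasCompactSupport_logKer {a b : ℝ} (ha : 0 < a) (hb : 0 < b) (x : ℂ) :
    HasCompactSupport (logKer a b x) := by
  refine HasCompactSupport.intro (isCompact_closedBall x (Real.sqrt b)) fun y hy => ?_
  rw [Metric.mem_closedBall, not_le, dist_eq_norm] at hy
  refine logKer_eq_zero ha hb ?_
  rw [sqDist_eq]
  exact (Real.sqrt_le_left (norm_nonneg _)).1 hy.le

lemma integrable_logKer {a b : ℝ} (ha : 0 < a) (hb : 0 < b) (x : ℂ) (μ : Measure ℂ)
    [IsFiniteMeasure μ] : Integrable (logKer a b x) μ :=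
  (continuous_logKer ha hb x).integrable_of_hasCompactSupport (hasCompactSupport_logKer ha hb x)

lemma integrable_exp_mul_logKer {a b : ℝ} (ha : 0 < a) (hb : 0 < b) (x : ℂ) (μ : Measure ℂ)
    [IsFiniteMeasure μ] (e : ℝ) : Integrable (fun y => Real.exp (e * logKer a b x y)) μ := by
  have hc := continuous_logKer ha hb x
  have h1 : Continuous fun y => Real.exp (e * logKer a b x y) := by fun_prop
  obtain ⟨C, hC⟩ := (hasCompactSupport_logKer ha hb x).exists_bound_of_continuous hc
  refine Integrable.of_bound h1.aestronglyMeasurable (Real.exp (|e| * C))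
    (Eventually.of_forall fun y => ?_)
  rw [Real.norm_eq_abs, Real.abs_exp]
  refine Real.exp_le_exp.2 ((le_abs_self _).trans ?_)
  rw [abs_mul]
  exact mul_le_mul_of_nonneg_left (hC y) (abs_nonneg e)

/-- `W` is locally bounded above by the logarithmic potential of a measure `μ` of mass at most
`m`, where `μ` is itself controlled by `exp W` on the plane and `exp (W / 2)` on the imaginary
axis. -/
structure PotentialBound (c : ℂ) (R m A : ℝ) (W : ℂ → ℝ) (μ : Measure ℂ) : Prop where
  continuous : Continuous W
  mass_le : μ Set.univ ≤ ENNReal.ofReal m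
  lintegral_le : ∀ f : ℂ → ℝ≥0∞, Measurable f → ∫⁻ y, f y ∂μ ≤ ENNReal.ofReal A *
    ((∫⁻ y, f y * ENNReal.ofReal (1 + Real.exp (1 * W y))) +
      ∫⁻ y, f y * ENNReal.ofReal (1 + Real.exp (1 / 2 * W y)) ∂axisMeasure)
  setIntegral_le : ∫ y in Metric.ball c R, max (W y) 0 ≤ A
  weak : ∀ (x : ℂ) (ρ a : ℝ), 0 < a → 0 < ρ → Metric.closedBall x ρ ⊆ Metric.ball c R →
    ∫ y, W y * peakKer a (ρ ^ 2) x y ≤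
      (∫ y, W y * tailKer a (ρ ^ 2) x y) + ∫ y, logKer a (ρ ^ 2) x y ∂μ

namespace PotentialBound

variable {c : ℂ} {R m A : ℝ} {W : ℂ → ℝ} {μ : Measure ℂ}

lemma isFiniteMeasure (h : PotentialBound c R m A W μ) : IsFiniteMeasure μ :=
  ⟨h.mass_le.trans_lt ENNReal.ofReal_lt_top⟩

lemma integral_mul_tailKer_le (h : PotentialBound c R m A W μ) {x : ℂ} {ρ a : ℝ} (ha : 0 < a)
    (hρ : 0 < ρ) (hx : Metric.closedBall x ρ ⊆ Metric.ball c R) :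
    ∫ y, W y * tailKer a (ρ ^ 2) x y ≤ 8 / ρ ^ 2 * A := by
  have hb : 0 < ρ ^ 2 := by positivity
  have hW := h.continuous
  have hout : ∀ y ∉ Metric.ball c R, tailKer a (ρ ^ 2) x y = 0 := fun y hy => by
    have h1 : ρ < ‖y - x‖ := by
      by_contra! h2
      exact hy (hx (by rwa [Metric.mem_closedBall, dist_eq_norm]))
    have h2 : ρ ^ 2 ≤ sqDist x y := by
      rw [sqDist_eq]
      gcongr
    simp [tailKer, cutVar_eq_zero ha hb h2]
  have hint : IntegrableOn (fun y => max (W y) 0) (Metric.ball c R) :=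
    ((hW.max continuous_const).continuousOn.integrableOn_compact
      (isCompact_closedBall c R)).mono_set Metric.ball_subset_closedBall
  calc ∫ y, W y * tailKer a (ρ ^ 2) x y
      = ∫ y in Metric.ball c R, W y * tailKer a (ρ ^ 2) x y :=
        (setIntegral_eq_integral_of_forall_compl_eq_zero fun y hy => by
          rw [hout y hy, mul_zero]).symm
    _ ≤ ∫ y in Metric.ball c R, 8 / ρ ^ 2 * max (W y) 0 := by
        refine setIntegral_mono ?_ (hint.const_mul _) fun y => ?_
        · have := continuous_tailKer ha hb x
          exact ((hW.mul this).continuousOn.integrableOn_compact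
            (isCompact_closedBall c R)).mono_set Metric.ball_subset_closedBall
        · calc W y * tailKer a (ρ ^ 2) x y ≤ max (W y) 0 * tailKer a (ρ ^ 2) x y := by
                gcongr
                · exact tailKer_nonneg ha hb x y
                · exact le_max_left _ _
            _ ≤ max (W y) 0 * (8 / ρ ^ 2) := by
                gcongr
                exact tailKer_le ha hb x y
            _ = _ := mul_comm _ _
    _ = 8 / ρ ^ 2 * ∫ y in Metric.ball c R, max (W y) 0 := integral_const_mul _ _
    _ ≤ _ := by
        gcongr
        exact h.setIntegral_le

lemma integral_mul_peakKer_le (h : PotentialBound c R m A W μ) {x : ℂ} {ρ a : ℝ} (ha : 0 < a)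
    (hρ : 0 < ρ) (hx : Metric.closedBall x ρ ⊆ Metric.ball c R) :
    ∫ y, W y * peakKer a (ρ ^ 2) x y ≤ 8 / ρ ^ 2 * A + ∫ y, logKer a (ρ ^ 2) x y ∂μ :=
  (h.weak x ρ a ha hρ hx).trans (by gcongr; exact h.integral_mul_tailKer_le ha hρ hx)

lemma ofReal_exp_le (h : PotentialBound c R m A W μ) (hm : 0 < m) {κ : ℝ} (hκ : 0 < κ) {x : ℂ}
    {ρ : ℝ} (hρ : 0 < ρ) (hx : Metric.closedBall x ρ ⊆ Metric.ball c R) :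
    ENNReal.ofReal (Real.exp (κ * (4 * Real.pi * W x))) ≤
      ENNReal.ofReal (Real.exp (κ * (8 / ρ ^ 2 * A))) *
        (1 + ENNReal.ofReal m⁻¹ * (ENNReal.ofReal m +
          ENNReal.ofReal ((ρ ^ 2) ^ (m * κ)) * ∫⁻ y, ‖y - x‖ₑ ^ (-(2 * (m * κ))) ∂μ)) := by
  have := h.isFiniteMeasure
  have hb : 0 < ρ ^ 2 := by positivity
  have hlim := tendsto_integral_peakKer h.continuous hb x
  have hlim2 := ENNReal.tendsto_ofReal
    ((Real.continuous_exp.tendsto _).comp (hlim.const_mul κ))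
  refine le_of_tendsto hlim2 ?_
  filter_upwards [eventually_gt_atTop 0] with t ht
  have ha : 0 < t⁻¹ ^ 2 := by positivity
  have h1 := h.integral_mul_peakKer_le ha hρ hx
  have hL := (integrable_logKer ha hb x μ).const_mul κ
  have hE : Integrable (fun y => Real.exp (m * (κ * logKer (t⁻¹ ^ 2) (ρ ^ 2) x y))) μ := by
    simpa only [mul_assoc] using integrable_exp_mul_logKer ha hb x μ (m * κ)
  have hmass : μ.real Set.univ ≤ m := by
    rw [Measure.real]
    exact ENNReal.toReal_le_of_le_ofReal hm.le h.mass_le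
  have h2 := exp_integral_le hm hmass hL hE
  rw [integral_const_mul] at h2
  have h3 : ENNReal.ofReal (∫ y, Real.exp (m * (κ * logKer (t⁻¹ ^ 2) (ρ ^ 2) x y)) ∂μ) ≤
      ENNReal.ofReal m +
        ENNReal.ofReal ((ρ ^ 2) ^ (m * κ)) * ∫⁻ y, ‖y - x‖ₑ ^ (-(2 * (m * κ))) ∂μ := by
    rw [ofReal_integral_eq_lintegral_ofReal hE (ae_of_all _ fun y => (Real.exp_pos _).le)]
    calc _ ≤ ∫⁻ y, 1 + ENNReal.ofReal ((ρ ^ 2) ^ (m * κ)) * ‖y - x‖ₑ ^ (-(2 * (m * κ))) ∂μ := by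
          refine lintegral_mono fun y => ?_
          simpa only [mul_assoc] using ofReal_exp_mul_logKer_le ha hb (mul_pos hm hκ) x y
      _ = μ Set.univ + ENNReal.ofReal ((ρ ^ 2) ^ (m * κ)) *
            ∫⁻ y, ‖y - x‖ₑ ^ (-(2 * (m * κ))) ∂μ := by
          rw [lintegral_add_left measurable_const, lintegral_one, lintegral_const_mul]
          exact (measurable_id.sub_const x).enorm.pow_const _
      _ ≤ _ := by
          gcongr
          exact h.mass_le
  calc ENNReal.ofReal (Real.exp (κ * ∫ y, W y * peakKer (t⁻¹ ^ 2) (ρ ^ 2) x y))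
      ≤ ENNReal.ofReal (Real.exp (κ * (8 / ρ ^ 2 * A)) *
          Real.exp (κ * ∫ y, logKer (t⁻¹ ^ 2) (ρ ^ 2) x y ∂μ)) := by
        rw [← Real.exp_add, ← mul_add]
        gcongr
    _ ≤ ENNReal.ofReal (Real.exp (κ * (8 / ρ ^ 2 * A)) *
          (1 + m⁻¹ * ∫ y, Real.exp (m * (κ * logKer (t⁻¹ ^ 2) (ρ ^ 2) x y)) ∂μ)) := by
        gcongr
    _ = ENNReal.ofReal (Real.exp (κ * (8 / ρ ^ 2 * A))) *
          (1 + ENNReal.ofReal m⁻¹ *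
            ENNReal.ofReal (∫ y, Real.exp (m * (κ * logKer (t⁻¹ ^ 2) (ρ ^ 2) x y)) ∂μ)) := by
        have h0 : 0 ≤ ∫ y, Real.exp (m * (κ * logKer (t⁻¹ ^ 2) (ρ ^ 2) x y)) ∂μ :=
          integral_nonneg fun y => (Real.exp_pos _).le
        rw [ENNReal.ofReal_mul (Real.exp_pos _).le, ENNReal.ofReal_add zero_le_one (by positivity),
          ENNReal.ofReal_one, ENNReal.ofReal_mul (by positivity)]
    _ ≤ _ := by gcongr

end PotentialBound

/-- Uniform exponential integrability. -/
lemma exists_lintegral_exp_le {ν : Measure ℂ} [SFinite ν] {α : ℝ} (hν : RieszBounded ν α)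
    (c : ℂ) {R m : ℝ} (hR : 0 < R) (hm : 0 < m) (A : ℝ) {s : ℝ} (hs : 0 < s)
    (hsm : m * s < 4 * Real.pi * α) :
    ∃ C : ℝ≥0∞, C ≠ ∞ ∧ ∀ W μ, PotentialBound c R m A W μ →
      ∫⁻ x in Metric.ball c (R / 2), ENNReal.ofReal (Real.exp (s * W x)) ∂ν ≤ C := by
  set κ := s / (4 * Real.pi) with hκdef
  have hκ : 0 < κ := by positivity
  have he : 0 < m * κ := mul_pos hm hκ
  have heα : 2 * (m * κ) < 2 * α := by
    have : m * κ < α := by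
      rw [hκdef, ← mul_div_assoc, div_lt_iff₀ (by positivity)]
      linarith
    linarith
  obtain ⟨C₁, hC₁, hbd⟩ := hν.exists_bound (2 * (m * κ)) (by positivity) heα c (R / 2)
  have hB := hν.ball_ne_top c (R / 2)
  set E := ENNReal.ofReal (Real.exp (κ * (8 / (R / 2) ^ 2 * A)))
  set b := ENNReal.ofReal (((R / 2) ^ 2) ^ (m * κ))
  refine ⟨E * (ν (Metric.ball c (R / 2)) + ENNReal.ofReal m⁻¹ *
    (ENNReal.ofReal m * ν (Metric.ball c (R / 2)) + b * (C₁ * ENNReal.ofReal m))), ?_, ?_⟩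
  · finiteness
  intro W μ h
  have := h.isFiniteMeasure
  have hmeas : Measurable fun p : ℂ × ℂ => ‖p.2 - p.1‖ₑ ^ (-(2 * (m * κ))) :=
    (measurable_snd.sub measurable_fst).enorm.pow_const _
  have hmeas1 : Measurable fun x => ∫⁻ y, ‖y - x‖ₑ ^ (-(2 * (m * κ))) ∂μ :=
    hmeas.lintegral_prod_right'
  calc ∫⁻ x in Metric.ball c (R / 2), ENNReal.ofReal (Real.exp (s * W x)) ∂ν
      ≤ ∫⁻ x in Metric.ball c (R / 2), E * (1 + ENNReal.ofReal m⁻¹ * (ENNReal.ofReal m +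
          b * ∫⁻ y, ‖y - x‖ₑ ^ (-(2 * (m * κ))) ∂μ)) ∂ν := by
        refine setLIntegral_mono (by fun_prop) fun x hx => ?_
        have hs' : s * W x = κ * (4 * Real.pi * W x) := by
          rw [hκdef]
          field_simp
        rw [hs']
        refine h.ofReal_exp_le hm hκ (by positivity) fun y hy => ?_
        rw [Metric.mem_ball] at hx ⊢
        rw [Metric.mem_closedBall] at hy
        linarith [dist_triangle y x c]
    _ = E * (ν (Metric.ball c (R / 2)) + ENNReal.ofReal m⁻¹ *
          (ENNReal.ofReal m * ν (Metric.ball c (R / 2)) +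
            b * ∫⁻ x in Metric.ball c (R / 2), ∫⁻ y, ‖y - x‖ₑ ^ (-(2 * (m * κ))) ∂μ ∂ν)) := by
        rw [lintegral_const_mul _ (by fun_prop), lintegral_add_left measurable_const,
          lintegral_const_mul _ (by fun_prop), lintegral_add_left measurable_const,
          lintegral_const_mul _ hmeas1, setLIntegral_const, setLIntegral_const, one_mul]
    _ ≤ _ := by
        gcongr
        rw [lintegral_lintegral_swap hmeas.aemeasurable]
        calc _ ≤ ∫⁻ _, C₁ ∂μ := lintegral_mono fun y => hbd y
          _ = C₁ * μ Set.univ := lintegral_const _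
          _ ≤ _ := by
            gcongr
            exact h.mass_le

lemma logKer_mul_one_add_exp_le {α q ψ w : ℝ} (hα : 0 < α) (hq : 1 < q) (hψ : 0 ≤ ψ) :
    ψ * (1 + Real.exp (α * w)) ≤
      4 / α * ((q - 1)⁻¹ * (1 + Real.exp (α * q * w)) + Real.exp (α / 2 * ψ)) := by
  have hq' : 0 < q - 1 := by linarith
  set v := α * max w 0 with hv
  have hv0 : 0 ≤ v := by positivity
  have h1 : 1 + Real.exp (α * w) ≤ 2 * Real.exp v := by
    have := Real.one_le_exp hv0
    have : Real.exp (α * w) ≤ Real.exp v := by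
      rw [hv]
      gcongr
      exact le_max_left _ _
    linarith
  have h2 : α / 2 * ψ * Real.exp v ≤ v * Real.exp v + Real.exp (α / 2 * ψ) := by
    have h3 : α / 2 * ψ - v ≤ Real.exp (α / 2 * ψ - v) := by
      linarith [Real.add_one_le_exp (α / 2 * ψ - v)]
    have h4 := mul_le_mul_of_nonneg_right h3 (Real.exp_pos v).le
    rw [← Real.exp_add, sub_add_cancel] at h4
    linarith
  have h3 : v * Real.exp v ≤ (q - 1)⁻¹ * (1 + Real.exp (α * q * w)) := by
    have h4 : (q - 1) * v ≤ Real.exp ((q - 1) * v) := by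
      linarith [Real.add_one_le_exp ((q - 1) * v)]
    have h5 : (q - 1) * (v * Real.exp v) ≤ Real.exp (q * v) := by
      have h6 := mul_le_mul_of_nonneg_right h4 (Real.exp_pos v).le
      rw [← Real.exp_add] at h6
      calc _ = (q - 1) * v * Real.exp v := by ring
        _ ≤ _ := h6
        _ = _ := by congr 1; ring
    have h6 : Real.exp (q * v) ≤ 1 + Real.exp (α * q * w) := by
      rcases le_total w 0 with hw | hw
      · rw [hv, max_eq_right hw]
        simp [(Real.exp_pos _).le]
      · rw [hv, max_eq_left hw, show q * (α * w) = α * q * w by ring]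
        linarith
    rw [inv_mul_eq_div, le_div_iff₀ hq']
    linarith
  calc ψ * (1 + Real.exp (α * w)) ≤ ψ * (2 * Real.exp v) := by gcongr
    _ = 4 / α * (α / 2 * ψ * Real.exp v) := by field_simp; ring
    _ ≤ _ := by
      gcongr
      linarith

/-- Uniform bounds for the regularized logarithmic kernels against `exp W`. -/
lemma exists_lintegral_logKer_mul_le {ν : Measure ℂ} [SFinite ν] {α : ℝ} (hα : 0 < α)
    (hν : RieszBounded ν α) (c : ℂ) {R m : ℝ} (hR : 0 < R) (hm : 0 < m)
    (hm4 : m < 4 * Real.pi) (A : ℝ) :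
    ∃ C : ℝ≥0∞, C ≠ ∞ ∧ ∀ W μ, PotentialBound c R m A W μ → ∀ x ∈ Metric.ball c (R / 4),
      ∀ a, 0 < a → ∫⁻ y, ENNReal.ofReal (logKer a ((R / 4) ^ 2) x y) *
        ENNReal.ofReal (1 + Real.exp (α * W y)) ∂ν ≤ C := by
  set q := (1 + 4 * Real.pi / m) / 2 with hqdef
  have h4 : 1 < 4 * Real.pi / m := by rwa [one_lt_div hm]
  have hq : 1 < q := by rw [hqdef]; linarith
  have hq' : 0 < q - 1 := by linarith
  have hqm : m * (α * q) < 4 * Real.pi * α := by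
    have : q < 4 * Real.pi / m := by rw [hqdef]; linarith
    rw [lt_div_iff₀ hm] at this
    nlinarith
  obtain ⟨C₁, hC₁, h₁⟩ := exists_lintegral_exp_le hν c hR hm A (by positivity) hqm
  obtain ⟨C₂, hC₂, h₂⟩ := hν.exists_bound (2 * (α / 2)) (by positivity) (by linarith) c (R / 2)
  have hB := hν.ball_ne_top c (R / 2)
  set B := ν (Metric.ball c (R / 2))
  set b := ENNReal.ofReal (((R / 4) ^ 2) ^ (α / 2))
  refine ⟨ENNReal.ofReal (4 / α) * (ENNReal.ofReal (q - 1)⁻¹ * (B + C₁) + (B + b * C₂)),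
    by finiteness, fun W μ h x hx a ha => ?_⟩
  have hb : 0 < (R / 4) ^ 2 := by positivity
  have hmW : Measurable W := h.continuous.measurable
  have hmL : Measurable (logKer a ((R / 4) ^ 2) x) := (continuous_logKer ha hb x).measurable
  have hmR : Measurable fun y => ‖x - y‖ₑ ^ (-(2 * (α / 2))) :=
    (measurable_id.const_sub x).enorm.pow_const _
  have hsupp : Function.support (fun y => ENNReal.ofReal (logKer a ((R / 4) ^ 2) x y) *
        ENNReal.ofReal (1 + Real.exp (α * W y))) ⊆ Metric.ball c (R / 2) := by
    intro y hy
    by_contra hyB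
    refine hy ?_
    have h5 : (R / 4) ^ 2 ≤ sqDist x y := by
      rw [sqDist_eq, ← dist_eq_norm]
      rw [Metric.mem_ball] at hyB hx
      have := dist_triangle y x c
      gcongr
      linarith
    simp [logKer_eq_zero ha hb h5]
  rw [← setLIntegral_eq_of_support_subset hsupp]
  calc _ ≤ ∫⁻ y in Metric.ball c (R / 2), ENNReal.ofReal (4 / α) *
        (ENNReal.ofReal (q - 1)⁻¹ * (1 + ENNReal.ofReal (Real.exp (α * q * W y))) +
          (1 + b * ‖x - y‖ₑ ^ (-(2 * (α / 2))))) ∂ν := by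
        refine lintegral_mono fun y => ?_
        rw [← ENNReal.ofReal_mul (logKer_nonneg ha hb x y)]
        refine (ENNReal.ofReal_le_ofReal
          (logKer_mul_one_add_exp_le hα hq (logKer_nonneg ha hb x y))).trans ?_
        rw [ENNReal.ofReal_mul (by positivity), ENNReal.ofReal_add (by positivity) (by positivity),
          ENNReal.ofReal_mul (by positivity), ENNReal.ofReal_add zero_le_one (by positivity),
          ENNReal.ofReal_one]
        gcongr
        rw [← enorm_neg (x - y), neg_sub]
        exact ofReal_exp_mul_logKer_le ha hb (by positivity) x y
    _ = ENNReal.ofReal (4 / α) * (ENNReal.ofReal (q - 1)⁻¹ *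
          (B + ∫⁻ y in Metric.ball c (R / 2), ENNReal.ofReal (Real.exp (α * q * W y)) ∂ν) +
          (B + b * ∫⁻ y in Metric.ball c (R / 2), ‖x - y‖ₑ ^ (-(2 * (α / 2))) ∂ν)) := by
        rw [lintegral_const_mul _ (by fun_prop), lintegral_add_left (by fun_prop),
          lintegral_const_mul _ (by fun_prop), lintegral_add_left measurable_const,
          lintegral_add_left measurable_const, lintegral_const_mul _ hmR, setLIntegral_const,
          one_mul]
    _ ≤ _ := by
        gcongr
        · exact h₁ W μ h
        · exact h₂ x

/-- A uniform upper bound from smallness of the mass. -/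
theorem exists_forall_le_of_potentialBound (c : ℂ) {R m : ℝ} (hR : 0 < R) (hm : 0 < m)
    (hm4 : m < 4 * Real.pi) (A : ℝ) :
    ∃ M, ∀ W μ, PotentialBound c R m A W μ → ∀ x ∈ Metric.ball c (R / 4), W x ≤ M := by
  obtain ⟨C₁, hC₁, h₁⟩ :=
    exists_lintegral_logKer_mul_le one_pos rieszBounded_volume c hR hm hm4 A
  obtain ⟨C₂, hC₂, h₂⟩ :=
    exists_lintegral_logKer_mul_le (by norm_num) rieszBounded_axisMeasure c hR hm hm4 A
  set C := ENNReal.ofReal A * (C₁ + C₂)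
  have hC : C ≠ ∞ := by finiteness
  refine ⟨(8 / (R / 4) ^ 2 * A + C.toReal) / (4 * Real.pi), fun W μ h x hx => ?_⟩
  have := h.isFiniteMeasure
  rw [le_div_iff₀ (by positivity), mul_comm]
  have hb : 0 < (R / 4) ^ 2 := by positivity
  refine le_of_tendsto (tendsto_integral_peakKer h.continuous hb x) ?_
  filter_upwards [eventually_gt_atTop 0] with t ht
  have ha : 0 < t⁻¹ ^ 2 := by positivity
  refine (h.integral_mul_peakKer_le ha (by positivity) fun y hy => ?_).trans ?_
  · rw [Metric.mem_ball] at hx ⊢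
    rw [Metric.mem_closedBall] at hy
    linarith [dist_triangle y x c]
  gcongr
  refine (ENNReal.ofReal_le_iff_le_toReal hC).1 ?_
  rw [ofReal_integral_eq_lintegral_ofReal (integrable_logKer ha hb x μ)
    (ae_of_all _ fun y => logKer_nonneg ha hb x y)]
  refine (h.lintegral_le _ (continuous_logKer ha hb x).measurable.ennreal_ofReal).trans ?_
  refine mul_le_mul_right (add_le_add ?_ ?_) _
  · exact h₁ W μ h x hx _ ha
  · exact h₂ W μ h x hx _ ha

instance : IsFiniteMeasureOnCompacts axisMeasure := ⟨fun K hK => by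
  obtain ⟨R, hR⟩ := hK.isBounded.subset_ball 0
  exact (measure_mono hR).trans_lt (rieszBounded_axisMeasure.ball_ne_top 0 R).lt_top⟩

lemma ae_axisMeasure {P : ℂ → Prop} (h : ∀ t : ℝ, P ⟨0, t⟩) : ∀ᵐ y ∂axisMeasure, P y := by
  have h0 : ∀ᵐ y ∂axisMeasure, y.re = 0 := by
    rw [axisMeasure, ae_map_iff (continuous_mk_right 0).aemeasurable
      (measurableSet_eq_fun Complex.measurable_re measurable_const)]
    exact ae_of_all _ fun t => rfl
  filter_upwards [h0] with y hy
  have : y = ⟨0, y.im⟩ := Complex.ext hy rfl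
  rw [this]
  exact h _

lemma integral_axisMeasure {f : ℂ → ℝ} (hf : Continuous f) :
    ∫ z, f z ∂axisMeasure = ∫ t : ℝ, f ⟨0, t⟩ :=
  integral_map (continuous_mk_right 0).aemeasurable hf.aestronglyMeasurable

section Density

variable {ν : Measure ℂ} {c : ℂ} {R A α : ℝ} {W g G : ℂ → ℝ}

/-- The measure with density `G` on the ball `B_R(c)` of the measure `ν`. -/
def ballDensity (ν : Measure ℂ) (c : ℂ) (R : ℝ) (G : ℂ → ℝ) : Measure ℂ :=
  (ν.restrict (Metric.ball c R)).withDensity fun y => ENNReal.ofReal (G y)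

lemma lintegral_ballDensity_le (hG : Measurable G)
    (hGA : ∀ᵐ y ∂ν, y ∈ Metric.ball c R → G y ≤ A * (1 + Real.exp (α * W y)))
    {f : ℂ → ℝ≥0∞} (hf : Measurable f) (hW : Measurable W) :
    ∫⁻ y, f y ∂(ballDensity ν c R G) ≤
      ENNReal.ofReal A * ∫⁻ y, f y * ENNReal.ofReal (1 + Real.exp (α * W y)) ∂ν := by
  rw [ballDensity, lintegral_withDensity_eq_lintegral_mul _ hG.ennreal_ofReal hf,
    ← lintegral_const_mul _ (by fun_prop)]
  refine (lintegral_mono_ae ?_).trans (setLIntegral_le_lintegral (Metric.ball c R) _)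
  filter_upwards [ae_restrict_of_ae hGA, ae_restrict_mem measurableSet_ball] with y hy hyB
  rw [Pi.mul_apply, ← mul_assoc, mul_right_comm, ← ENNReal.ofReal_mul' (by positivity)]
  gcongr
  exact hy hyB

lemma integral_le_integral_ballDensity [IsFiniteMeasureOnCompacts ν] {ψ : ℂ → ℝ}
    (hψ : Continuous ψ) (hψ0 : ∀ y, 0 ≤ ψ y) (hsupp : ∀ y ∉ Metric.ball c R, ψ y = 0)
    (hg : Continuous g) (hG : Continuous G) (hG0 : ∀ y, 0 ≤ G y)
    (hgG : ∀ᵐ y ∂ν, y ∈ Metric.ball c R → g y ≤ G y) :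
    ∫ y, g y * ψ y ∂ν ≤ ∫ y, ψ y ∂(ballDensity ν c R G) := by
  have key : ∀ f : ℂ → ℝ, Continuous f →
      IntegrableOn (fun y => f y * ψ y) (Metric.ball c R) ν := fun f hf =>
    ((hf.mul hψ).continuousOn.integrableOn_compact
      (isCompact_closedBall c R)).mono_set Metric.ball_subset_closedBall
  rw [ballDensity, integral_withDensity_eq_integral_toReal_smul hG.measurable.ennreal_ofReal
    (ae_of_all _ fun y => ENNReal.ofReal_lt_top)]
  calc ∫ y, g y * ψ y ∂ν = ∫ y in Metric.ball c R, g y * ψ y ∂ν :=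
        (setIntegral_eq_integral_of_forall_compl_eq_zero fun y hy => by
          rw [hsupp y hy, mul_zero]).symm
    _ ≤ ∫ y in Metric.ball c R, G y * ψ y ∂ν := by
        refine integral_mono_ae (key g hg) (key G hG) ?_
        filter_upwards [ae_restrict_of_ae hgG, ae_restrict_mem measurableSet_ball] with y hy hyB
        exact mul_le_mul_of_nonneg_right (hy hyB) (hψ0 y)
    _ = _ := by
        refine integral_congr_ae (ae_of_all _ fun y => ?_)
        simp [ENNReal.toReal_ofReal (hG0 y)]

end Density

/-- Potential bounds from a weak inequality with continuous densities. -/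
lemma PotentialBound.of_green {c : ℂ} {R m A : ℝ} {W g G k H : ℂ → ℝ}
    (hW : Continuous W) (hg : Continuous g) (hG : Continuous G) (hk : Continuous k)
    (hH : Continuous H) (hG0 : ∀ y, 0 ≤ G y) (hH0 : ∀ y, 0 ≤ H y)
    (hgG : ∀ y ∈ Metric.ball c R, g y ≤ G y)
    (hGA : ∀ y ∈ Metric.ball c R, G y ≤ A * (1 + Real.exp (W y)))
    (hkH : ∀ t : ℝ, (⟨0, t⟩ : ℂ) ∈ Metric.ball c R → k ⟨0, t⟩ ≤ H ⟨0, t⟩)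
    (hHA : ∀ t : ℝ, (⟨0, t⟩ : ℂ) ∈ Metric.ball c R →
      H ⟨0, t⟩ ≤ A * (1 + Real.exp (W ⟨0, t⟩ / 2)))
    (hmass : (∫⁻ y in Metric.ball c R, ENNReal.ofReal (G y)) +
      (∫⁻ y in Metric.ball c R, ENNReal.ofReal (H y) ∂axisMeasure) ≤ ENNReal.ofReal m)
    (hpos : ∫ y in Metric.ball c R, max (W y) 0 ≤ A)
    (hgreen : ∀ (ψ ψs ψss ψt ψtt : ℂ → ℝ) (T : ℝ), HasPartials ψ ψs ψss ψt ψtt → 0 ≤ T →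
      (∀ z, T < ‖z‖ → ψ z = 0) → ∫ y, W y * (ψss y + ψtt y) =
        -(∫ y, g y * ψ y) - ∫ y, k y * ψ y ∂axisMeasure) :
    PotentialBound c R m A W (ballDensity volume c R G + ballDensity axisMeasure c R H) := by
  have f1 : IsFiniteMeasure (ballDensity volume c R G) :=
    isFiniteMeasure_withDensity ((le_self_add.trans hmass).trans_lt ENNReal.ofReal_lt_top).ne
  have f2 : IsFiniteMeasure (ballDensity axisMeasure c R H) :=
    isFiniteMeasure_withDensity ((le_add_self.trans hmass).trans_lt ENNReal.ofReal_lt_top).ne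
  refine ⟨hW, ?_, fun f hf => ?_, hpos, fun x ρ a ha hρ hx => ?_⟩
  · rw [Measure.add_apply, ballDensity, ballDensity, withDensity_apply _ MeasurableSet.univ,
      withDensity_apply _ MeasurableSet.univ, Measure.restrict_univ, Measure.restrict_univ]
    exact hmass
  · rw [lintegral_add_measure, mul_add]
    refine add_le_add (lintegral_ballDensity_le hG.measurable ?_ hf hW.measurable)
      (lintegral_ballDensity_le hH.measurable ?_ hf hW.measurable)
    · exact ae_of_all _ fun y hy => by simpa using hGA y hy
    · refine ae_axisMeasure fun t ht => ?_
      have := hHA t ht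
      rwa [one_div, inv_mul_eq_div]
  · have hb : 0 < ρ ^ 2 := by positivity
    obtain ⟨ψs, ψss, ψt, ψtt, hψ, hL⟩ := logKer_hasPartials ha hb x
    have hfar : ∀ y, ρ < ‖y - x‖ → ρ ^ 2 ≤ sqDist x y := fun y hy => by
      rw [sqDist_eq]
      gcongr
    have hfar2 : ∀ z, ‖x‖ + ρ < ‖z‖ → ρ ^ 2 ≤ sqDist x z := fun z hz =>
      hfar z (by linarith [norm_sub_norm_le z x])
    have hfar3 : ∀ y ∉ Metric.ball c R, ρ ^ 2 ≤ sqDist x y := fun y hy => hfar y <| by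
      by_contra! h2
      exact hy (hx (by rwa [Metric.mem_closedBall, dist_eq_norm]))
    have hsupp : ∀ y ∉ Metric.ball c R, logKer a (ρ ^ 2) x y = 0 := fun y hy =>
      logKer_eq_zero ha hb (hfar3 y hy)
    have h1 := hgreen _ _ _ _ _ (‖x‖ + ρ) hψ (by positivity) fun z hz =>
      logKer_eq_zero ha hb (hfar2 z hz)
    have c1 := continuous_tailKer ha hb x
    have c2 := continuous_peakKer (b := ρ ^ 2) ha x
    have i1 : Integrable fun y => W y * tailKer a (ρ ^ 2) x y :=
      (hW.mul c1).integrable_of_hasCompactSupport <| hasCompactSupport_of_norm (T := ‖x‖ + ρ) fun z hz => by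
        simp [tailKer, cutVar_eq_zero ha hb (hfar2 z hz)]
    have i2 : Integrable fun y => W y * peakKer a (ρ ^ 2) x y :=
      (hW.mul c2).integrable_of_hasCompactSupport <| hasCompactSupport_of_norm (T := ‖x‖ + ρ) fun z hz => by
        simp [peakKer, cutVar_eq_zero ha hb (hfar2 z hz)]
    simp only [hL, mul_sub] at h1
    rw [integral_sub i1 i2] at h1
    have cL := continuous_logKer ha hb x
    have h2 := integral_le_integral_ballDensity (ν := volume) cL (logKer_nonneg ha hb x) hsupp
      hg hG hG0 (ae_of_all _ hgG)
    have h3 := integral_le_integral_ballDensity (ν := axisMeasure) cL (logKer_nonneg ha hb x)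
      hsupp hk hH hH0 (ae_axisMeasure hkH)
    rw [integral_add_measure (integrable_logKer ha hb x _) (integrable_logKer ha hb x _)]
    linarith

lemma continuous_lap {w : ℂ → ℝ} (hw : ContDiff ℝ 2 w) : Continuous (lap w) :=
  (HasPartials.of_contDiff hw).cont_ss.add (HasPartials.of_contDiff hw).cont_tt

lemma integrableOn_ball_of_continuous {f : ℂ → ℝ} (hf : Continuous f) (c : ℂ) (R : ℝ) :
    IntegrableOn f (Metric.ball c R) :=
  (hf.continuousOn.integrableOn_compact (isCompact_closedBall c R)).mono_set
    Metric.ball_subset_closedBall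

lemma setIntegral_max_zero_le {f : ℂ → ℝ} (hf : Continuous f) {c : ℂ} {R : ℝ}
    {s : Set ℂ} (hs : IntegrableOn (fun z => Real.exp (f z)) s) (hsub : Metric.ball c R ⊆ s) :
    ∫ z in Metric.ball c R, max (f z) 0 ≤ ∫ z in s, Real.exp (f z) := by
  refine (setIntegral_mono (integrableOn_ball_of_continuous (hf.max continuous_const) c R)
    (integrableOn_ball_of_continuous (Real.continuous_exp.comp hf) c R) fun z => ?_).trans
    (setIntegral_mono_set hs (ae_of_all _ fun z => (Real.exp_pos _).le) hsub.eventuallyLE)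
  exact max_le (by simp only [Function.comp]; linarith [Real.add_one_le_exp (f z)])
    (Real.exp_pos _).le

lemma exists_interior_bound {u K Kh : ℕ → ℂ → ℝ} (hu : ∀ n, ContDiff ℝ 2 (u n))
    (hK : ∀ n, Continuous (K n)) {C₀ C₁ : ℝ}
    (hK1 : ∀ n, ∀ z ∈ unitClosedDisk, |K n z| ≤ C₁)
    (hKh1 : ∀ n, ∀ z ∈ unitClosedDisk, |Kh n z| ≤ C₁)
    (heq : ∀ n, ∀ z ∈ unitDisk, -lap (u n) z + 2 * Kh n z = 2 * K n z * Real.exp (u n z))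
    (hmass : ∀ n, ∫ z in unitDisk, Real.exp (u n z) ≤ C₀) {q : ℂ} {r ε : ℝ} (hr : 0 < r)
    (hball : Metric.ball q r ⊆ unitDisk) (hε : ε < 2 * Real.pi)
    (hsmall : ∀ n, ∫ z in Metric.ball q r, max (K n z) 0 * Real.exp (u n z) ≤ ε) :
    ∃ δ > 0, ∃ M, ∀ n, ∀ z ∈ Metric.ball q δ, u n z ≤ M := by
  have hC₁ : 0 ≤ C₁ := (abs_nonneg _).trans (hK1 0 0 (by simp [unitClosedDisk]))
  have hε0 : 0 ≤ ε := (integral_nonneg fun z => by positivity).trans (hsmall 0)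
  obtain ⟨R, ⟨hRr, hRs⟩, hR⟩ : ∃ R : ℝ, (R < r ∧ R ^ 2 * Real.pi * (2 * C₁) < 2 * Real.pi - ε) ∧
      0 < R := by
    have h1 : ∀ᶠ R : ℝ in 𝓝 0, R < r := gt_mem_nhds hr
    have h2 : ∀ᶠ R : ℝ in 𝓝 0, R ^ 2 * Real.pi * (2 * C₁) < 2 * Real.pi - ε := by
      refine ContinuousAt.eventually_lt (by fun_prop) continuousAt_const ?_
      simpa using hε
    have h3 : ∀ᶠ R : ℝ in 𝓝[>] 0, 0 < R := self_mem_nhdsWithin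
    exact (((h1.and h2).filter_mono nhdsWithin_le_nhds).and h3).exists
  have hRball : Metric.ball q R ⊆ Metric.ball q r := Metric.ball_subset_ball hRr.le
  have hdc : unitDisk ⊆ unitClosedDisk := Metric.ball_subset_closedBall
  obtain ⟨M, hM⟩ := exists_forall_le_of_potentialBound q hR (m := ε + 2 * Real.pi)
    (by positivity) (by linarith) (max (2 * C₁) C₀)
  refine ⟨R / 4, by positivity, M, fun n => ?_⟩
  have hun := (hu n).continuous
  have hKn := hK n
  have hGc : Continuous fun z => 2 * (max (K n z) 0 * Real.exp (u n z)) + 2 * C₁ := by fun_prop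
  have hlap := continuous_lap (hu n)
  refine hM (u n) _ (PotentialBound.of_green (g := fun z => -lap (u n) z)
    (G := fun z => 2 * (max (K n z) 0 * Real.exp (u n z)) + 2 * C₁) (k := 0) (H := 0) hun
    hlap.neg hGc continuous_zero continuous_zero (fun y => by positivity) (fun y => le_rfl)
    (fun y hy => ?_) (fun y hy => ?_) (fun t _ => le_rfl) (fun t _ => ?_) ?_ ?_ ?_)
  · have hy' := hball (hRball hy)
    have h1 := heq n y hy'
    have h2 := (abs_le.1 (hKh1 n y (hdc hy'))).1
    have h2' := (abs_le.1 (hKh1 n y (hdc hy'))).2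
    have h3 : K n y * Real.exp (u n y) ≤ max (K n y) 0 * Real.exp (u n y) := by
      gcongr
      exact le_max_left _ _
    linarith
  · have h2 := (abs_le.1 (hK1 n y (hdc (hball (hRball hy))))).2
    have h3 : max (K n y) 0 * Real.exp (u n y) ≤ C₁ * Real.exp (u n y) := by
      gcongr
      exact max_le h2 hC₁
    calc _ ≤ 2 * C₁ * (1 + Real.exp (u n y)) := by linarith
      _ ≤ _ := by
        gcongr
        exact le_max_left _ _
  · have : 0 ≤ max (2 * C₁) C₀ := le_max_of_le_left (by positivity)
    simp only [Pi.zero_apply]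
    positivity
  · simp only [Pi.zero_apply, ENNReal.ofReal_zero, lintegral_zero, add_zero]
    have hi := integrableOn_ball_of_continuous hGc q R
    rw [← ofReal_integral_eq_lintegral_ofReal hi (ae_of_all _ fun y => by positivity)]
    refine ENNReal.ofReal_le_ofReal ?_
    have hc1 : Continuous fun z => max (K n z) 0 * Real.exp (u n z) := by fun_prop
    have i1 := integrableOn_ball_of_continuous hc1 q R
    have i2 := integrableOn_ball_of_continuous hc1 q r
    rw [integral_add (i1.const_mul 2) (integrableOn_ball_of_continuous continuous_const q R),
      integral_const_mul, setIntegral_const, Measure.real, Complex.volume_ball]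
    have h1 := (setIntegral_mono_set i2 (ae_of_all _ fun z => by positivity)
      hRball.eventuallyLE).trans (hsmall n)
    have h2 : (ENNReal.ofReal R ^ 2 * (NNReal.pi : ℝ≥0∞)).toReal = R ^ 2 * Real.pi := by
      rw [ENNReal.toReal_mul, ENNReal.toReal_pow, ENNReal.toReal_ofReal hR.le]
      rfl
    rw [h2, smul_eq_mul]
    linarith
  · refine (setIntegral_max_zero_le hun ?_ (hRball.trans hball)).trans
      ((hmass n).trans (le_max_right _ _))
    exact integrableOn_ball_of_continuous (Real.continuous_exp.comp hun) 0 1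
  · intro ψ ψs ψss ψt ψtt T hψ hT h0
    rw [integral_mul_laplacian (HasPartials.of_contDiff (hu n)) hψ h0]
    simp only [neg_mul, integral_neg, neg_neg, Pi.zero_apply, zero_mul, integral_zero, sub_zero]
    rfl

/-- The exponential chart of the punctured plane at `p`. -/
def expChart (p ζ : ℂ) : ℂ := p * Complex.exp ζ

lemma hasFDerivAt_expChart (p ζ : ℂ) :
    HasFDerivAt (expChart p) (expChart p ζ • (1 : ℂ →L[ℝ] ℂ)) ζ :=
  HasDerivAt.complexToReal_fderiv ((Complex.hasDerivAt_exp ζ).const_mul p)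

lemma contDiff_expChart (p : ℂ) : ContDiff ℝ 2 (expChart p) :=
  contDiff_const.mul Complex.contDiff_exp

lemma continuous_expChart (p : ℂ) : Continuous (expChart p) := (contDiff_expChart p).continuous

lemma norm_expChart {p : ℂ} (hp : ‖p‖ = 1) (ζ : ℂ) : ‖expChart p ζ‖ = Real.exp ζ.re := by
  rw [expChart, norm_mul, hp, one_mul, Complex.norm_exp]

lemma det_smul_one_complex (E : ℂ) : (E • (1 : ℂ →L[ℝ] ℂ)).det = ‖E‖ ^ 2 := by
  have h : ((E • (1 : ℂ →L[ℝ] ℂ) : ℂ →L[ℝ] ℂ) : ℂ →ₗ[ℝ] ℂ) = LinearMap.mul ℝ ℂ E := by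
    ext; simp
  rw [ContinuousLinearMap.det, h, ← Complex.normSq_eq_norm_sq, ← Algebra.norm_complex_apply]
  rfl

lemma dirDeriv_comp_expChart {u : ℂ → ℝ} (hu : ContDiff ℝ 2 u) (p v ζ : ℂ) :
    dirDeriv v (fun ζ => u (expChart p ζ)) ζ =
      fderiv ℝ u (expChart p ζ) (expChart p ζ * v) := by
  have h1 := (hu.differentiable (by norm_num) (expChart p ζ)).hasFDerivAt
  have h2 : HasFDerivAt (fun ζ => u (expChart p ζ)) _ ζ := h1.comp ζ (hasFDerivAt_expChart p ζ)
  rw [dirDeriv, h2.fderiv]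
  simp

lemma dirDeriv_dirDeriv_eq {u : ℂ → ℝ} (hu : ContDiff ℝ 2 u) (v v' z : ℂ) :
    dirDeriv v (dirDeriv v' u) z = fderiv ℝ (fderiv ℝ u) z v v' := by
  have h1 : HasFDerivAt (fderiv ℝ u) (fderiv ℝ (fderiv ℝ u) z) z :=
    ((hu.fderiv_right (m := 1) (by norm_num)).differentiable (by norm_num) z).hasFDerivAt
  have h2 := h1.clm_apply (hasFDerivAt_const v' z)
  rw [dirDeriv, show dirDeriv v' u = fun z => fderiv ℝ u z v' from rfl, h2.fderiv]
  simp

lemma dirDeriv_dirDeriv_comp_expChart {u : ℂ → ℝ} (hu : ContDiff ℝ 2 u) (p v ζ : ℂ) :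
    dirDeriv v (dirDeriv v (fun ζ => u (expChart p ζ))) ζ =
      fderiv ℝ (fderiv ℝ u) (expChart p ζ) (expChart p ζ * v) (expChart p ζ * v) +
        fderiv ℝ u (expChart p ζ) (expChart p ζ * v * v) := by
  have h1 : HasFDerivAt (fderiv ℝ u) (fderiv ℝ (fderiv ℝ u) (expChart p ζ)) (expChart p ζ) :=
    ((hu.fderiv_right (m := 1) (by norm_num)).differentiable (by norm_num) _).hasFDerivAt
  have h2 : HasFDerivAt (fun ζ => fderiv ℝ u (expChart p ζ) (expChart p ζ * v)) _ ζ :=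
    (h1.comp ζ (hasFDerivAt_expChart p ζ)).clm_apply ((hasFDerivAt_expChart p ζ).mul_const v)
  rw [dirDeriv, show dirDeriv v (fun ζ => u (expChart p ζ)) = fun ζ =>
    fderiv ℝ u (expChart p ζ) (expChart p ζ * v) from funext (dirDeriv_comp_expChart hu p v),
    h2.fderiv]
  simp [add_comm, mul_comm]

lemma lap_comp_expChart {u : ℂ → ℝ} (hu : ContDiff ℝ 2 u) (p ζ : ℂ) :
    lap (fun ζ => u (expChart p ζ)) ζ = ‖expChart p ζ‖ ^ 2 * lap u (expChart p ζ) := by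
  rw [lap, lap, dirDeriv_dirDeriv_comp_expChart hu, dirDeriv_dirDeriv_comp_expChart hu,
    dirDeriv_dirDeriv_eq hu, dirDeriv_dirDeriv_eq hu]
  set E := expChart p ζ
  set B := fderiv ℝ (fderiv ℝ u) E
  have e1 : E * 1 = E.re • (1 : ℂ) + E.im • Complex.I := by
    apply Complex.ext <;> simp
  have e2 : E * Complex.I = (-E.im) • (1 : ℂ) + E.re • Complex.I := by
    apply Complex.ext <;> simp
  have e3 : E * Complex.I * Complex.I = -(E * 1 * 1) := by
    rw [mul_assoc, Complex.I_mul_I]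
    ring
  rw [e3, map_neg, e1, e2, ← Complex.normSq_eq_norm_sq, Complex.normSq_apply]
  simp only [map_add, map_smul, add_apply, smul_apply,
    smul_eq_mul]
  ring

lemma injOn_expChart {p : ℂ} (hp : p ≠ 0) : Set.InjOn (expChart p) (Metric.ball 0 1) := by
  intro x hx y hy hxy
  rw [mem_ball_zero_iff] at hx hy
  have h1 := abs_lt.1 ((Complex.abs_im_le_norm x).trans_lt hx)
  have h2 := abs_lt.1 ((Complex.abs_im_le_norm y).trans_lt hy)
  have hpi := Real.pi_gt_three
  exact Complex.exp_inj_of_neg_pi_lt_of_le_pi (by linarith) (by linarith) (by linarith)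
    (by linarith) (mul_left_cancel₀ hp hxy)

lemma lintegral_image_expChart {p : ℂ} (hp : p ≠ 0) {s : Set ℂ} (hs : MeasurableSet s)
    (hs1 : s ⊆ Metric.ball 0 1) (f : ℂ → ℝ≥0∞) :
    ∫⁻ z in expChart p '' s, f z =
      ∫⁻ ζ in s, ENNReal.ofReal (‖expChart p ζ‖ ^ 2) * f (expChart p ζ) := by
  rw [lintegral_image_eq_lintegral_abs_det_fderiv_mul volume hs
    (fun ζ _ => (hasFDerivAt_expChart p ζ).hasFDerivWithinAt) ((injOn_expChart hp).mono hs1)]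
  refine lintegral_congr fun ζ => ?_
  rw [det_smul_one_complex, abs_of_nonneg (by positivity)]

lemma fold_of_re_nonpos {z : ℂ} (hz : z.re ≤ 0) : fold z = z :=
  Complex.ext (by simp [fold, abs_of_nonpos hz]) rfl

lemma fold_re_nonpos (z : ℂ) : (fold z).re ≤ 0 := by simp [fold]

lemma norm_fold (z : ℂ) : ‖fold z‖ = ‖z‖ := by
  rw [← sq_eq_sq₀ (norm_nonneg _) (norm_nonneg _), ← Complex.normSq_eq_norm_sq,
    ← Complex.normSq_eq_norm_sq, Complex.normSq_apply, Complex.normSq_apply]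
  simp [fold]

lemma measurableSet_ball_inter_re_nonpos (R : ℝ) :
    MeasurableSet (Metric.ball (0 : ℂ) R ∩ {z | z.re ≤ 0}) :=
  measurableSet_ball.inter (measurableSet_le Complex.measurable_re measurable_const)

lemma lintegral_fold_le {f : ℂ → ℝ≥0∞} (R : ℝ) :
    ∫⁻ z in Metric.ball 0 R, f (fold z) ≤
      2 * ∫⁻ z in Metric.ball 0 R ∩ {z | z.re ≤ 0}, f z := by
  set s : Set ℂ := {z | z.re ≤ 0} with hs
  have hsm : MeasurableSet s := measurableSet_le Complex.measurable_re measurable_const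
  rw [← lintegral_inter_add_sdiff _ _ hsm, two_mul]
  refine add_le_add (le_of_eq (setLIntegral_congr_fun (measurableSet_ball.inter hsm)
    fun z hz => by rw [fold_of_re_nonpos hz.2])) ?_
  set σ : ℂ ≃ₗᵢ[ℝ] ℂ := Complex.conjLIE.trans (LinearIsometryEquiv.neg ℝ) with hσ
  have hσre : ∀ z, (σ z).re = -z.re := fun z => by simp [hσ]
  have hmp : MeasurePreserving σ := σ.measurePreserving
  have hpre : σ ⁻¹' (Metric.ball 0 R ∩ {z | z.re < 0}) = Metric.ball 0 R \ s := by
    ext z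
    simp [hs, hσre]
  calc ∫⁻ z in Metric.ball 0 R \ s, f (fold z) = ∫⁻ z in Metric.ball 0 R \ s, f (σ z) := by
        refine setLIntegral_congr_fun (measurableSet_ball.diff hsm) fun z hz => ?_
        have hz2 : 0 < z.re := not_le.1 hz.2
        have : fold z = σ z := Complex.ext (by simp [fold, hσ, abs_of_pos hz2]) (by simp [fold, hσ])
        simp only [this]
    _ = ∫⁻ z in Metric.ball 0 R ∩ {z | z.re < 0}, f z := by
        rw [← hpre, hmp.setLIntegral_comp_preimage_emb
          σ.toHomeomorph.measurableEmbedding]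
    _ ≤ _ := lintegral_mono_set (Set.inter_subset_inter_right _ fun z (hz : z.re < 0) =>
        show z.re ≤ 0 from hz.le)

lemma volume_le_hausdorffMeasure_image {γ : ℝ → ℂ} {s : Set ℝ} {K : NNReal}
    (h : ∀ t ∈ s, ∀ t' ∈ s, dist t t' ≤ K * dist (γ t) (γ t')) :
    volume s ≤ K * μH[1] (γ '' s) := by
  have hinj : Set.InjOn γ s := fun t ht t' ht' htt' => by
    have := h t ht t' ht'
    rw [htt', dist_self, mul_zero] at this
    exact dist_le_zero.1 this
  have hl : LipschitzOnWith K (Function.invFunOn γ s) (γ '' s) := by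
    refine LipschitzOnWith.of_dist_le_mul ?_
    rintro _ ⟨t, ht, rfl⟩ _ ⟨t', ht', rfl⟩
    rw [hinj.leftInvOn_invFunOn ht, hinj.leftInvOn_invFunOn ht']
    exact h t ht t' ht'
  have h1 := hl.hausdorffMeasure_image_le (d := 1) zero_le_one
  rw [hinj.leftInvOn_invFunOn.image_image, ENNReal.rpow_one, hausdorffMeasure_real] at h1
  exact h1

lemma lintegral_comp_le_arcMeasure {γ : ℝ → ℂ} (hγ : Measurable γ) {s : Set ℝ}
    {B : Set ℂ} (hsB : Set.MapsTo γ s B)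
    {K : NNReal} (h : ∀ t ∈ s, ∀ t' ∈ s, dist t t' ≤ K * dist (γ t) (γ t'))
    {f : ℂ → ℝ≥0∞} (hf : Measurable f) :
    ∫⁻ t in s, f (γ t) ≤ K * ∫⁻ z in B, f z ∂arcMeasure := by
  rw [← lintegral_map hf hγ, ← smul_eq_mul, ← lintegral_smul_measure]
  refine lintegral_mono' (Measure.le_iff.2 fun E hE => ?_) le_rfl
  rw [Measure.map_apply hγ hE, Measure.restrict_apply (hγ hE), Measure.smul_apply,
    Measure.restrict_apply hE, smul_eq_mul]
  refine (volume_le_hausdorffMeasure_image (K := K) fun t ht t' ht' =>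
    h t ht.2 t' ht'.2).trans ?_
  refine mul_le_mul_right (measure_mono (μ := arcMeasure) ?_) _
  rintro _ ⟨t, ht, rfl⟩
  exact ⟨ht.1, hsB ht.2⟩

lemma dist_expChart_axis {p : ℂ} (hp : ‖p‖ = 1) (t t' : ℝ) :
    dist (expChart p ⟨0, t⟩) (expChart p ⟨0, t'⟩) = ‖Complex.exp (Complex.I * (t - t' : ℝ)) - 1‖ := by
  have h1 : (⟨0, t⟩ : ℂ) = Complex.I * (t - t' : ℝ) + ⟨0, t'⟩ := by
    apply Complex.ext <;> simp
  have h2 : ‖Complex.exp ⟨0, t'⟩‖ = 1 := by simp [Complex.norm_exp]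
  rw [h1, dist_eq_norm, expChart, expChart, Complex.exp_add, ← mul_sub, norm_mul, hp, one_mul,
    ← sub_one_mul, norm_mul, h2, mul_one]

lemma dist_le_dist_expChart {p : ℂ} (hp : ‖p‖ = 1) {R : ℝ} (hR : R < 1 / 2) {t t' : ℝ}
    (ht : |t| < R) (ht' : |t'| < R) :
    dist t t' ≤ (1 - 2 * R)⁻¹ * dist (expChart p ⟨0, t⟩) (expChart p ⟨0, t'⟩) := by
  have hR' : 0 < 1 - 2 * R := by linarith
  rw [dist_expChart_axis hp, inv_mul_eq_div, le_div_iff₀ hR', Real.dist_eq]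
  set d := t - t'
  have hd : |d| ≤ 2 * R := by
    have := abs_sub t t'
    linarith
  have hn : ‖Complex.I * (d : ℂ)‖ = |d| := by simp
  have h1 := Complex.norm_exp_sub_one_sub_id_le (x := Complex.I * d) (by rw [hn]; linarith)
  rw [hn] at h1
  have h2 := norm_sub_norm_le (Complex.I * (d : ℂ)) (Complex.exp (Complex.I * d) - 1)
  rw [hn, norm_sub_rev (Complex.I * (d : ℂ))] at h2
  nlinarith [abs_nonneg d]

lemma arcMeasure_unitCircle_lt_top : arcMeasure unitCircle < ∞ := by
  have h1 : unitCircle ⊆ (fun t : ℝ => expChart 1 ⟨0, t⟩) '' Set.Icc (-Real.pi) Real.pi := by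
    intro z hz
    rw [unitCircle, mem_sphere_zero_iff_norm] at hz
    refine ⟨z.arg, ⟨(Complex.neg_pi_lt_arg z).le, Complex.arg_le_pi z⟩, ?_⟩
    have h2 : (⟨0, z.arg⟩ : ℂ) = z.arg * Complex.I := by apply Complex.ext <;> simp
    have h3 := Complex.norm_mul_exp_arg_mul_I z
    rw [hz, Complex.ofReal_one] at h3
    simpa only [expChart, h2] using h3
  have hl : LipschitzWith 1 (fun t : ℝ => expChart 1 ⟨0, t⟩) := by
    refine LipschitzWith.of_dist_le_mul fun t t' => ?_
    rw [dist_expChart_axis norm_one, NNReal.coe_one, one_mul]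
    exact Real.norm_exp_I_mul_ofReal_sub_one_le
  have h2 := hl.hausdorffMeasure_image_le (d := 1) zero_le_one (Set.Icc (-Real.pi) Real.pi)
  rw [hausdorffMeasure_real, Real.volume_Icc] at h2
  refine (measure_mono h1).trans_lt (h2.trans_lt ?_)
  simp

lemma integrableOn_arcMeasure {f : ℂ → ℝ} (hf : Continuous f) {s : Set ℂ}
    (hs : s ⊆ unitCircle) : IntegrableOn f s arcMeasure := by
  have h1 : IsCompact unitCircle := isCompact_sphere 0 1
  obtain ⟨C, hC⟩ := h1.exists_bound_of_continuousOn hf.continuousOn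
  refine IntegrableOn.mono_set (t := unitCircle) ?_ hs
  refine Measure.integrableOn_of_bounded (M := C) arcMeasure_unitCircle_lt_top.ne
    hf.aestronglyMeasurable ?_
  filter_upwards [ae_restrict_mem h1.measurableSet] with z hz
  exact hC z hz

lemma norm_mk_zero (t : ℝ) : ‖(⟨0, t⟩ : ℂ)‖ = |t| := by
  rw [Complex.norm_eq_sqrt_sq_add_sq]
  simp [Real.sqrt_sq_eq_abs]

lemma mk_zero_mem_ball {t R : ℝ} : (⟨0, t⟩ : ℂ) ∈ Metric.ball (0 : ℂ) R ↔ |t| < R := by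
  rw [mem_ball_zero_iff, norm_mk_zero]

lemma setLIntegral_axisMeasure {f : ℂ → ℝ≥0∞} (hf : Measurable f) (R : ℝ) :
    ∫⁻ z in Metric.ball 0 R, f z ∂axisMeasure = ∫⁻ t in {t : ℝ | |t| < R}, f ⟨0, t⟩ := by
  rw [axisMeasure, setLIntegral_map measurableSet_ball hf (continuous_mk_right 0).measurable]
  congr 2
  ext t
  exact mk_zero_mem_ball

lemma norm_expChart_le_one {p : ℂ} (hp : ‖p‖ = 1) {ζ : ℂ} (hζ : ζ.re ≤ 0) :
    ‖expChart p ζ‖ ≤ 1 := by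
  rw [norm_expChart hp]
  exact Real.exp_le_one_iff.2 hζ

lemma expChart_fold_mem {p : ℂ} (hp : ‖p‖ = 1) (ζ : ℂ) :
    expChart p (fold ζ) ∈ unitClosedDisk :=
  mem_closedBall_zero_iff.2 (norm_expChart_le_one hp (fold_re_nonpos ζ))

lemma expChart_axis_mem {p : ℂ} (hp : ‖p‖ = 1) (t : ℝ) : expChart p ⟨0, t⟩ ∈ unitCircle := by
  rw [unitCircle, mem_sphere_zero_iff_norm, norm_expChart hp]
  exact Real.exp_zero

lemma lintegral_expChart_fold_le {p : ℂ} (hp : ‖p‖ = 1) {R : ℝ} (hR : R ≤ 1) {B : Set ℂ}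
    (hB : Set.MapsTo (expChart p) (Metric.ball 0 R) B) (f : ℂ → ℝ≥0∞) :
    ∫⁻ ζ in Metric.ball 0 R, ENNReal.ofReal (‖expChart p (fold ζ)‖ ^ 2) *
      f (expChart p (fold ζ)) ≤ 2 * ∫⁻ z in B ∩ unitClosedDisk, f z := by
  refine (lintegral_fold_le
    (f := fun ζ => ENNReal.ofReal (‖expChart p ζ‖ ^ 2) * f (expChart p ζ)) R).trans ?_
  have hp0 : p ≠ 0 := norm_ne_zero_iff.1 (by rw [hp]; exact one_ne_zero)
  rw [← lintegral_image_expChart hp0 (measurableSet_ball_inter_re_nonpos R)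
    (Set.inter_subset_left.trans (Metric.ball_subset_ball hR))]
  gcongr
  rintro _ ⟨ζ, hζ, rfl⟩
  exact ⟨hB hζ.1, mem_closedBall_zero_iff.2 (norm_expChart_le_one hp hζ.2)⟩

lemma setLIntegral_unitClosedDisk (f : ℂ → ℝ≥0∞) :
    ∫⁻ z in unitClosedDisk, f z = ∫⁻ z in unitDisk, f z := by
  exact setLIntegral_congr (ae_eq_of_subset_of_measure_ge Metric.ball_subset_closedBall
    (Measure.addHaar_closedBall_eq_addHaar_ball volume 0 1).le
    measurableSet_ball.nullMeasurableSet measure_closedBall_lt_top.ne).symm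

lemma ofReal_exp_bound {p : ℂ} (hp : ‖p‖ = 1) {ζ : ℂ} (hζ : ‖ζ‖ < 1) (x : ℝ) :
    Real.exp x ≤ Real.exp 2 * (‖expChart p ζ‖ ^ 2 * Real.exp x) := by
  have h1 : 1 ≤ Real.exp 2 * ‖expChart p ζ‖ ^ 2 := by
    rw [norm_expChart hp, ← Real.exp_nat_mul, ← Real.exp_add]
    refine Real.one_le_exp ?_
    have := (abs_le.1 ((Complex.abs_re_le_norm ζ).trans hζ.le)).1
    push_cast
    linarith
  rw [← mul_assoc]
  exact le_mul_of_one_le_left (Real.exp_pos x).le h1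

lemma setIntegral_max_expChart_fold_le {u : ℂ → ℝ} (hu : Continuous u) {p : ℂ} (hp : ‖p‖ = 1)
    {R : ℝ} (hR : R ≤ 1) :
    ∫ ζ in Metric.ball 0 R, max (u (expChart p (fold ζ))) 0 ≤
      2 * Real.exp 2 * ∫ z in unitDisk, Real.exp (u z) := by
  have hc : Continuous fun ζ => u (expChart p (fold ζ)) :=
    hu.comp ((continuous_expChart p).comp continuous_fold)
  have hi : IntegrableOn (fun ζ => Real.exp (u (expChart p (fold ζ)))) (Metric.ball 0 R) :=
    integrableOn_ball_of_continuous (Real.continuous_exp.comp hc) 0 R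
  have hd : IntegrableOn (fun z => Real.exp (u z)) unitDisk :=
    integrableOn_ball_of_continuous (Real.continuous_exp.comp hu) 0 1
  have hd0 : 0 ≤ ∫ z in unitDisk, Real.exp (u z) := integral_nonneg fun z => (Real.exp_pos _).le
  refine (setIntegral_max_zero_le hc hi subset_rfl).trans ?_
  rw [← ENNReal.ofReal_le_ofReal_iff (by positivity),
    ofReal_integral_eq_lintegral_ofReal hi (ae_of_all _ fun z => (Real.exp_pos _).le)]
  calc ∫⁻ ζ in Metric.ball 0 R, ENNReal.ofReal (Real.exp (u (expChart p (fold ζ))))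
      ≤ ∫⁻ ζ in Metric.ball 0 R, ENNReal.ofReal (Real.exp 2) *
          (ENNReal.ofReal (‖expChart p (fold ζ)‖ ^ 2) *
            ENNReal.ofReal (Real.exp (u (expChart p (fold ζ))))) := by
        refine setLIntegral_mono' measurableSet_ball fun ζ hζ => ?_
        rw [← ENNReal.ofReal_mul (by positivity), ← ENNReal.ofReal_mul (by positivity)]
        refine ENNReal.ofReal_le_ofReal (ofReal_exp_bound hp ?_ _)
        rw [norm_fold]
        exact (mem_ball_zero_iff.1 hζ).trans_le hR
    _ = ENNReal.ofReal (Real.exp 2) * ∫⁻ ζ in Metric.ball 0 R,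
          (ENNReal.ofReal (‖expChart p (fold ζ)‖ ^ 2) *
            ENNReal.ofReal (Real.exp (u (expChart p (fold ζ))))) :=
        lintegral_const_mul' _ _ ENNReal.ofReal_ne_top
    _ ≤ ENNReal.ofReal (Real.exp 2) *
          (2 * ∫⁻ z in Set.univ ∩ unitClosedDisk, ENNReal.ofReal (Real.exp (u z))) := by
        gcongr
        exact lintegral_expChart_fold_le hp hR (Set.mapsTo_univ _ _)
          fun z => ENNReal.ofReal (Real.exp (u z))
    _ = _ := by
        rw [Set.univ_inter, setLIntegral_unitClosedDisk,
          ← ofReal_integral_eq_lintegral_ofReal hd (ae_of_all _ fun z => (Real.exp_pos _).le),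
          ENNReal.ofReal_mul (by positivity), ENNReal.ofReal_mul (by positivity),
          ENNReal.ofReal_ofNat, ← mul_assoc, mul_comm (ENNReal.ofReal _) 2]

lemma lintegral_area_le {k : ℂ → ℝ} (hk : Continuous k) (hk0 : ∀ z, 0 ≤ k z) {p : ℂ}
    (hp : ‖p‖ = 1) {R r C ε : ℝ} (hR0 : 0 < R) (hR : R ≤ 1) (hC : 0 ≤ C) (hε : 0 ≤ ε)
    (hB : Set.MapsTo (expChart p) (Metric.ball 0 R) (Metric.ball p r))
    (hsmall : ∫ z in Metric.ball p r ∩ unitClosedDisk, k z ≤ ε) :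
    ∫⁻ ζ in Metric.ball 0 R, ENNReal.ofReal (‖expChart p (fold ζ)‖ ^ 2 *
      (2 * k (expChart p (fold ζ)) + C)) ≤
        ENNReal.ofReal (4 * ε + C * (R ^ 2 * Real.pi)) := by
  have hc : Continuous fun ζ => k (expChart p (fold ζ)) :=
    hk.comp ((continuous_expChart p).comp continuous_fold)
  have hi : IntegrableOn k (Metric.ball p r ∩ unitClosedDisk) :=
    (integrableOn_ball_of_continuous hk p r).mono_set Set.inter_subset_left
  calc _ ≤ ∫⁻ ζ in Metric.ball 0 R, 2 * (ENNReal.ofReal (‖expChart p (fold ζ)‖ ^ 2) *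
        ENNReal.ofReal (k (expChart p (fold ζ)))) + ENNReal.ofReal C := by
        refine lintegral_mono fun ζ => ?_
        have h0 := hk0 (expChart p (fold ζ))
        rw [← ENNReal.ofReal_mul (by positivity), ← ENNReal.ofReal_ofNat 2,
          ← ENNReal.ofReal_mul (by positivity), ← ENNReal.ofReal_add (by positivity) hC]
        refine ENNReal.ofReal_le_ofReal ?_
        have h1 : ‖expChart p (fold ζ)‖ ^ 2 ≤ 1 :=
          pow_le_one₀ (norm_nonneg _) (norm_expChart_le_one hp (fold_re_nonpos ζ))
        have h2 := mul_le_mul_of_nonneg_right h1 hC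
        linarith
    _ = 2 * (∫⁻ ζ in Metric.ball 0 R, (ENNReal.ofReal (‖expChart p (fold ζ)‖ ^ 2) *
        ENNReal.ofReal (k (expChart p (fold ζ))))) +
          ENNReal.ofReal C * volume (Metric.ball (0 : ℂ) R) := by
        rw [lintegral_add_right _ measurable_const, setLIntegral_const,
          lintegral_const_mul' _ _ (by simp)]
    _ ≤ 2 * (2 * ENNReal.ofReal ε) + ENNReal.ofReal C * volume (Metric.ball (0 : ℂ) R) := by
        gcongr
        refine (lintegral_expChart_fold_le hp hR hB fun z => ENNReal.ofReal (k z)).trans ?_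
        gcongr
        rw [← ofReal_integral_eq_lintegral_ofReal hi (ae_of_all _ hk0)]
        exact ENNReal.ofReal_le_ofReal hsmall
    _ = _ := by
        have h2 : (NNReal.pi : ℝ≥0∞) = ENNReal.ofReal Real.pi := by
          rw [ENNReal.ofReal, ← NNReal.coe_real_pi, Real.toNNReal_coe]
        rw [Complex.volume_ball, h2, ← ENNReal.ofReal_pow hR0.le,
          ← ENNReal.ofReal_mul (by positivity), ← ENNReal.ofReal_mul hC,
          ← ENNReal.ofReal_ofNat 2, ← ENNReal.ofReal_mul (by norm_num),
          ← ENNReal.ofReal_mul (by norm_num), ← ENNReal.ofReal_add (by positivity) (by positivity)]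
        congr 1
        ring

lemma lintegral_line_le {k : ℂ → ℝ} (hk : Continuous k) (hk0 : ∀ z, 0 ≤ k z) {p : ℂ}
    (hp : ‖p‖ = 1) {R r C ε : ℝ} (hR0 : 0 < R) (hR : R < 1 / 2) (hC : 0 ≤ C) (hε : 0 ≤ ε)
    (hB : Set.MapsTo (expChart p) (Metric.ball 0 R) (Metric.ball p r))
    (hsmall : ∫ z in Metric.ball p r ∩ unitCircle, k z ∂arcMeasure ≤ ε) :
    ∫⁻ ζ in Metric.ball 0 R, ENNReal.ofReal (4 * k (expChart p ζ) + C) ∂axisMeasure ≤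
        ENNReal.ofReal (4 * (1 - 2 * R)⁻¹ * ε + C * (2 * R)) := by
  have hc : Continuous fun ζ => k (expChart p ζ) := hk.comp (continuous_expChart p)
  have hm : Measurable fun ζ => ENNReal.ofReal (4 * k (expChart p ζ) + C) :=
    ((hc.const_mul 4).add_const C).measurable.ennreal_ofReal
  have hR' : 0 < 1 - 2 * R := by linarith
  have hs : {t : ℝ | |t| < R} = Metric.ball 0 R := by
    ext t
    rw [mem_ball_zero_iff, Real.norm_eq_abs, Set.mem_ofPred_eq]
  rw [setLIntegral_axisMeasure hm]
  calc _ = ∫⁻ t in {t : ℝ | |t| < R}, (4 * ENNReal.ofReal (k (expChart p ⟨0, t⟩)) +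
        ENNReal.ofReal C) := by
        refine lintegral_congr fun t => ?_
        have h0 := hk0 (expChart p ⟨0, t⟩)
        rw [ENNReal.ofReal_add (by positivity) hC, ENNReal.ofReal_mul (by norm_num),
          ENNReal.ofReal_ofNat]
    _ = 4 * (∫⁻ t in {t : ℝ | |t| < R}, ENNReal.ofReal (k (expChart p ⟨0, t⟩))) +
          ENNReal.ofReal C * volume {t : ℝ | |t| < R} := by
        rw [lintegral_add_right _ measurable_const, setLIntegral_const,
          lintegral_const_mul' _ _ (by simp)]
    _ ≤ 4 * (ENNReal.ofReal (1 - 2 * R)⁻¹ * ENNReal.ofReal ε) +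
          ENNReal.ofReal C * ENNReal.ofReal (2 * R) := by
        rw [hs, Real.volume_ball, ← hs]
        gcongr
        refine (lintegral_comp_le_arcMeasure (γ := fun t => expChart p ⟨0, t⟩)
          (B := Metric.ball p r ∩ unitCircle) (K := (1 - 2 * R)⁻¹.toNNReal)
          ((continuous_expChart p).comp (continuous_mk_right 0)).measurable
          (fun t ht => ⟨hB (mk_zero_mem_ball.2 ht), expChart_axis_mem hp t⟩)
          (fun t ht t' ht' => ?_) (f := fun z => ENNReal.ofReal (k z))
          hk.measurable.ennreal_ofReal).trans ?_
        · rw [Real.coe_toNNReal _ (by positivity)]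
          exact dist_le_dist_expChart hp hR ht ht'
        · refine mul_le_mul_right ?_ _
          rw [← ofReal_integral_eq_lintegral_ofReal
            (integrableOn_arcMeasure hk Set.inter_subset_right) (ae_of_all _ hk0)]
          exact ENNReal.ofReal_le_ofReal hsmall
    _ = _ := by
        rw [← ENNReal.ofReal_mul hC, ← ENNReal.ofReal_mul (by positivity),
          ← ENNReal.ofReal_ofNat 4, ← ENNReal.ofReal_mul (by norm_num),
          ← ENNReal.ofReal_add (by positivity) (by positivity), mul_assoc]

lemma exists_boundary_radius {p : ℂ} {r ε C : ℝ} (hr : 0 < r) (hε : ε < Real.pi / 2) :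
    ∃ R : ℝ, 0 < R ∧ R < 1 / 2 ∧
      Set.MapsTo (expChart p) (Metric.ball 0 R) (Metric.ball p r) ∧
      (4 * ε + 2 * C * (R ^ 2 * Real.pi)) + (4 * (1 - 2 * R)⁻¹ * ε + 4 * C * (2 * R)) <
        4 * ε + 2 * Real.pi := by
  have h1 : ∀ᶠ R : ℝ in 𝓝 0, R < 1 / 2 := gt_mem_nhds (by norm_num)
  have h2 : ∀ᶠ R : ℝ in 𝓝 0, (4 * ε + 2 * C * (R ^ 2 * Real.pi)) +
      (4 * (1 - 2 * R)⁻¹ * ε + 4 * C * (2 * R)) < 4 * ε + 2 * Real.pi := by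
    refine ContinuousAt.eventually_lt ?_ continuousAt_const ?_
    · have : ContinuousAt (fun R : ℝ => (1 - 2 * R)⁻¹) 0 :=
        ContinuousAt.inv₀ (by fun_prop) (by norm_num)
      fun_prop
    · norm_num
      linarith
  obtain ⟨δ, hδ, hball⟩ := Metric.mem_nhds_iff.1
    ((continuous_expChart p).continuousAt.preimage_mem_nhds (x := 0)
      (Metric.isOpen_ball.mem_nhds (x := expChart p 0) (s := Metric.ball p r)
        (by simpa [expChart] using hr)))
  have h3 : ∀ᶠ R : ℝ in 𝓝 0, R < δ := gt_mem_nhds hδ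
  have h4 : ∀ᶠ R : ℝ in 𝓝[>] 0, 0 < R := self_mem_nhdsWithin
  obtain ⟨R, ⟨⟨hR1, hR2⟩, hR3⟩, hR⟩ :=
    ((((h1.and h2).and h3).filter_mono nhdsWithin_le_nhds).and h4).exists
  exact ⟨R, hR, hR1, fun ζ hζ => hball (Metric.ball_subset_ball hR3.le hζ), hR2⟩

lemma exists_ball_expChart {p : ℂ} (hp : ‖p‖ = 1) {R : ℝ} (hR : 0 < R) :
    ∃ δ > 0, ∀ z ∈ Metric.ball p δ ∩ unitClosedDisk, ∃ ζ ∈ Metric.ball (0 : ℂ) R,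
      ζ.re ≤ 0 ∧ expChart p ζ = z := by
  have hp0 : p ≠ 0 := norm_ne_zero_iff.1 (by rw [hp]; exact one_ne_zero)
  have h1 : ContinuousAt (fun z => Complex.log (z / p)) p :=
    ContinuousAt.clog (by fun_prop) (by rw [div_self hp0]; exact Complex.one_mem_slitPlane)
  have h2 : ∀ᶠ z in 𝓝 p, Complex.log (z / p) ∈ Metric.ball (0 : ℂ) R :=
    h1.preimage_mem_nhds (Metric.isOpen_ball.mem_nhds (by simpa [div_self hp0] using hR))
  have h3 : ∀ᶠ z in 𝓝 p, z ≠ 0 := eventually_ne_nhds hp0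
  obtain ⟨δ, hδ, hball⟩ := Metric.mem_nhds_iff.1 (h2.and h3)
  refine ⟨δ, hδ, fun z hz => ⟨_, (hball hz.1).1, ?_, ?_⟩⟩
  · rw [Complex.log_re, norm_div, hp, div_one]
    exact Real.log_nonpos (norm_nonneg _) (mem_closedBall_zero_iff.1 hz.2)
  · rw [expChart, Complex.exp_log (div_ne_zero (hball hz.1).2 hp0), mul_div_cancel₀ _ hp0]

lemma exists_boundary_bound {u K Kh h hh : ℕ → ℂ → ℝ} (hu : ∀ n, ContDiff ℝ 2 (u n))
    (hK : ∀ n, Continuous (K n)) (hh' : ∀ n, Continuous (h n)) {C₀ C₁ : ℝ}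
    (hK1 : ∀ n, ∀ z ∈ unitClosedDisk, |K n z| ≤ C₁)
    (hKh1 : ∀ n, ∀ z ∈ unitClosedDisk, |Kh n z| ≤ C₁)
    (hh1 : ∀ n, ∀ z ∈ unitCircle, |h n z| ≤ C₁)
    (hhh1 : ∀ n, ∀ z ∈ unitCircle, |hh n z| ≤ C₁)
    (heq : ∀ n, ∀ z ∈ unitClosedDisk, -lap (u n) z + 2 * Kh n z = 2 * K n z * Real.exp (u n z))
    (hbd : ∀ n, ∀ z ∈ unitCircle,
      normalDeriv (u n) z + 2 * hh n z = 2 * h n z * Real.exp (u n z / 2))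
    (hmass : ∀ n, ∫ z in unitDisk, Real.exp (u n z) ≤ C₀) {p : ℂ} {r ε : ℝ} (hp : ‖p‖ = 1)
    (hr : 0 < r) (hε : ε < Real.pi / 2)
    (hsmall : ∀ n, ∫ z in Metric.ball p r ∩ unitClosedDisk,
      max (K n z) 0 * Real.exp (u n z) ≤ ε)
    (hsmall' : ∀ n, ∫ z in Metric.ball p r ∩ unitCircle,
      max (h n z) 0 * Real.exp (u n z / 2) ∂arcMeasure ≤ ε) :
    ∃ δ > 0, ∃ M, ∀ n, ∀ z ∈ Metric.ball p δ ∩ unitClosedDisk, u n z ≤ M := by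
  have hC₁ : 0 ≤ C₁ := (abs_nonneg _).trans (hK1 0 0 (by simp [unitClosedDisk]))
  have hC₀ : 0 ≤ C₀ := (integral_nonneg fun z => (Real.exp_pos _).le).trans (hmass 0)
  have hε0 : 0 ≤ ε := (integral_nonneg fun z => by positivity).trans (hsmall 0)
  obtain ⟨R, hR, hR2, hmaps, hRm⟩ := exists_boundary_radius (p := p) (C := C₁) hr hε
  have hpi := Real.pi_pos
  set A := max (4 * C₁) (2 * Real.exp 2 * C₀) with hA
  have hA0 : 0 ≤ A := le_max_of_le_left (by positivity)
  obtain ⟨M, hM⟩ := exists_forall_le_of_potentialBound 0 hR (m := 4 * ε + 2 * Real.pi)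
    (by positivity) (by linarith) A
  obtain ⟨δ, hδ, hchart⟩ := exists_ball_expChart hp (R := R / 4) (by positivity)
  refine ⟨δ, hδ, M, fun n z hz => ?_⟩
  obtain ⟨ζ, hζ, hζre, rfl⟩ := hchart z hz
  rw [← fold_of_re_nonpos hζre]
  clear hz hchart
  have hun := (hu n).continuous
  have hKn := hK n
  have hhn := hh' n
  have hφ := continuous_expChart p
  have hφf : Continuous fun ζ => expChart p (fold ζ) := hφ.comp continuous_fold
  have hw : ContDiff ℝ 2 fun ζ => u n (expChart p ζ) := (hu n).comp (contDiff_expChart p)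
  set k : ℂ → ℝ := fun z => max (K n z) 0 * Real.exp (u n z) with hk
  set l : ℂ → ℝ := fun z => max (h n z) 0 * Real.exp (u n z / 2) with hl
  have hkc : Continuous k := by fun_prop
  have hlc : Continuous l := by fun_prop
  have hk0 : ∀ z, 0 ≤ k z := fun z => by positivity
  have hl0 : ∀ z, 0 ≤ l z := fun z => by positivity
  have hD : Continuous (dirDeriv 1 fun ζ => u n (expChart p ζ)) :=
    (contDiff_dirDeriv (n := 1) hw 1).continuous
  have hlapc := continuous_lap hw
  refine hM (fun ζ => u n (expChart p (fold ζ))) _ (PotentialBound.of_green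
    (g := fun ζ => -lap (fun ζ => u n (expChart p ζ)) (fold ζ))
    (G := fun ζ => ‖expChart p (fold ζ)‖ ^ 2 * (2 * k (expChart p (fold ζ)) + 2 * C₁))
    (k := fun ζ => 2 * dirDeriv 1 (fun ζ => u n (expChart p ζ)) ζ)
    (H := fun ζ => 4 * l (expChart p ζ) + 4 * C₁)
    (hun.comp hφf) (hlapc.comp continuous_fold).neg
    ((hφf.norm.pow 2).mul (((hkc.comp hφf).const_mul 2).add continuous_const))
    (hD.const_mul 2) (((hlc.comp hφ).const_mul 4).add continuous_const)
    (fun y => ?_) (fun y => ?_) (fun y hy => ?_) (fun y hy => ?_) (fun t ht => ?_)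
    (fun t ht => ?_) ?_ ?_ ?_) ζ hζ
  · have := hk0 (expChart p (fold y))
    positivity
  · have := hl0 (expChart p y)
    positivity
  · have hy' := expChart_fold_mem hp y
    have h1 := heq n _ hy'
    have h2 := abs_le.1 (hKh1 n _ hy')
    have h3 : K n (expChart p (fold y)) * Real.exp (u n (expChart p (fold y))) ≤
        k (expChart p (fold y)) := by
      exact mul_le_mul_of_nonneg_right (le_max_left _ _) (Real.exp_pos _).le
    simp only [lap_comp_expChart (hu n), ← mul_neg]
    gcongr
    linarith
  · have hy' := expChart_fold_mem hp y
    have h2 := (abs_le.1 (hK1 n _ hy')).2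
    have h3 : k (expChart p (fold y)) ≤ C₁ * Real.exp (u n (expChart p (fold y))) := by
      exact mul_le_mul_of_nonneg_right (max_le h2 hC₁) (Real.exp_pos _).le
    have h4 : ‖expChart p (fold y)‖ ^ 2 ≤ 1 :=
      pow_le_one₀ (norm_nonneg _) (mem_closedBall_zero_iff.1 hy')
    have h5 := hk0 (expChart p (fold y))
    calc _ ≤ 1 * (2 * k (expChart p (fold y)) + 2 * C₁) := by gcongr
      _ ≤ 2 * C₁ * (1 + Real.exp (u n (expChart p (fold y)))) := by linarith
      _ ≤ _ := by
        gcongr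
        exact le_max_of_le_left (by linarith)
  · have ht' := expChart_axis_mem hp t
    have h1 := hbd n _ ht'
    have h2 := abs_le.1 (hhh1 n _ ht')
    have h3 : h n (expChart p ⟨0, t⟩) * Real.exp (u n (expChart p ⟨0, t⟩) / 2) ≤
        l (expChart p ⟨0, t⟩) := by
      exact mul_le_mul_of_nonneg_right (le_max_left _ _) (Real.exp_pos _).le
    simp only [dirDeriv_comp_expChart (hu n), mul_one]
    rw [normalDeriv] at h1
    linarith
  · have ht' := expChart_axis_mem hp t
    have h2 := (abs_le.1 (hh1 n _ ht')).2
    have h3 : l (expChart p ⟨0, t⟩) ≤ C₁ * Real.exp (u n (expChart p ⟨0, t⟩) / 2) := by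
      exact mul_le_mul_of_nonneg_right (max_le h2 hC₁) (Real.exp_pos _).le
    rw [fold_of_re_nonpos (z := ⟨0, t⟩) le_rfl]
    calc _ ≤ 4 * C₁ * (1 + Real.exp (u n (expChart p ⟨0, t⟩) / 2)) := by linarith
      _ ≤ _ := by
        gcongr
        exact le_max_left _ _
  · refine (add_le_add
      (lintegral_area_le hkc hk0 hp hR (by linarith) (by positivity) hε0 hmaps (hsmall n))
      (lintegral_line_le hlc hl0 hp hR hR2 (by positivity) hε0 hmaps (hsmall' n))).trans ?_
    have hR' : 0 < 1 - 2 * R := by linarith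
    rw [← ENNReal.ofReal_add (by positivity) (by positivity)]
    exact ENNReal.ofReal_le_ofReal hRm.le
  · refine (setIntegral_max_expChart_fold_le hun hp (by linarith)).trans ?_
    refine le_trans ?_ (le_max_right _ _)
    gcongr
    exact hmass n
  · intro ψ ψs ψss ψt ψtt T hψ hT h0
    have haxis := integral_axisMeasure
      (f := fun y => 2 * dirDeriv 1 (fun ζ => u n (expChart p ζ)) y * ψ y)
      ((hD.const_mul 2).mul hψ.cont)
    rw [integral_fold_mul_laplacian (HasPartials.of_contDiff hw) hψ hT hD h0, haxis]
    simp only [neg_mul, integral_neg, neg_neg]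
    rfl

lemma TendstoC2On.exists_abs_le {F : ℕ → ℂ → ℝ} {G : ℂ → ℝ} {s : Set ℂ}
    (hFG : TendstoC2On F G s) (hs : IsCompact s) (hF : ∀ n, Continuous (F n))
    (hG : Continuous G) : ∃ C, ∀ n, ∀ z ∈ s, |F n z| ≤ C := by
  obtain ⟨B, hB⟩ := hs.exists_bound_of_continuousOn hG.continuousOn
  have h0 := Metric.tendstoUniformlyOn_iff.1 (hFG 0 (Nat.zero_le _)) 1 one_pos
  obtain ⟨N, hN⟩ := eventually_atTop.1 h0
  choose b hb using fun n => hs.exists_bound_of_continuousOn (hF n).continuousOn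
  refine ⟨max (B + 1) (∑ i ∈ Finset.range N, |b i|), fun n z hz => ?_⟩
  rcases le_or_gt N n with hn | hn
  · refine le_max_of_le_left ?_
    have h1 := hN n hn z hz
    rw [dist_eq_norm, iteratedFDeriv_zero_eq_comp, iteratedFDeriv_zero_eq_comp,
      Function.comp_apply, Function.comp_apply, ← map_sub, LinearIsometryEquiv.norm_map,
      Real.norm_eq_abs] at h1
    have h2 := hB z hz
    rw [Real.norm_eq_abs] at h2
    rw [abs_sub_comm] at h1
    linarith [abs_sub_abs_le_abs_sub (F n z) (G z)]
  · refine le_max_of_le_right ((hb n z hz).trans ((le_abs_self _).trans ?_))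
    exact Finset.single_le_sum (f := fun i => |b i|) (fun i _ => abs_nonneg _)
      (Finset.mem_range.2 hn)

lemma IsCompact.exists_forall_le_of_locally {u : ℕ → ℂ → ℝ} {S T : Set ℂ} (hS : IsCompact S)
    (h : ∀ q ∈ S, ∃ δ > 0, ∃ M, ∀ n, ∀ z ∈ Metric.ball q δ ∩ T, u n z ≤ M) :
    ∃ M, ∀ n, ∀ z ∈ S ∩ T, u n z ≤ M := by
  refine hS.induction_on (p := fun s => ∃ M, ∀ n, ∀ z ∈ s ∩ T, u n z ≤ M) ⟨0, by simp⟩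
    (fun s t hst ⟨M, hM⟩ => ⟨M, fun n z hz => hM n z ⟨hst hz.1, hz.2⟩⟩) ?_ fun q hq => ?_
  · rintro s t ⟨M, hM⟩ ⟨M', hM'⟩
    refine ⟨max M M', fun n z hz => ?_⟩
    rcases hz.1 with hz' | hz'
    · exact le_max_of_le_left (hM n z ⟨hz', hz.2⟩)
    · exact le_max_of_le_right (hM' n z ⟨hz', hz.2⟩)
  · obtain ⟨δ, hδ, hM⟩ := h q hq
    exact ⟨_, mem_nhdsWithin_of_mem_nhds (Metric.ball_mem_nhds q hδ), hM⟩

/-- Brezis–Merle type minimal mass lemma: smallness of the local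
(interior, resp. interior-plus-boundary) masses forces a uniform `L^∞` bound on
`uₙ⁺` in the half-sized ball. -/
theorem minimal_mass_lemma
    (u Kn Khatn hn hhatn : ℕ → ℂ → ℝ) (K Khat h hhat : ℂ → ℝ)
    (hureg : ∀ n, ContDiff ℝ 2 (u n))
    (hKnreg : ∀ n, ContDiff ℝ 2 (Kn n)) (hKreg : ContDiff ℝ 2 K)
    (hKhatnreg : ∀ n, ContDiff ℝ 2 (Khatn n)) (hKhatreg : ContDiff ℝ 2 Khat)
    (hhnreg : ∀ n, ContDiff ℝ 2 (hn n)) (hhreg : ContDiff ℝ 2 h)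
    (hhhatnreg : ∀ n, ContDiff ℝ 2 (hhatn n)) (hhhatreg : ContDiff ℝ 2 hhat)
    (hKconv : TendstoC2On Kn K unitClosedDisk)
    (hKhatconv : TendstoC2On Khatn Khat unitClosedDisk)
    (hhconv : TendstoC2On hn h unitCircle)
    (hhhatconv : TendstoC2On hhatn hhat unitCircle)
    (hsol : ∀ n, SolvesLiouvilleGen (Kn n) (Khatn n) (hn n) (hhatn n) (u n))
    (C₀ : ℝ) (hmass : MassBound u C₀) :
    (∀ (p : ℂ) (r ε : ℝ), p ∈ unitDisk → 0 < r → Metric.ball p r ⊆ unitDisk →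
      ε < 2 * Real.pi →
      (∀ n, (∫ z in Metric.ball p r, max (Kn n z) 0 * Real.exp (u n z)) ≤ ε) →
      ∃ M, ∀ n, ∀ z ∈ Metric.ball p (r / 2), max (u n z) 0 ≤ M) ∧
    (∀ (p : ℂ) (r ε : ℝ), p ∈ unitCircle → 0 < r → ε < Real.pi / 2 →
      (∀ n, (∫ z in Metric.ball p r ∩ unitClosedDisk,
        max (Kn n z) 0 * Real.exp (u n z)) ≤ ε) →
      (∀ n, (∫ z in Metric.ball p r ∩ unitCircle,
        max (hn n z) 0 * Real.exp (u n z / 2) ∂arcMeasure) ≤ ε) →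
      ∃ M, ∀ n, ∀ z ∈ Metric.ball p (r / 2) ∩ unitClosedDisk, max (u n z) 0 ≤ M) := by
  have hu := fun n => (hureg n).continuous
  have hK := fun n => (hKnreg n).continuous
  have hh := fun n => (hhnreg n).continuous
  obtain ⟨c₁, hc₁⟩ := hKconv.exists_abs_le (isCompact_closedBall 0 1) hK hKreg.continuous
  obtain ⟨c₂, hc₂⟩ := hKhatconv.exists_abs_le (isCompact_closedBall 0 1)
    (fun n => (hKhatnreg n).continuous) hKhatreg.continuous
  obtain ⟨c₃, hc₃⟩ := hhconv.exists_abs_le (isCompact_sphere 0 1) hh hhreg.continuous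
  obtain ⟨c₄, hc₄⟩ := hhhatconv.exists_abs_le (isCompact_sphere 0 1)
    (fun n => (hhhatnreg n).continuous) hhhatreg.continuous
  obtain ⟨C₁, hC₁⟩ : ∃ C₁, C₁ = max (max c₁ c₂) (max c₃ c₄) := ⟨_, rfl⟩
  replace hc₁ : ∀ n, ∀ z ∈ unitClosedDisk, |Kn n z| ≤ C₁ := fun n z hz =>
    (hc₁ n z hz).trans (by simp [hC₁])
  replace hc₂ : ∀ n, ∀ z ∈ unitClosedDisk, |Khatn n z| ≤ C₁ := fun n z hz =>
    (hc₂ n z hz).trans (by simp [hC₁])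
  replace hc₃ : ∀ n, ∀ z ∈ unitCircle, |hn n z| ≤ C₁ := fun n z hz =>
    (hc₃ n z hz).trans (by simp [hC₁])
  replace hc₄ : ∀ n, ∀ z ∈ unitCircle, |hhatn n z| ≤ C₁ := fun n z hz =>
    (hc₄ n z hz).trans (by simp [hC₁])
  have harea : ∀ n, ∫ z in unitDisk, Real.exp (u n z) ≤ C₀ := fun n =>
    (le_add_of_nonneg_right (integral_nonneg fun z => (Real.exp_pos _).le)).trans (hmass n)
  have heq : ∀ n, ∀ z ∈ unitClosedDisk,
      -lap (u n) z + 2 * Khatn n z = 2 * Kn n z * Real.exp (u n z) := fun n => by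
    have hl := continuous_lap (hureg n)
    have hk := (hKhatnreg n).continuous
    have hk' := hK n
    have hu' := hu n
    have : Set.EqOn (fun z => -lap (u n) z + 2 * Khatn n z)
        (fun z => 2 * Kn n z * Real.exp (u n z)) (closure unitDisk) :=
      Set.EqOn.closure (hsol n).1 (by fun_prop) (by fun_prop)
    rwa [unitDisk, closure_ball _ one_ne_zero] at this
  have hKi : ∀ n q R, IntegrableOn (fun z => max (Kn n z) 0 * Real.exp (u n z))
      (Metric.ball q R) volume := fun n q R =>
    integrableOn_ball_of_continuous (by have := hu n; have := hK n; fun_prop) q R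
  have hball : ∀ {p q : ℂ} {r : ℝ}, q ∈ Metric.closedBall p (r / 2) →
      Metric.ball q (r / 2) ⊆ Metric.ball p r := fun {p q r} hq =>
    Metric.ball_subset_ball' (by linarith [Metric.mem_closedBall.1 hq])
  have hpos : ∀ {S : Set ℂ}, (∃ M, ∀ n, ∀ z ∈ S, u n z ≤ M) →
      ∃ M, ∀ n, ∀ z ∈ S, max (u n z) 0 ≤ M := fun ⟨M, hM⟩ =>
    ⟨max M 0, fun n z hz => max_le_max (hM n z hz) le_rfl⟩
  refine ⟨fun p r ε _ hr hpr hε hsmall => hpos ?_, fun p r ε _ hr hε hsmall hsmall' => hpos ?_⟩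
  · obtain ⟨M, hM⟩ := (isCompact_closedBall p (r / 2)).exists_forall_le_of_locally (u := u)
      (T := Set.univ) fun q hq => by
        simpa only [Set.inter_univ] using exists_interior_bound hureg hK hc₁ hc₂
          (fun n => (hsol n).1) harea (half_pos hr) ((hball hq).trans hpr) hε fun n =>
            (setIntegral_mono_set (hKi n p r) (ae_of_all _ fun z => by positivity)
              (hball hq).eventuallyLE).trans (hsmall n)
    exact ⟨M, fun n z hz => hM n z ⟨Metric.ball_subset_closedBall hz, trivial⟩⟩
  · obtain ⟨M, hM⟩ := ((isCompact_closedBall p (r / 2)).inter_right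
      (Metric.isClosed_closedBall (x := (0 : ℂ)) (ε := 1))).exists_forall_le_of_locally (u := u)
      (T := unitClosedDisk) fun q hq => by
        have hKi' : ∀ n, IntegrableOn (fun z => max (Kn n z) 0 * Real.exp (u n z))
            (Metric.ball p r ∩ unitClosedDisk) volume := fun n =>
          (hKi n p r).mono_set Set.inter_subset_left
        rcases (mem_closedBall_zero_iff.1 hq.2).lt_or_eq with hq1 | hq1
        · obtain ⟨R, hR, hRs⟩ := Metric.mem_nhds_iff.1 ((Metric.isOpen_ball.inter
            Metric.isOpen_ball).mem_nhds (x := q) (s := Metric.ball p r ∩ unitDisk)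
              ⟨hball hq.1 (Metric.mem_ball_self (half_pos hr)), mem_ball_zero_iff.2 hq1⟩)
          obtain ⟨δ, hδ, M, hM⟩ := exists_interior_bound hureg hK hc₁ hc₂
            (fun n => (hsol n).1) harea hR (hRs.trans Set.inter_subset_right)
            (hε.trans (by linarith [Real.pi_pos])) fun n =>
              (setIntegral_mono_set (hKi' n) (ae_of_all _ fun z => by positivity)
                (hRs.trans (Set.inter_subset_inter_right _
                  Metric.ball_subset_closedBall)).eventuallyLE).trans (hsmall n)
          exact ⟨δ, hδ, M, fun n z hz => hM n z hz.1⟩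
        · exact exists_boundary_bound hureg hK hh hc₁ hc₂ hc₃ hc₄ heq (fun n => (hsol n).2)
            harea hq1 (half_pos hr) hε
            (fun n => (setIntegral_mono_set (hKi' n) (ae_of_all _ fun z => by positivity)
              (Set.inter_subset_inter_left _ (hball hq.1)).eventuallyLE).trans (hsmall n))
            fun n => (setIntegral_mono_set (integrableOn_arcMeasure
              (by have := hu n; have := hh n; fun_prop) Set.inter_subset_right)
                (ae_of_all _ fun z => by positivity)
              (Set.inter_subset_inter_left _ (hball hq.1)).eventuallyLE).trans (hsmall' n)
    exact ⟨M, fun n z hz => hM n z ⟨⟨Metric.ball_subset_closedBall hz.1, hz.2⟩, hz.2⟩⟩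
end
end

section
/- Let u : closure 𝔻 → ℝ be continuous. Then there exists a ∈ 𝔻 such that ∫_𝔻 z e^{v_a(z)} dz = 0, where v_a(z) := u(f_a(z)) + 2 log |f_a'(z)|. Equivalently, there exists a ∈ 𝔻 with ∫_𝔻 f_{−a}(z') e^{u(z')} dz' = 0, where the integral of the complex-valued integrand is taken componentwise. -/
open MeasureTheory Filter

noncomputable section

/-- The Möbius transformation `f_a(z) = (a + z)/(1 + āz)` of the disk. -/
def mobius (a z : ℂ) : ℂ := (a + z) / (1 + star a * z)

lemma mem_unitDisk_iff {z : ℂ} : z ∈ unitDisk ↔ ‖z‖ < 1 := by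
  simp [unitDisk]

lemma one_sub_norm_le_norm_one_sub (a : ℂ) {w : ℂ} (hw : ‖w‖ < 1) :
    1 - ‖a‖ ≤ ‖1 - star a * w‖ := by
  have h1 := norm_sub_norm_le (1 : ℂ) (star a * w)
  rw [norm_mul, norm_star, norm_one] at h1
  nlinarith [norm_nonneg a]

lemma norm_one_sub_pos {a w : ℂ} (ha : ‖a‖ < 1) (hw : ‖w‖ < 1) : 0 < ‖1 - star a * w‖ :=
  (sub_pos.2 ha).trans_le (one_sub_norm_le_norm_one_sub a hw)

lemma norm_one_sub_le_two {a w : ℂ} (ha : ‖a‖ < 1) (hw : ‖w‖ < 1) : ‖1 - star a * w‖ ≤ 2 := by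
  have h1 := norm_sub_le (1 : ℂ) (star a * w)
  rw [norm_mul, norm_star, norm_one] at h1
  nlinarith [norm_nonneg a, norm_nonneg w]

lemma one_sub_norm_sq_pos {a : ℂ} (ha : ‖a‖ < 1) : 0 < 1 - ‖a‖ ^ 2 := by
  nlinarith [norm_nonneg a]

lemma abs_log_norm_one_sub_sq_le {a w : ℂ} {r : ℝ} (hr : r < 1) (ha : ‖a‖ ≤ r) (hw : ‖w‖ < 1) :
    |Real.log (‖1 - star a * w‖ ^ 2)| ≤ 2 * (|Real.log (1 - r)| + Real.log 2) := by
  have h1 := one_sub_norm_le_norm_one_sub a hw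
  have h2 := norm_one_sub_le_two (ha.trans_lt hr) hw
  have h3 : Real.log (1 - r) ≤ Real.log ‖1 - star a * w‖ :=
    Real.log_le_log (by linarith) (by linarith)
  have h4 : Real.log ‖1 - star a * w‖ ≤ Real.log 2 :=
    Real.log_le_log (by linarith) h2
  have h5 : 0 ≤ Real.log 2 := Real.log_nonneg (by norm_num)
  rw [Real.log_pow, abs_le]
  have h6 := neg_abs_le (Real.log (1 - r))
  have h7 := abs_nonneg (Real.log (1 - r))
  push_cast
  constructor <;> linarith

/-- The potential whose gradient at `a` is proportional to the conformal barycenter of `μ` seen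
from `a`: minus the integral of `log (1 - ‖mobius (-a) w‖ ^ 2)`, up to a constant. -/
def conformalPotential (μ : Measure ℂ) (a : ℂ) : ℝ :=
  (∫ w, Real.log (‖1 - star a * w‖ ^ 2) ∂μ) - μ.real Set.univ * Real.log (1 - ‖a‖ ^ 2)

section

variable {μ : Measure ℂ}

lemma aestronglyMeasurable_log_norm_one_sub_sq (a : ℂ) :
    AEStronglyMeasurable (fun w : ℂ => Real.log (‖1 - star a * w‖ ^ 2)) μ := by
  apply Measurable.aestronglyMeasurable
  fun_prop

lemma integrable_log_norm_one_sub_sq [IsFiniteMeasure μ] (hμ : ∀ᵐ w ∂μ, ‖w‖ < 1) {a : ℂ}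
    (ha : ‖a‖ < 1) : Integrable (fun w : ℂ => Real.log (‖1 - star a * w‖ ^ 2)) μ :=
  Integrable.of_bound (aestronglyMeasurable_log_norm_one_sub_sq a) _
    (hμ.mono fun _ hw => abs_log_norm_one_sub_sq_le ha le_rfl hw)

lemma continuousOn_conformalPotential [IsFiniteMeasure μ] (hμ : ∀ᵐ w ∂μ, ‖w‖ < 1) {r : ℝ}
    (hr : r < 1) : ContinuousOn (conformalPotential μ) (Metric.closedBall 0 r) := by
  have hball : ∀ a ∈ Metric.closedBall (0 : ℂ) r, ‖a‖ ≤ r := fun a ha => by simpa using ha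
  apply ContinuousOn.sub
  · apply continuousOn_of_dominated
      (bound := fun _ => 2 * (|Real.log (1 - r)| + Real.log 2))
    · exact fun a _ => aestronglyMeasurable_log_norm_one_sub_sq a
    · exact fun a ha => hμ.mono fun w hw => abs_log_norm_one_sub_sq_le hr (hball a ha) hw
    · exact integrable_const _
    · refine hμ.mono fun w hw => ContinuousOn.log (by fun_prop) fun a ha => ?_
      exact (pow_pos (norm_one_sub_pos ((hball a ha).trans_lt hr) hw) 2).ne'
  · refine ContinuousOn.mul continuousOn_const (ContinuousOn.log (by fun_prop) fun a ha => ?_)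
    exact (one_sub_norm_sq_pos ((hball a ha).trans_lt hr)).ne'

lemma exists_measureReal_annulus_le [IsFiniteMeasure μ] (hμ : ∀ᵐ w ∂μ, ‖w‖ < 1) {ε : ℝ}
    (hε : 0 < ε) : ∃ δ : ℝ, 0 < δ ∧ δ ≤ 1 ∧ μ.real {w : ℂ | 1 - δ ≤ ‖w‖} ≤ ε := by
  let S : ℕ → Set ℂ := fun n => {w | 1 - 1 / ((n : ℝ) + 1) ≤ ‖w‖}
  have hS : ∀ n, MeasurableSet (S n) := fun n => measurableSet_le (by fun_prop) (by fun_prop)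
  have hanti : Antitone S := fun m n hmn w hw =>
    (sub_le_sub_left (Nat.one_div_le_one_div (α := ℝ) hmn) 1).trans
      (show 1 - 1 / ((n : ℝ) + 1) ≤ ‖w‖ from hw)
  have hinter : μ (⋂ n, S n) = 0 := by
    refine measure_mono_null (fun w hw => ?_) (ae_iff.1 hμ)
    simp only [S, Set.mem_iInter, Set.mem_ofPred_eq, not_lt] at hw ⊢
    refine le_of_forall_pos_le_add fun η hη => ?_
    obtain ⟨n, hn⟩ := exists_nat_one_div_lt hη
    linarith [hw n]
  have ht := tendsto_measure_iInter_atTop (μ := μ) (fun n => (hS n).nullMeasurableSet) hanti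
    ⟨0, measure_ne_top _ _⟩
  rw [hinter] at ht
  obtain ⟨n, hn⟩ := (ht.eventually (gt_mem_nhds (ENNReal.ofReal_pos.2 hε))).exists
  refine ⟨1 / ((n : ℝ) + 1), by positivity, ?_, ?_⟩
  · rw [div_le_one (by positivity)]
    linarith [n.cast_nonneg (α := ℝ)]
  · exact ENNReal.toReal_le_of_le_ofReal hε.le hn.le

lemma two_mul_log_add_indicator_le_log_norm_one_sub_sq {a w : ℂ} {δ : ℝ}
    (hδ : 0 < δ) (hδ1 : δ ≤ 1) (ha : ‖a‖ < 1) (hw : ‖w‖ < 1) :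
    2 * Real.log δ + {w : ℂ | 1 - δ ≤ ‖w‖}.indicator (fun _ => 2 * Real.log (1 - ‖a‖)) w ≤
      Real.log (‖1 - star a * w‖ ^ 2) := by
  rw [Real.log_pow]
  push_cast
  by_cases h : 1 - δ ≤ ‖w‖
  · rw [Set.indicator_of_mem (show w ∈ {w : ℂ | 1 - δ ≤ ‖w‖} from h)]
    have h1 := Real.log_le_log (sub_pos.2 ha) (one_sub_norm_le_norm_one_sub a hw)
    have h2 := Real.log_nonpos hδ.le hδ1
    linarith
  · rw [Set.indicator_of_notMem (show w ∉ {w : ℂ | 1 - δ ≤ ‖w‖} from h)]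
    have h1 := norm_sub_norm_le (1 : ℂ) (star a * w)
    rw [norm_mul, norm_star, norm_one] at h1
    have h2 := Real.log_le_log hδ (show δ ≤ ‖1 - star a * w‖ by
      nlinarith [norm_nonneg a, norm_nonneg w])
    linarith

lemma exists_norm_le_of_conformalPotential_nonpos [IsFiniteMeasure μ] [NeZero μ]
    (hμ : ∀ᵐ w ∂μ, ‖w‖ < 1) :
    ∃ r < 1, 0 ≤ r ∧ ∀ a : ℂ, ‖a‖ < 1 → conformalPotential μ a ≤ 0 → ‖a‖ ≤ r := by
  have hM : 0 < μ.real Set.univ := measureReal_univ_pos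
  set M := μ.real Set.univ with hMdef
  obtain ⟨δ, hδ, hδ1, hm⟩ := exists_measureReal_annulus_le hμ (ε := M / 4) (by positivity)
  have hlogδ := Real.log_nonpos hδ.le hδ1
  have hlog2 : 0 ≤ Real.log 2 := Real.log_nonneg (by norm_num)
  refine ⟨1 - Real.exp (4 * Real.log δ - 2 * Real.log 2), sub_lt_self _ (Real.exp_pos _), ?_,
    fun a ha hle => ?_⟩
  · linarith [Real.exp_le_one_iff.2 (show 4 * Real.log δ - 2 * Real.log 2 ≤ 0 by linarith)]
  have hS : MeasurableSet {w : ℂ | 1 - δ ≤ ‖w‖} := measurableSet_le (by fun_prop) (by fun_prop)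
  have hint := integral_mono_ae
    ((integrable_const (2 * Real.log δ)).add ((integrable_const (μ := μ) _).indicator hS))
    (integrable_log_norm_one_sub_sq hμ ha)
    (hμ.mono fun w hw => two_mul_log_add_indicator_le_log_norm_one_sub_sq hδ hδ1 ha hw)
  simp only [Pi.add_apply] at hint
  rw [integral_add (integrable_const _) ((integrable_const _).indicator hS), integral_const,
    integral_indicator_const _ hS, smul_eq_mul, smul_eq_mul, ← hMdef] at hint
  have ha1 : Real.log (1 - ‖a‖) ≤ 0 :=
    Real.log_nonpos (by linarith) (by linarith [norm_nonneg a])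
  have hsplit : Real.log (1 - ‖a‖ ^ 2) ≤ Real.log 2 + Real.log (1 - ‖a‖) := by
    rw [← Real.log_mul (by norm_num) (by linarith)]
    exact Real.log_le_log (one_sub_norm_sq_pos ha) (by nlinarith [norm_nonneg a])
  have h1 := mul_le_mul_of_nonneg_left hsplit hM.le
  have h2 := mul_le_mul_of_nonpos_right hm ha1
  have h3 : M * (4 * Real.log δ - 2 * Real.log 2 - Real.log (1 - ‖a‖)) ≤ 0 := by
    unfold conformalPotential at hle
    rw [← hMdef] at hle
    linarith
  have h4 : 4 * Real.log δ - 2 * Real.log 2 ≤ Real.log (1 - ‖a‖) := by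
    by_contra! h
    nlinarith
  have h5 := (Real.le_log_iff_exp_le (by linarith)).1 h4
  linarith

lemma exists_isMinOn_conformalPotential [IsFiniteMeasure μ] [NeZero μ] (hμ : ∀ᵐ w ∂μ, ‖w‖ < 1) :
    ∃ a : ℂ, ‖a‖ < 1 ∧ ∀ b : ℂ, ‖b‖ < 1 → conformalPotential μ a ≤ conformalPotential μ b := by
  obtain ⟨r, hr, hr0, hbound⟩ := exists_norm_le_of_conformalPotential_nonpos hμ
  obtain ⟨a, ha, hmin⟩ := (isCompact_closedBall (0 : ℂ) r).exists_isMinOn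
    ⟨0, by simpa using hr0⟩ (continuousOn_conformalPotential hμ hr)
  have h0 : conformalPotential μ 0 = 0 := by simp [conformalPotential]
  have ha0 : conformalPotential μ a ≤ 0 := h0 ▸ hmin (show (0 : ℂ) ∈ _ by simpa using hr0)
  refine ⟨a, (show ‖a‖ ≤ r by simpa using ha).trans_lt hr, fun b hb => ?_⟩
  rcases le_or_gt (conformalPotential μ b) 0 with h | h
  · exact hmin (show b ∈ _ by simpa using hbound b hb h)
  · exact ha0.trans h.le

lemma norm_one_sub_smul_sq (t : ℝ) (q : ℂ) :
    ‖1 - t * q‖ ^ 2 = 1 - 2 * t * q.re + t ^ 2 * ‖q‖ ^ 2 := by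
  rw [← Complex.normSq_eq_norm_sq, ← Complex.normSq_eq_norm_sq, Complex.normSq_apply,
    Complex.normSq_apply]
  simp
  ring

lemma log_norm_one_sub_sq_le {a v w : ℂ} {t : ℝ} (ha : ‖a‖ < 1) (hb : ‖a + t * v‖ < 1)
    (hw : ‖w‖ < 1) :
    Real.log (‖1 - star (a + t * v) * w‖ ^ 2) ≤ Real.log (‖1 - star a * w‖ ^ 2) +
      (-2 * t * (star v * (w / (1 - star a * w))).re +
        t ^ 2 * ‖star v * (w / (1 - star a * w))‖ ^ 2) := by
  have hp := norm_one_sub_pos ha hw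
  have hne : 1 - star a * w ≠ 0 := norm_pos_iff.1 hp
  have hfac : 1 - star (a + t * v) * w =
      (1 - star a * w) * (1 - t * (star v * (w / (1 - star a * w)))) := by
    have hstar : star (a + t * v) = star a + t * star v := by simp
    have hmul : (1 - star a * w) * (w / (1 - star a * w)) = w := mul_div_cancel₀ _ hne
    rw [hstar]
    linear_combination (t * star v) * hmul
  have hq : 0 < ‖1 - t * (star v * (w / (1 - star a * w)))‖ := by
    have := norm_one_sub_pos hb hw
    rw [hfac, norm_mul] at this
    exact pos_of_mul_pos_right this hp.le
  rw [hfac, norm_mul, mul_pow, Real.log_mul (by positivity) (by positivity)]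
  have := Real.log_le_sub_one_of_pos (pow_pos hq 2)
  rw [norm_one_sub_smul_sq] at this ⊢
  linarith

lemma integrable_div_one_sub [IsFiniteMeasure μ] (hμ : ∀ᵐ w ∂μ, ‖w‖ < 1) {a : ℂ}
    (ha : ‖a‖ < 1) : Integrable (fun w : ℂ => w / (1 - star a * w)) μ := by
  refine Integrable.of_bound (Measurable.aestronglyMeasurable (by fun_prop)) (1 / (1 - ‖a‖))
    (hμ.mono fun w hw => ?_)
  rw [norm_div]
  exact div_le_div₀ zero_le_one hw.le (sub_pos.2 ha) (one_sub_norm_le_norm_one_sub a hw)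

lemma integrable_norm_mul_div_one_sub_sq [IsFiniteMeasure μ] (hμ : ∀ᵐ w ∂μ, ‖w‖ < 1) {a : ℂ}
    (ha : ‖a‖ < 1) (v : ℂ) :
    Integrable (fun w : ℂ => ‖star v * (w / (1 - star a * w))‖ ^ 2) μ := by
  refine Integrable.of_bound (Measurable.aestronglyMeasurable (by fun_prop))
    ((‖v‖ * (1 / (1 - ‖a‖))) ^ 2) (hμ.mono fun w hw => ?_)
  rw [Real.norm_of_nonneg (by positivity), norm_mul, norm_star, norm_div]
  gcongr
  exact one_sub_norm_le_norm_one_sub a hw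

lemma re_star_mul_eq_zero_of_isMin [IsFiniteMeasure μ] (hμ : ∀ᵐ w ∂μ, ‖w‖ < 1) {a : ℂ}
    (ha : ‖a‖ < 1)
    (hmin : ∀ b : ℂ, ‖b‖ < 1 → conformalPotential μ a ≤ conformalPotential μ b) (v : ℂ) :
    (star v * ((1 - ‖a‖ ^ 2 : ℝ) * (∫ w, w / (1 - star a * w) ∂μ) - μ.real Set.univ * a)).re
      = 0 := by
  set X := ∫ w, w / (1 - star a * w) ∂μ with hX
  set Y := ∫ w, ‖star v * (w / (1 - star a * w))‖ ^ 2 ∂μ with hY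
  set M := μ.real Set.univ with hM
  have hA := one_sub_norm_sq_pos ha
  have hexp : ∀ t : ℝ, ‖a + t * v‖ ^ 2 = ‖a‖ ^ 2 + 2 * t * (star v * a).re + t ^ 2 * ‖v‖ ^ 2 := by
    intro t
    simp only [← Complex.normSq_eq_norm_sq, Complex.normSq_apply]
    simp
    ring
  let R : ℝ → ℝ := fun t => -2 * t * (star v * X).re + t ^ 2 * Y -
    M * (Real.log (1 - (‖a‖ ^ 2 + 2 * t * (star v * a).re + t ^ 2 * ‖v‖ ^ 2)) -
      Real.log (1 - ‖a‖ ^ 2))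
  have hR0 : R 0 = 0 := by simp [R]
  have hnhds : ∀ᶠ t : ℝ in nhds 0, ‖a + t * v‖ < 1 := by
    have hc : Continuous fun t : ℝ => ‖a + t * v‖ := by fun_prop
    exact hc.tendsto 0 |>.eventually (gt_mem_nhds (by simpa using ha))
  have hlocal : IsLocalMin R 0 := by
    refine hnhds.mono fun t ht => ?_
    rw [hR0]
    have hre : Integrable (fun w : ℂ => (star v * (w / (1 - star a * w))).re) μ :=
      ((integrable_div_one_sub hμ ha).const_mul (star v)).re
    have hreX : ∫ w, (star v * (w / (1 - star a * w))).re ∂μ = (star v * X).re := by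
      rw [hX, ← integral_const_mul]
      exact integral_re ((integrable_div_one_sub hμ ha).const_mul (star v))
    have hsq := integrable_norm_mul_div_one_sub_sq hμ ha v
    have hlog := integrable_log_norm_one_sub_sq hμ ha
    have hint := integral_mono_ae (integrable_log_norm_one_sub_sq hμ ht)
      (hlog.add ((hre.const_mul (-2 * t)).add (hsq.const_mul (t ^ 2))))
      (hμ.mono fun w hw => log_norm_one_sub_sq_le ha ht hw)
    rw [integral_add' hlog ((hre.const_mul (-2 * t)).add (hsq.const_mul (t ^ 2))),
      integral_add' (hre.const_mul (-2 * t)) (hsq.const_mul (t ^ 2)), integral_const_mul,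
      integral_const_mul, hreX, ← hY] at hint
    have hle := hmin _ ht
    simp only [conformalPotential, hexp, ← hM] at hle
    simp only [R]
    linarith
  have hderiv : HasDerivAt R (-2 * (star v * X).re -
      M * (-(2 * (star v * a).re) / (1 - ‖a‖ ^ 2))) 0 := by
    have hid := hasDerivAt_id (0 : ℝ)
    have hinner : HasDerivAt
        (fun t : ℝ => 1 - (‖a‖ ^ 2 + 2 * t * (star v * a).re + t ^ 2 * ‖v‖ ^ 2))
        (-(2 * (star v * a).re)) 0 := by
      have := ((((hid.const_mul 2).mul_const (star v * a).re).const_add (‖a‖ ^ 2)).add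
        ((hid.pow 2).mul_const (‖v‖ ^ 2))).const_sub 1
      exact this.congr_deriv (by simp)
    have hlog := (hinner.log (by simpa using hA.ne')).sub_const (Real.log (1 - ‖a‖ ^ 2))
    have := (((hid.const_mul (-2)).mul_const (star v * X).re).add
      ((hid.pow 2).mul_const Y)).sub (hlog.const_mul M)
    exact this.congr_deriv (by simp)
  have h0 := hlocal.hasDerivAt_eq_zero hderiv
  field_simp at h0
  have : (star v * ((1 - ‖a‖ ^ 2 : ℝ) * X - M * a)).re =
      (1 - ‖a‖ ^ 2) * (star v * X).re - M * (star v * a).re := by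
    rw [mul_sub, mul_left_comm, mul_left_comm (star v), Complex.sub_re, Complex.re_ofReal_mul,
      Complex.re_ofReal_mul]
  rw [this]
  linarith

lemma mobius_neg_eq {a w : ℂ} (ha : ‖a‖ < 1) (hw : ‖w‖ < 1) :
    mobius (-a) w = (1 - ‖a‖ ^ 2 : ℝ) * (w / (1 - star a * w)) - a := by
  have hne : 1 - star a * w ≠ 0 := norm_pos_iff.1 (norm_one_sub_pos ha hw)
  have hsq : ((‖a‖ ^ 2 : ℝ) : ℂ) = a * star a := by
    rw [← Complex.normSq_eq_norm_sq]
    exact Complex.normSq_eq_conj_mul_self.trans (mul_comm _ _)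
  rw [mobius, star_neg, neg_mul, ← sub_eq_add_neg, Complex.ofReal_sub, hsq, Complex.ofReal_one,
    div_eq_iff hne, sub_mul, mul_assoc, div_mul_cancel₀ _ hne]
  ring

/-- Every finite measure carried by the open unit disk has vanishing conformal barycenter as seen
from some point of the disk. -/
theorem exists_integral_mobius_neg_eq_zero [IsFiniteMeasure μ] (hμ : ∀ᵐ w ∂μ, ‖w‖ < 1) :
    ∃ a : ℂ, ‖a‖ < 1 ∧ ∫ w, mobius (-a) w ∂μ = 0 := by
  rcases eq_zero_or_neZero μ with rfl | _
  · exact ⟨0, by simp, by simp⟩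
  obtain ⟨a, ha, hmin⟩ := exists_isMinOn_conformalPotential hμ
  refine ⟨a, ha, ?_⟩
  have hint := integrable_div_one_sub hμ ha
  rw [integral_congr_ae (hμ.mono fun w hw => mobius_neg_eq ha hw),
    integral_sub (hint.const_mul _) (integrable_const _), integral_const_mul, integral_const,
    Complex.real_smul]
  set D := (1 - ‖a‖ ^ 2 : ℝ) * (∫ w, w / (1 - star a * w) ∂μ) - μ.real Set.univ * a with hD
  have h := re_star_mul_eq_zero_of_isMin hμ ha hmin D
  have hsq : star D * D = (Complex.normSq D : ℂ) := Complex.normSq_eq_conj_mul_self.symm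
  rw [← hD, hsq, Complex.ofReal_re] at h
  exact Complex.normSq_eq_zero.1 h

end

lemma one_add_star_mul_ne_zero {a z : ℂ} (ha : ‖a‖ < 1) (hz : ‖z‖ < 1) : 1 + star a * z ≠ 0 := by
  have := norm_pos_iff.1 (norm_one_sub_pos (a := -a) (by simpa using ha) hz)
  simpa using this

lemma norm_mobius_lt_one {a z : ℂ} (ha : ‖a‖ < 1) (hz : ‖z‖ < 1) : ‖mobius a z‖ < 1 := by
  have hne := one_add_star_mul_ne_zero ha hz
  rw [mobius, norm_div, div_lt_one (norm_pos_iff.2 hne)]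
  refine lt_of_pow_lt_pow_left₀ 2 (norm_nonneg _) ?_
  have hprod := mul_pos (one_sub_norm_sq_pos ha) (one_sub_norm_sq_pos hz)
  have hid : ‖1 + star a * z‖ ^ 2 - ‖a + z‖ ^ 2 = (1 - ‖a‖ ^ 2) * (1 - ‖z‖ ^ 2) := by
    simp only [← Complex.normSq_eq_norm_sq, Complex.normSq_apply]
    simp
    ring
  linarith

lemma mobius_neg_mobius {a z : ℂ} (ha : ‖a‖ < 1) (hz : ‖z‖ < 1) :
    mobius (-a) (mobius a z) = z := by
  have hne := one_add_star_mul_ne_zero ha hz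
  rw [mobius_neg_eq ha (norm_mobius_lt_one ha hz)]
  have hA : ((1 - ‖a‖ ^ 2 : ℝ) : ℂ) = 1 - star a * a := by
    rw [Complex.ofReal_sub, ← Complex.normSq_eq_norm_sq, Complex.ofReal_one]
    exact congrArg _ Complex.normSq_eq_conj_mul_self
  have hA0 : 1 - star a * a ≠ 0 := by
    rw [← hA]
    exact_mod_cast (one_sub_norm_sq_pos ha).ne'
  have hden : 1 - star a * mobius a z = (1 - star a * a) / (1 + star a * z) := by
    rw [mobius]
    field_simp
    ring
  rw [hden, hA, mobius]
  field_simp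
  ring

lemma image_mobius_unitDisk {a : ℂ} (ha : ‖a‖ < 1) : mobius a '' unitDisk = unitDisk := by
  have ha' : ‖-a‖ < 1 := by simpa using ha
  ext w
  simp only [Set.mem_image, mem_unitDisk_iff]
  constructor
  · rintro ⟨z, hz, rfl⟩
    exact norm_mobius_lt_one ha hz
  · exact fun hw => ⟨mobius (-a) w, norm_mobius_lt_one ha' hw,
      by simpa using mobius_neg_mobius ha' hw⟩

lemma injOn_mobius_unitDisk {a : ℂ} (ha : ‖a‖ < 1) : Set.InjOn (mobius a) unitDisk :=
  Set.LeftInvOn.injOn (f₁' := mobius (-a)) fun _ hz =>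
    mobius_neg_mobius ha (mem_unitDisk_iff.1 hz)

lemma hasDerivAt_mobius {a z : ℂ} (ha : ‖a‖ < 1) (hz : ‖z‖ < 1) :
    HasDerivAt (mobius a) ((1 - ‖a‖ ^ 2 : ℝ) / (1 + star a * z) ^ 2) z := by
  have hnum := (hasDerivAt_id z).const_add a
  have hden := ((hasDerivAt_id z).const_mul (star a)).const_add 1
  have h := hnum.div hden (one_add_star_mul_ne_zero ha hz)
  refine h.congr_deriv ?_
  rw [Complex.ofReal_sub, ← Complex.normSq_eq_norm_sq, Complex.ofReal_one,
    Complex.normSq_eq_conj_mul_self]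
  simp
  ring

lemma abs_det_restrictScalars_toSpanSingleton (c : ℂ) :
    |((ContinuousLinearMap.toSpanSingleton ℂ c).restrictScalars ℝ).det| = ‖c‖ ^ 2 := by
  simp [ContinuousLinearMap.det, LinearMap.det_restrictScalars, Algebra.norm_complex_eq,
    Complex.normSq_eq_norm_sq]

lemma setIntegral_unitDisk_comp_mobius {a : ℂ} (ha : ‖a‖ < 1) (g : ℂ → ℂ) :
    ∫ w in unitDisk, g w =
      ∫ z in unitDisk, ((1 - ‖a‖ ^ 2) / ‖1 + star a * z‖ ^ 2) ^ 2 • g (mobius a z) := by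
  have hmeas : MeasurableSet unitDisk := Metric.isOpen_ball.measurableSet
  have h := integral_image_eq_integral_abs_det_fderiv_smul volume hmeas
    (fun z hz => ((hasDerivAt_mobius ha (mem_unitDisk_iff.1 hz)).hasFDerivAt.restrictScalars
      ℝ).hasFDerivWithinAt) (injOn_mobius_unitDisk ha) g
  rw [image_mobius_unitDisk ha] at h
  rw [h]
  refine setIntegral_congr_fun hmeas fun z _ => ?_
  rw [abs_det_restrictScalars_toSpanSingleton, norm_div, norm_pow, Complex.norm_real,
    Real.norm_of_nonneg (one_sub_norm_sq_pos ha).le]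

lemma exp_add_two_mul_log {a z : ℂ} (ha : ‖a‖ < 1) (hz : ‖z‖ < 1) (s : ℝ) :
    Real.exp (s + 2 * Real.log ((1 - ‖a‖ ^ 2) / ‖1 + star a * z‖ ^ 2)) =
      ((1 - ‖a‖ ^ 2) / ‖1 + star a * z‖ ^ 2) ^ 2 * Real.exp s := by
  have h1 := one_sub_norm_sq_pos ha
  have h2 := norm_pos_iff.2 (one_add_star_mul_ne_zero ha hz)
  rw [Real.exp_add, two_mul, Real.exp_add, Real.exp_log (by positivity), ← sq, mul_comm]

/-- for every continuous `u` on the closed disk there is `a ∈ 𝔻`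
such that the conformal barycenter vanishes:
`∫_𝔻 z e^{v_a(z)} dz = 0` with `v_a = u ∘ f_a + 2 log|f_a'|`. -/
theorem conformal_barycenter_zero
    (u : ℂ → ℝ) (hu : ContinuousOn u unitClosedDisk) :
    ∃ a ∈ unitDisk,
      (∫ z in unitDisk,
        Real.exp (u (mobius a z) +
          2 * Real.log ((1 - ‖a‖ ^ 2) / ‖1 + star a * z‖ ^ 2)) • z) = (0 : ℂ) := by
  have hmeas : MeasurableSet unitDisk := Metric.isOpen_ball.measurableSet
  have hcont : ContinuousOn (fun w => Real.exp (u w)) unitClosedDisk := hu.rexp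
  have hint : IntegrableOn (fun w => Real.exp (u w)) unitDisk :=
    (hcont.integrableOn_compact (isCompact_closedBall _ _)).mono_set Metric.ball_subset_closedBall
  let μ : Measure ℂ :=
    (volume.restrict unitDisk).withDensity fun w => ENNReal.ofReal (Real.exp (u w))
  have : IsFiniteMeasure μ := isFiniteMeasure_withDensity_ofReal hint.2
  have hμ : ∀ᵐ w ∂μ, ‖w‖ < 1 := (withDensity_absolutelyContinuous _ _).ae_le
    ((ae_restrict_mem hmeas).mono fun w hw => mem_unitDisk_iff.1 hw)
  obtain ⟨a, ha, h0⟩ := exists_integral_mobius_neg_eq_zero hμ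
  refine ⟨a, mem_unitDisk_iff.2 ha, ?_⟩
  rw [integral_withDensity_eq_integral_toReal_smul₀ hint.aemeasurable.ennreal_ofReal
    (ae_of_all _ fun _ => ENNReal.ofReal_lt_top), setIntegral_unitDisk_comp_mobius ha] at h0
  rw [← h0]
  refine setIntegral_congr_fun hmeas fun z hz => ?_
  have hz' := mem_unitDisk_iff.1 hz
  rw [exp_add_two_mul_log ha hz', mobius_neg_mobius ha hz',
    ENNReal.toReal_ofReal (Real.exp_pos _).le, mul_smul]
end
end

section
/- Let 1 < q < 2 and let a_n ∈ 𝔻 with |a_n| → 1 as n → ∞. Then there exists C > 0, independent of n, such that for all n sufficiently large: (i) ∫_𝔻 | f_{a_n}(z) − f_{a_n}(a_n/|a_n|) |^q dz ≤ C (1 − |a_n|)^q, and (ii) ∫_{∂𝔻} | f_{a_n}(z) − f_{a_n}(a_n/|a_n|) |^q dσ(z) ≤ C (1 − |a_n|). -/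
open MeasureTheory Filter

noncomputable section

/-- Radial projection of `a ∈ 𝔻 \ {0}` to the boundary. -/
def bdryPt (a : ℂ) : ℂ := a / (‖a‖ : ℂ)

open scoped ComplexConjugate in
lemma norm_mobius_sub_bdryPt_le {a z : ℂ} (ha0 : 0 < ‖a‖) (ha1 : ‖a‖ < 1) (hz : ‖z‖ ≤ 1) :
    ‖mobius a z - mobius a (bdryPt a)‖ ≤ 4 * (1 + ‖z + bdryPt a‖ / (2 * (1 - ‖a‖)))⁻¹ := by
  obtain ⟨r, hr⟩ : ∃ r, r = ‖a‖ := ⟨_, rfl⟩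
  obtain ⟨e, he⟩ : ∃ e, e = bdryPt a := ⟨_, rfl⟩
  rw [← hr] at ha0 ha1
  have hrC : (r : ℂ) ≠ 0 := by exact_mod_cast ha0.ne'
  have hae : a = r * e := by
    rw [he, bdryPt, ← hr]; field_simp
  have hen : ‖e‖ = 1 := by
    have h := congrArg norm hae
    rw [norm_mul, Complex.norm_real, Real.norm_of_nonneg ha0.le, ← hr] at h
    exact mul_left_cancel₀ ha0.ne' (by linarith)
  have hee : conj e * e = 1 := by
    rw [mul_comm, Complex.mul_conj, Complex.normSq_eq_norm_sq, hen]; simp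
  rw [← he, ← hr]
  have hstar : star a = r * conj e := by
    rw [hae]; simp
  have hwn : ‖conj e * z‖ ≤ 1 := by
    rw [norm_mul, RCLike.norm_conj, hen, one_mul]; exact hz
  have hδ : 0 < 1 - r := by linarith
  have hlow : 1 - r ≤ ‖1 + star a * z‖ := by
    have h1 : ‖star a * z‖ ≤ r := by
      rw [hstar, mul_assoc, norm_mul, Complex.norm_real, Real.norm_of_nonneg ha0.le]
      nlinarith
    have h2 := norm_sub_le (1 + star a * z) (star a * z)
    simp only [add_sub_cancel_right, norm_one] at h2
    linarith
  have hdist : ‖z + e‖ ≤ 2 * ‖1 + star a * z‖ := by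
    have h1 : ‖z + e‖ = ‖(1 + star a * z) + ((1 - r : ℝ) : ℂ) * (conj e * z)‖ := by
      have : (1 + star a * z) + ((1 - r : ℝ) : ℂ) * (conj e * z) = conj e * (z + e) := by
        rw [hstar]; push_cast; linear_combination -hee
      rw [this, norm_mul, RCLike.norm_conj, hen, one_mul]
    have h2 : ‖((1 - r : ℝ) : ℂ) * (conj e * z)‖ ≤ 1 - r := by
      rw [norm_mul, Complex.norm_real, Real.norm_of_nonneg hδ.le]
      nlinarith
    have h3 := norm_add_le (1 + star a * z) (((1 - r : ℝ) : ℂ) * (conj e * z))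
    linarith
  have hN : 0 < ‖1 + star a * z‖ := hδ.trans_le hlow
  have hden : 1 + star a * z ≠ 0 := norm_pos_iff.mp hN
  have hden' : 1 + (r : ℂ) ≠ 0 := by
    have : (1 + r : ℝ) ≠ 0 := by positivity
    exact_mod_cast this
  have hfe : mobius a e = e := by
    have h1 : 1 + star a * e = 1 + r := by rw [hstar]; linear_combination r * hee
    rw [mobius, h1, hae]; field_simp; ring
  have hdiff : mobius a z - mobius a e = ((1 - r : ℝ) : ℂ) * ((z - e) / (1 + star a * z)) := by
    rw [hfe, mobius, ← mul_div_assoc, eq_div_iff hden, sub_mul, div_mul_cancel₀ _ hden, hstar, hae]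
    push_cast
    linear_combination (-(r : ℂ) * z) * hee
  rw [hdiff, norm_mul, norm_div, Complex.norm_real, Real.norm_of_nonneg hδ.le]
  have hze : ‖z - e‖ ≤ 2 := (norm_sub_le z e).trans (by linarith)
  have hs : 0 < 1 + ‖z + e‖ / (2 * (1 - r)) := by positivity
  rw [← div_eq_mul_inv, le_div_iff₀ hs]
  calc (1 - r) * (‖z - e‖ / ‖1 + star a * z‖) * (1 + ‖z + e‖ / (2 * (1 - r)))
      = ‖z - e‖ * ((1 - r) + ‖z + e‖ / 2) / ‖1 + star a * z‖ := by field_simp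
    _ ≤ 4 := by
      rw [div_le_iff₀ hN]
      have : (1 - r) + ‖z + e‖ / 2 ≤ 2 * ‖1 + star a * z‖ := by linarith
      calc ‖z - e‖ * ((1 - r) + ‖z + e‖ / 2) ≤ 2 * (2 * ‖1 + star a * z‖) := by gcongr
        _ = 4 * ‖1 + star a * z‖ := by ring

lemma norm_bdryPt {a : ℂ} (ha : 0 < ‖a‖) : ‖bdryPt a‖ = 1 := by
  rw [bdryPt, norm_div, Complex.norm_real, norm_norm, div_self ha.ne']

/-- The arc-length parametrization of the unit circle starting at `e` is `1`-Lipschitz. -/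
lemma lipschitzWith_mul_exp {e : ℂ} (he : ‖e‖ = 1) :
    LipschitzWith 1 (fun θ : ℝ => e * Complex.exp (Complex.I * θ)) := by
  refine LipschitzWith.of_dist_le_mul fun x y => ?_
  have : e * Complex.exp (Complex.I * x) - e * Complex.exp (Complex.I * y)
      = e * Complex.exp (Complex.I * y) * (Complex.exp (Complex.I * (x - y : ℝ)) - 1) := by
    rw [mul_sub, mul_assoc, ← Complex.exp_add]
    push_cast
    ring_nf
  rw [dist_eq_norm, this, norm_mul, norm_mul, he, Complex.norm_exp_I_mul_ofReal, dist_eq_norm]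
  simpa using Real.norm_exp_I_mul_ofReal_sub_one_le (x := x - y)

lemma arcMeasure_restrict_unitCircle_le {e : ℂ} (he : ‖e‖ = 1) :
    arcMeasure.restrict unitCircle ≤
      (volume.restrict (Set.Ioc (-Real.pi) Real.pi)).map
        (fun θ : ℝ => e * Complex.exp (Complex.I * θ)) := by
  have hL := lipschitzWith_mul_exp he
  refine Measure.le_iff.mpr fun s hs => ?_
  rw [Measure.restrict_apply hs, Measure.map_apply hL.continuous.measurable hs,
    Measure.restrict_apply (hL.continuous.measurable hs)]
  have hsub : s ∩ unitCircle ⊆ (fun θ : ℝ => e * Complex.exp (Complex.I * θ)) ''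
      ((fun θ : ℝ => e * Complex.exp (Complex.I * θ)) ⁻¹' s ∩
        Set.Ioc (-Real.pi) Real.pi) := by
    rintro z ⟨hzs, hz⟩
    have hz1 : ‖z‖ = 1 := by simpa [unitCircle] using hz
    have he0 : e ≠ 0 := norm_pos_iff.mp (by rw [he]; exact one_pos)
    have key : e * Complex.exp (Complex.I * (z / e).arg) = z := by
      have h := Complex.norm_mul_exp_arg_mul_I (z / e)
      rw [norm_div, hz1, he, div_one, Complex.ofReal_one, one_mul, mul_comm _ Complex.I] at h
      rw [h]; field_simp
    exact ⟨(z / e).arg, ⟨by simpa only [Set.mem_preimage, key] using hzs,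
      Complex.arg_mem_Ioc _⟩, key⟩
  refine (measure_mono hsub).trans ?_
  have h := hL.hausdorffMeasure_image_le zero_le_one
    ((fun θ : ℝ => e * Complex.exp (Complex.I * θ)) ⁻¹' s ∩ Set.Ioc (-Real.pi) Real.pi)
  simpa [arcMeasure, hausdorffMeasure_real] using h

lemma abs_div_pi_le_norm_exp_sub_one {θ : ℝ} (hθ : |θ| ≤ Real.pi) :
    2 * (|θ| / Real.pi) ≤ ‖Complex.exp (Complex.I * θ) - 1‖ := by
  rw [Complex.norm_exp_I_mul_ofReal_sub_one, Real.norm_eq_abs, abs_mul, abs_two]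
  have h := Real.mul_abs_le_abs_sin (x := θ / 2) (by rw [abs_div, abs_two]; linarith)
  rw [abs_div, abs_two] at h
  have : 2 / Real.pi * (|θ| / 2) = |θ| / Real.pi := by field_simp
  linarith

lemma setIntegral_unitDisk_mobius_le {q : ℝ} (hq0 : 0 < q) (hq2 : q < 2) {a : ℂ}
    (ha0 : 0 < ‖a‖) (ha1 : ‖a‖ < 1) :
    ∫ z in unitDisk, ‖mobius a z - mobius a (bdryPt a)‖ ^ q
      ≤ 8 ^ q * (∫ z in Metric.ball (0 : ℂ) 2, ‖z‖ ^ (-q)) * (1 - ‖a‖) ^ q := by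
  have hδ : 0 < 1 - ‖a‖ := by linarith
  have he := norm_bdryPt ha0
  have hball : Integrable ((Metric.ball (0 : ℂ) 2).indicator fun z => ‖z‖ ^ (-q)) := by
    rw [integrable_indicator_iff measurableSet_ball]
    refine integrableOn_ball_of_norm_le_rpow (C := 1) (α := q) (by simp) (by simpa using hq2)
      (ae_of_all _ fun z => ?_) (Measurable.aestronglyMeasurable (by fun_prop))
    rw [Real.norm_of_nonneg (by positivity), one_mul]
  have hball' := (hball.comp_add_right (bdryPt a)).const_mul (8 ^ q * (1 - ‖a‖) ^ q)
  calc ∫ z in unitDisk, ‖mobius a z - mobius a (bdryPt a)‖ ^ q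
      ≤ ∫ z in unitDisk, 8 ^ q * (1 - ‖a‖) ^ q *
          (Metric.ball (0 : ℂ) 2).indicator (fun z => ‖z‖ ^ (-q)) (z + bdryPt a) := by
        refine integral_mono_of_nonneg (ae_of_all _ fun z => by positivity) hball'.integrableOn
          ((ae_restrict_iff' measurableSet_ball).mpr (ae_of_all _ fun z hz => ?_))
        have hz1 : ‖z‖ < 1 := by simpa using hz
        have hmem : z + bdryPt a ∈ Metric.ball (0 : ℂ) 2 := by
          rw [mem_ball_zero_iff]
          exact (norm_add_le _ _).trans_lt (by linarith)
        have hs : 0 < ‖z + bdryPt a‖ := by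
          rw [norm_pos_iff]
          intro h
          rw [eq_neg_of_add_eq_zero_left h, norm_neg, he] at hz1
          exact lt_irrefl _ hz1
        beta_reduce
        rw [Set.indicator_of_mem hmem, Real.rpow_neg hs.le, ← Real.inv_rpow hs.le,
          ← Real.mul_rpow (by norm_num) hδ.le, ← Real.mul_rpow (by positivity) (by positivity)]
        refine Real.rpow_le_rpow (norm_nonneg _) ?_ hq0.le
        refine (norm_mobius_sub_bdryPt_le ha0 ha1 hz1.le).trans ?_
        calc 4 * (1 + ‖z + bdryPt a‖ / (2 * (1 - ‖a‖)))⁻¹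
            ≤ 4 * (‖z + bdryPt a‖ / (2 * (1 - ‖a‖)))⁻¹ := by gcongr; linarith
          _ = 8 * (1 - ‖a‖) * ‖z + bdryPt a‖⁻¹ := by field_simp; norm_num
    _ ≤ ∫ z, 8 ^ q * (1 - ‖a‖) ^ q *
          (Metric.ball (0 : ℂ) 2).indicator (fun z => ‖z‖ ^ (-q)) (z + bdryPt a) := by
        refine setIntegral_le_integral hball' (ae_of_all _ fun z => ?_)
        exact mul_nonneg (by positivity) (Set.indicator_nonneg (fun _ _ => by positivity) _)
    _ = 8 ^ q * (∫ z in Metric.ball (0 : ℂ) 2, ‖z‖ ^ (-q)) * (1 - ‖a‖) ^ q := by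
        rw [integral_const_mul, integral_add_right_eq_self
          ((Metric.ball (0 : ℂ) 2).indicator fun z => ‖z‖ ^ (-q)),
          integral_indicator measurableSet_ball]
        ring

lemma setIntegral_unitCircle_mobius_le {q : ℝ} (hq1 : 1 < q) {a : ℂ}
    (ha0 : 0 < ‖a‖) (ha1 : ‖a‖ < 1) :
    ∫ z in unitCircle, ‖mobius a z - mobius a (bdryPt a)‖ ^ q ∂arcMeasure
      ≤ 4 ^ q * Real.pi * (∫ t : ℝ, (1 + ‖t‖) ^ (-q)) * (1 - ‖a‖) := by
  have hδ : 0 < 1 - ‖a‖ := by linarith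
  have hπ := Real.pi_pos
  have he : ‖-bdryPt a‖ = 1 := by rw [norm_neg, norm_bdryPt ha0]
  set γ : ℝ → ℂ := fun θ => -bdryPt a * Complex.exp (Complex.I * θ) with hγ
  set H : ℂ → ℝ := fun z => 4 ^ q * (1 + ‖z + bdryPt a‖ / (2 * (1 - ‖a‖))) ^ (-q) with hH
  have hγc : Continuous γ := (lipschitzWith_mul_exp he).continuous
  have hH0 : ∀ z, 0 ≤ H z := fun z => by positivity
  have hHm : Measurable H := by fun_prop
  have hgi : Integrable fun θ : ℝ => 4 ^ q * (1 + ‖θ / (Real.pi * (1 - ‖a‖))‖) ^ (-q) :=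
    ((integrable_one_add_norm (E := ℝ) (by simpa using hq1)).comp_div
      (by positivity)).const_mul _
  have hle : ∀ᵐ θ ∂volume.restrict (Set.Ioc (-Real.pi) Real.pi),
      H (γ θ) ≤ 4 ^ q * (1 + ‖θ / (Real.pi * (1 - ‖a‖))‖) ^ (-q) := by
    refine (ae_restrict_iff' measurableSet_Ioc).mpr (ae_of_all _ fun θ hθ => ?_)
    have habs : |θ| ≤ Real.pi := abs_le.mpr ⟨hθ.1.le, hθ.2⟩
    have hs : ‖γ θ + bdryPt a‖ = ‖Complex.exp (Complex.I * θ) - 1‖ := by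
      rw [show γ θ + bdryPt a = -bdryPt a * (Complex.exp (Complex.I * θ) - 1) by
        simp only [hγ]; ring, norm_mul, he, one_mul]
    have h := abs_div_pi_le_norm_exp_sub_one habs
    simp only [hH, hs]
    refine mul_le_mul_of_nonneg_left ?_ (by positivity)
    refine Real.rpow_le_rpow_of_nonpos (by positivity) ?_ (by linarith)
    rw [Real.norm_eq_abs, abs_div, abs_of_pos (mul_pos hπ hδ)]
    calc 1 + |θ| / (Real.pi * (1 - ‖a‖))
        = 1 + 2 * (|θ| / Real.pi) / (2 * (1 - ‖a‖)) := by field_simp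
      _ ≤ _ := by gcongr
  have hHi : Integrable H ((volume.restrict (Set.Ioc (-Real.pi) Real.pi)).map γ) := by
    rw [integrable_map_measure hHm.aestronglyMeasurable hγc.aemeasurable]
    refine hgi.integrableOn.mono' (hHm.comp hγc.measurable).aestronglyMeasurable ?_
    filter_upwards [hle] with θ hθ
    rwa [Function.comp_apply, Real.norm_of_nonneg (hH0 _)]
  have hμ : arcMeasure.restrict unitCircle ≤
      (volume.restrict (Set.Ioc (-Real.pi) Real.pi)).map γ :=
    arcMeasure_restrict_unitCircle_le he
  calc ∫ z in unitCircle, ‖mobius a z - mobius a (bdryPt a)‖ ^ q ∂arcMeasure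
      ≤ ∫ z in unitCircle, H z ∂arcMeasure := by
        refine integral_mono_of_nonneg (ae_of_all _ fun z => by positivity)
          (hHi.mono_measure hμ)
          ((ae_restrict_iff' Metric.isClosed_sphere.measurableSet).mpr
            (ae_of_all _ fun z hz => ?_))
        have hz1 : ‖z‖ = 1 := by simpa using hz
        refine (Real.rpow_le_rpow (norm_nonneg _)
          (norm_mobius_sub_bdryPt_le ha0 ha1 hz1.le) (by linarith)).trans_eq ?_
        rw [Real.mul_rpow (by norm_num) (by positivity), Real.inv_rpow (by positivity),
          ← Real.rpow_neg (by positivity)]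
    _ ≤ ∫ z, H z ∂((volume.restrict (Set.Ioc (-Real.pi) Real.pi)).map γ) :=
        integral_mono_measure hμ (ae_of_all _ hH0) hHi
    _ = ∫ θ in Set.Ioc (-Real.pi) Real.pi, H (γ θ) :=
        integral_map hγc.aemeasurable hHm.aestronglyMeasurable
    _ ≤ ∫ θ in Set.Ioc (-Real.pi) Real.pi,
          4 ^ q * (1 + ‖θ / (Real.pi * (1 - ‖a‖))‖) ^ (-q) :=
        integral_mono_of_nonneg (ae_of_all _ fun θ => hH0 _) hgi.integrableOn hle
    _ ≤ ∫ θ : ℝ, 4 ^ q * (1 + ‖θ / (Real.pi * (1 - ‖a‖))‖) ^ (-q) :=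
        setIntegral_le_integral hgi (ae_of_all _ fun θ => by positivity)
    _ = 4 ^ q * Real.pi * (∫ t : ℝ, (1 + ‖t‖) ^ (-q)) * (1 - ‖a‖) := by
        rw [integral_const_mul, Measure.integral_comp_div (fun t : ℝ => (1 + ‖t‖) ^ (-q)),
          abs_of_pos (mul_pos hπ hδ), smul_eq_mul]
        ring

/-- `L^q` estimates for the Möbius maps: for `1 < q < 2` and
`aₙ ∈ 𝔻` with `|aₙ| → 1`,
`∫_𝔻 |f_{aₙ}(z) - f_{aₙ}(aₙ/|aₙ|)|^q ≤ C (1-|aₙ|)^q` and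
`∫_{∂𝔻} |f_{aₙ}(z) - f_{aₙ}(aₙ/|aₙ|)|^q ≤ C (1-|aₙ|)` for large `n`. -/
theorem mobius_lq_estimates
    (q : ℝ) (hq1 : 1 < q) (hq2 : q < 2)
    (a : ℕ → ℂ) (ha : ∀ n, a n ∈ unitDisk)
    (hnorm : Filter.Tendsto (fun n => ‖a n‖) Filter.atTop (nhds 1)) :
    ∃ C > 0, ∀ᶠ n in Filter.atTop,
      (∫ z in unitDisk,
        ‖mobius (a n) z - mobius (a n) (bdryPt (a n))‖ ^ q)
        ≤ C * (1 - ‖a n‖) ^ q ∧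
      (∫ z in unitCircle,
        ‖mobius (a n) z - mobius (a n) (bdryPt (a n))‖ ^ q ∂arcMeasure)
        ≤ C * (1 - ‖a n‖) := by
  have hI : 0 ≤ ∫ z in Metric.ball (0 : ℂ) 2, ‖z‖ ^ (-q) :=
    integral_nonneg fun _ => by positivity
  have hJ : 0 ≤ ∫ t : ℝ, (1 + ‖t‖) ^ (-q) := integral_nonneg fun _ => by positivity
  have hπ := Real.pi_pos
  refine ⟨8 ^ q * (∫ z in Metric.ball (0 : ℂ) 2, ‖z‖ ^ (-q)) +
    4 ^ q * Real.pi * (∫ t : ℝ, (1 + ‖t‖) ^ (-q)) + 1, by positivity, ?_⟩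
  filter_upwards [hnorm.eventually_const_lt one_pos] with n ha0
  have ha1 : ‖a n‖ < 1 := by simpa [unitDisk] using ha n
  have hδ : 0 < 1 - ‖a n‖ := by linarith
  constructor
  · refine (setIntegral_unitDisk_mobius_le (by linarith) hq2 ha0 ha1).trans ?_
    refine mul_le_mul_of_nonneg_right ?_ (by positivity)
    have : 0 ≤ 4 ^ q * Real.pi * (∫ t : ℝ, (1 + ‖t‖) ^ (-q)) := by positivity
    linarith
  · refine (setIntegral_unitCircle_mobius_le hq1 ha0 ha1).trans ?_
    refine mul_le_mul_of_nonneg_right ?_ hδ.le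
    have : 0 ≤ 8 ^ q * (∫ z in Metric.ball (0 : ℂ) 2, ‖z‖ ^ (-q)) := by positivity
    linarith
end
end
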